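/- arXiv:2111.08855 — 2 statements merged into one kernel-verified Lean document; each statement's English description precedes it below -/
import Mathlib

section
/- If f : A → A is a C¹ diffeomorphism of the standard annulus which maps each boundary component to itself, is a twist map, and admits a positive integral invariant, then f has at least two fixed points. -/
open Set MeasureTheory

noncomputable section

/-- The cylinder `(ℝ/ℤ) × ℝ`, in which the standard annulus sits. -/
abbrev Cyl : Type := AddCircle (1 : ℝ) × ℝ

/-- The standard annulus `A = (ℝ/ℤ) × [0,1]`, viewed inside the cylinder. -/
def annA : Set Cyl := Set.univ ×ˢ Set.Icc (0 : ℝ) 1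

/-- The universal cover `Ã = ℝ × [0,1]`, viewed inside `ℝ²`. -/
def stripA : Set (ℝ × ℝ) := Set.univ ×ˢ Set.Icc (0 : ℝ) 1

/-- The covering projection `π(x, y) = (x mod 1, y)`. -/
def covProj (p : ℝ × ℝ) : Cyl := ((p.1 : AddCircle (1 : ℝ)), p.2)

theorem pb_log_lift {X : Type*} [TopologicalSpace X] [SimplyConnectedSpace X]
    [LocallyPathConnectedSpace X] (w : X → ℂ) (hw : Continuous w) (h0 : ∀ x, w x ≠ 0) :
    ∃ l : X → ℂ, Continuous l ∧ ∀ x, Complex.exp (l x) = w x := by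
  obtain ⟨a⟩ : Nonempty X := inferInstance
  obtain ⟨l, ⟨-, hl⟩, -⟩ := Complex.isCoveringMapOn_exp.existsUnique_continuousMap_lifts
    (⟨w, hw⟩ : C(X, ℂ)) (a₀ := a) (e₀ := Complex.log (w a)) (Complex.exp_log (h0 a))
    (fun x => h0 x)
  exact ⟨l, l.continuous, fun x => congrFun hl x⟩

theorem pb_log_unique {X : Type*} [TopologicalSpace X] {S : Set X} (hS : IsPreconnected S)
    {l1 l2 : X → ℂ} (h1 : ContinuousOn l1 S) (h2 : ContinuousOn l2 S)
    (h : ∀ x ∈ S, Complex.exp (l1 x) = Complex.exp (l2 x)) {a b : X} (ha : a ∈ S) (hb : b ∈ S) :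
    l1 a - l2 a = l1 b - l2 b := by
  have hd : DiscreteTopology (Complex.exp ⁻¹' {1}) :=
    (Complex.isCoveringMapOn_exp 1 (by simp)).1
  refine hS.constant_of_mapsTo (T := Complex.exp ⁻¹' {1}) ⟨hd⟩ (h1.sub h2) ?_ ha hb
  intro x hx
  simp [Complex.exp_sub, h x hx, div_self (Complex.exp_ne_zero _)]

/-- the displacement as a complex number -/
def pbC (p : ℝ × ℝ) : ℂ := ⟨p.1, p.2⟩

theorem pbC_cont : Continuous pbC := by
  have : pbC = fun p : ℝ × ℝ => (p.1 : ℂ) + p.2 * Complex.I := by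
    funext p; apply Complex.ext <;> simp [pbC]
  rw [this]; fun_prop

theorem pbC_eq_zero {p : ℝ × ℝ} : pbC p = 0 ↔ p = 0 := by
  simp [pbC, Complex.ext_iff, Prod.ext_iff]

theorem pbC_sub (p q : ℝ × ℝ) : pbC (p - q) = pbC p - pbC q := by
  apply Complex.ext <;> simp [pbC]

/-- branch of the logarithm on the closed upper half plane -/
def pbA (v : ℂ) : ℂ := Complex.log (-Complex.I * v) + Complex.I * (Real.pi / 2)

theorem pbA_exp {v : ℂ} (hv : v ≠ 0) : Complex.exp (pbA v) = v := by
  rw [pbA, Complex.exp_add, Complex.exp_log (by simp [hv])]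
  have : Complex.I * (Real.pi / 2) = (Real.pi / 2) * Complex.I := by ring
  rw [this, Complex.exp_pi_div_two_mul_I]
  linear_combination (-v) * Complex.I_mul_I

theorem pbA_slit {v : ℂ} (hv : v ≠ 0) (h : 0 ≤ v.im) : -Complex.I * v ∈ Complex.slitPlane := by
  rw [Complex.mem_slitPlane_iff]
  by_contra hc
  push Not at hc
  apply hv
  apply Complex.ext
  · have := hc.2; simpa using this
  · have := hc.1; simp at this; simp; linarith

theorem pbA_contOn {X : Type*} [TopologicalSpace X] {S : Set X} {w : X → ℂ}
    (hw : ContinuousOn w S) (h0 : ∀ x ∈ S, w x ≠ 0) (hi : ∀ x ∈ S, 0 ≤ (w x).im) :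
    ContinuousOn (fun x => pbA (w x)) S := by
  unfold pbA
  refine ContinuousOn.add (ContinuousOn.clog (continuousOn_const.mul hw) ?_) continuousOn_const
  intro x hx
  exact pbA_slit (h0 x hx) (hi x hx)

theorem pbA_mul {v w : ℂ} (hv : v ≠ 0) (h : 0 ≤ v.im) (hw : 0 < (w / v).re) :
    pbA w = pbA v + Complex.log (w / v) := by
  have hw0 : w / v ≠ 0 := by
    intro hh; rw [hh] at hw; simp at hw
  have e : -Complex.I * w = (-Complex.I * v) * (w / v) := by field_simp
  unfold pbA
  rw [e, Complex.log_mul]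
  · ring
  · simp [hv]
  · exact hw0
  · have h1 : |(-Complex.I * v).arg| ≤ Real.pi / 2 := by
      rw [Complex.abs_arg_le_pi_div_two_iff]; simpa using h
    have h2 : |(w / v).arg| < Real.pi / 2 := by
      rw [Complex.abs_arg_lt_pi_div_two_iff]; left; exact hw
    rw [abs_le] at h1
    rw [abs_lt] at h2
    constructor <;> linarith [h1.1, h1.2, h2.1, h2.2]

theorem pbA_pos {v : ℂ} (h : 0 < v.re) (hi : v.im = 0) : (pbA v).im = 0 := by
  have : -Complex.I * v = (v.re : ℝ) * (-Complex.I) := by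
    apply Complex.ext <;> simp [hi]
  rw [pbA, this]
  rw [Complex.add_im, Complex.log_im, Complex.arg_real_mul _ h, Complex.arg_neg_I]
  simp

theorem pbA_neg {v : ℂ} (h : v.re < 0) (hi : v.im = 0) : (pbA v).im = Real.pi := by
  have : -Complex.I * v = ((-v.re : ℝ) : ℂ) * (Complex.I) := by
    apply Complex.ext <;> simp [hi]
  rw [pbA, this]
  rw [Complex.add_im, Complex.log_im, Complex.arg_real_mul _ (by linarith), Complex.arg_I]
  simp

/-- fibrewise homeomorphism -/
theorem pb_fiber_homeo (h : ℝ × ℝ → ℝ) (hc : Continuous h) (c : ℝ) (hcpos : 0 < c)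
    (hexp : ∀ x y y', y ≤ y' → c * (y' - y) ≤ h (x, y') - h (x, y)) :
    ∃ Φ : (ℝ × ℝ) ≃ₜ (ℝ × ℝ), ∀ p, Φ p = (p.1, h p) := by
  have hmono : ∀ x, StrictMono (fun y => h (x, y)) := by
    intro x y y' hy
    have := hexp x y y' hy.le
    have h2 : 0 < c * (y' - y) := mul_pos hcpos (by linarith)
    simp only; linarith
  have hsurj : ∀ x, Function.Surjective (fun y => h (x, y)) := by
    intro x
    have hcx : Continuous (fun y => h (x, y)) := by fun_prop
    refine hcx.surjective ?_ ?_
    · refine Filter.tendsto_atTop_mono' _ ?_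
        (Filter.tendsto_atTop_add_const_right _ (h (x, 0))
          (Filter.tendsto_id.const_mul_atTop hcpos))
      filter_upwards [Filter.eventually_ge_atTop (0:ℝ)] with y hy
      have := hexp x 0 y hy
      simp only [id]; linarith
    · refine Filter.tendsto_atBot_mono' _ ?_
        (Filter.tendsto_atBot_add_const_right _ (h (x, 0))
          (Filter.tendsto_id.const_mul_atBot hcpos))
      filter_upwards [Filter.eventually_le_atBot (0:ℝ)] with y hy
      have := hexp x y 0 hy
      simp only [id]; linarith
  choose k hk using hsurj
  have hk' : ∀ x y, k x (h (x, y)) = y := fun x y => (hmono x).injective (hk x _)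
  have habs : ∀ x y y', c * |y' - y| ≤ |h (x, y') - h (x, y)| := by
    intro x y y'
    rcases le_total y y' with hy | hy
    · rw [abs_of_nonneg (by linarith : (0:ℝ) ≤ y' - y)]
      exact (hexp x y y' hy).trans (le_abs_self _)
    · rw [abs_sub_comm y', abs_sub_comm (h (x, y')), abs_of_nonneg (by linarith : (0:ℝ) ≤ y - y')]
      exact (hexp x y' y hy).trans (le_abs_self _)
  have hkc : Continuous (fun p : ℝ × ℝ => k p.1 p.2) := by
    rw [continuous_iff_continuousAt]
    intro p
    have hb : ∀ q : ℝ × ℝ, |k q.1 q.2 - k p.1 p.2| ≤ c⁻¹ * |q.2 - h (q.1, k p.1 p.2)| := by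
      intro q
      have := habs q.1 (k p.1 p.2) (k q.1 q.2)
      have e : h (q.1, k q.1 q.2) = q.2 := hk q.1 q.2
      rw [e] at this
      rw [inv_mul_eq_div, le_div_iff₀ hcpos]; linarith
    have ht : Filter.Tendsto (fun q : ℝ × ℝ => c⁻¹ * |q.2 - h (q.1, k p.1 p.2)|) (nhds p) (nhds 0) := by
      have hcc : Continuous (fun q : ℝ × ℝ => c⁻¹ * |q.2 - h (q.1, k p.1 p.2)|) := by fun_prop
      have := hcc.tendsto p
      have e : h (p.1, k p.1 p.2) = p.2 := hk p.1 p.2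
      simpa [e] using this
    rw [ContinuousAt, tendsto_iff_dist_tendsto_zero]
    refine squeeze_zero (fun _ => dist_nonneg) (fun q => ?_) ht
    rw [Real.dist_eq]; exact hb q
  refine ⟨{ toFun := fun p => (p.1, h p), invFun := fun p => (p.1, k p.1 p.2),
            left_inv := fun p => ?_, right_inv := fun p => ?_,
            continuous_toFun := by fun_prop, continuous_invFun := by fun_prop }, fun p => rfl⟩
  · exact Prod.ext rfl (hk' p.1 p.2)
  · exact Prod.ext rfl (hk p.1 p.2)

/-- vertical cumulative mass -/
def pbR (ρ : Cyl → ℝ) (z : Cyl) : ℝ :=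
  min z.2 0 + max (z.2 - 1) 0 + ∫ s in (0:ℝ)..(max 0 (min z.2 1)), ρ (z.1, s)

theorem pbR_cont {ρ : Cyl → ℝ} (hρ : Continuous ρ) : Continuous (pbR ρ) := by
  unfold pbR
  have : Continuous fun z : Cyl => ∫ s in (0:ℝ)..(max 0 (min z.2 1)), ρ (z.1, s) := by
    apply intervalIntegral.continuous_parametric_intervalIntegral_of_continuous
      (f := fun (z : Cyl) s => ρ (z.1, s))
    · fun_prop
    · fun_prop
  fun_prop

theorem pbR_nonpos (ρ : Cyl → ℝ) (x : AddCircle (1:ℝ)) {y : ℝ} (hy : y ≤ 0) :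
    pbR ρ (x, y) = y := by
  have h1 : max (y - 1) 0 = 0 := max_eq_right (by linarith)
  have h2 : max 0 (min y 1) = 0 := max_eq_left ((min_le_left _ _).trans hy)
  simp [pbR, min_eq_left hy, h1, h2]

theorem pbR_mid (ρ : Cyl → ℝ) (x : AddCircle (1:ℝ)) {y : ℝ} (h0 : 0 ≤ y) (h1 : y ≤ 1) :
    pbR ρ (x, y) = ∫ s in (0:ℝ)..y, ρ (x, s) := by
  have h2 : max (y - 1) 0 = 0 := max_eq_right (by linarith)
  simp [pbR, h0, h1]

theorem pbR_ge (ρ : Cyl → ℝ) (x : AddCircle (1:ℝ)) {y : ℝ} (h1 : 1 ≤ y) :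
    pbR ρ (x, y) = pbR ρ (x, 1) + (y - 1) := by
  have e : max (y - 1) 0 = y - 1 := max_eq_left (by linarith)
  have e2 : min y 0 = 0 := min_eq_right (by linarith)
  have e3 : min y 1 = 1 := min_eq_right h1
  simp [pbR, e, e2, e3]; ring

theorem pbR_exp {ρ : Cyl → ℝ} (hρ : Continuous ρ) {δ : ℝ} (hδ1 : δ ≤ 1)
    (hδ : ∀ z, δ ≤ ρ z) (x : AddCircle (1:ℝ)) {y y' : ℝ} (hy : y ≤ y') :
    δ * (y' - y) ≤ pbR ρ (x, y') - pbR ρ (x, y) := by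
  have hcx : Continuous fun s => ρ (x, s) := by fun_prop
  set a := max 0 (min y 1) with ha
  set b := max 0 (min y' 1) with hb
  have hab : a ≤ b := max_le_max le_rfl (min_le_min hy le_rfl)
  have e1 : (∫ s in (0:ℝ)..b, ρ (x, s)) - ∫ s in (0:ℝ)..a, ρ (x, s) = ∫ s in a..b, ρ (x, s) :=
    intervalIntegral.integral_interval_sub_left (hcx.intervalIntegrable _ _)
      (hcx.intervalIntegrable _ _)
  have e2 : δ * (b - a) ≤ ∫ s in a..b, ρ (x, s) := by
    have := intervalIntegral.integral_mono_on hab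
      (continuous_const.intervalIntegrable (μ := volume) a b)
      (hcx.intervalIntegrable (μ := volume) a b) (fun s _ => hδ (x, s))
    simp at this; linarith
  have m1 : min y 0 ≤ min y' 0 := min_le_min hy le_rfl
  have m2 : max (y - 1) 0 ≤ max (y' - 1) 0 := max_le_max (by linarith) le_rfl
  have dec : ∀ t : ℝ, t = min t 0 + max (t - 1) 0 + max 0 (min t 1) := by
    intro t
    rcases le_total t 0 with h | h
    · rw [min_eq_left h, max_eq_right (by linarith), min_eq_left (by linarith), max_eq_left h]; ring
    · rcases le_total t 1 with h' | h'
      · rw [min_eq_right h, max_eq_right (by linarith), min_eq_left h', max_eq_right h]; ring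
      · rw [min_eq_right h, max_eq_left (by linarith), min_eq_right h', max_eq_right (by linarith)]
        ring
  have d1 := dec y
  have d2 := dec y'
  rw [← ha] at d1
  rw [← hb] at d2
  simp only [pbR]
  rw [← ha, ← hb]
  nlinarith

theorem pbR_vol {ρ : Cyl → ℝ} (hρ : Continuous ρ) {δ : ℝ} (hδ0 : 0 < δ) (hδ1 : δ ≤ 1)
    (hδ : ∀ z, δ ≤ ρ z) (x : AddCircle (1:ℝ)) {S : Set ℝ} (hS : MeasurableSet S)
    (hS1 : S ⊆ Icc 0 1) :
    ∫⁻ y in S, ENNReal.ofReal (ρ (x, y)) = volume ((fun y => pbR ρ (x, y)) '' S) := by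
  have hcx : Continuous fun s => ρ (x, s) := by fun_prop
  apply lintegral_deriv_eq_volume_image_of_monotoneOn hS
  · intro y hy
    have h1 : HasDerivAt (fun u => ∫ s in (0:ℝ)..u, ρ (x, s)) (ρ (x, y)) y :=
      intervalIntegral.integral_hasDerivAt_right (hcx.intervalIntegrable _ _)
        hcx.aestronglyMeasurable.stronglyMeasurableAtFilter hcx.continuousAt
    refine h1.hasDerivWithinAt.congr ?_ ?_
    · intro u hu; exact pbR_mid ρ x (hS1 hu).1 (hS1 hu).2
    · exact pbR_mid ρ x (hS1 hy).1 (hS1 hy).2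
  · intro y _ y' _ hyy
    have := pbR_exp hρ hδ1 hδ x hyy
    have h3 : 0 ≤ δ * (y' - y) := mul_nonneg hδ0.le (by linarith)
    simp only; linarith

theorem pb_slice {ρ : Cyl → ℝ} (hρ : Continuous ρ) {δ : ℝ} (hδ0 : 0 < δ) (hδ1 : δ ≤ 1)
    (hδ : ∀ z, δ ≤ ρ z) (x : AddCircle (1:ℝ)) {V W : Set ℝ} (hV : MeasurableSet V)
    (hW : MeasurableSet W) (τ : ℝ → ℝ) (t : ℝ) (ht : 0 ≤ t)
    (hτ : ∀ y ∈ Icc (0:ℝ) 1, pbR ρ (x, τ y) = pbR ρ (x, y) + t)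
    (hWV : ∀ y ∈ W, τ y ∈ V) (hV1 : ∀ y ∈ V, y ≤ 1)
    (hV0 : ∀ y, 0 ≤ y → pbR ρ (x, y) < t → y ∈ V) :
    ENNReal.ofReal t + ∫⁻ y in W ∩ Icc 0 1, ENNReal.ofReal (ρ (x, y)) ≤
      ∫⁻ y in V ∩ Icc 0 1, ENNReal.ofReal (ρ (x, y)) := by
  set R := fun y => pbR ρ (x, y) with hR
  have hRm : StrictMono R := by
    intro y y' hy
    have := pbR_exp hρ hδ1 hδ x hy.le
    have h3 : 0 < δ * (y' - y) := mul_pos hδ0 (by linarith)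
    simp only [hR]; linarith
  have hR0 : R 0 = 0 := pbR_nonpos ρ x le_rfl
  rw [pbR_vol hρ hδ0 hδ1 hδ x (hW.inter measurableSet_Icc) inter_subset_right,
    pbR_vol hρ hδ0 hδ1 hδ x (hV.inter measurableSet_Icc) inter_subset_right]
  have hsub : (fun u => u + t) '' (R '' (W ∩ Icc 0 1)) ∪ Ico 0 t ⊆ R '' (V ∩ Icc 0 1) := by
    apply union_subset
    · rintro _ ⟨_, ⟨y, ⟨hyW, hyI⟩, rfl⟩, rfl⟩
      refine ⟨τ y, ⟨hWV y hyW, ?_, hV1 _ (hWV y hyW)⟩, hτ y hyI⟩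
      rw [← hRm.le_iff_le, hR0]
      have e : R (τ y) = R y + t := hτ y hyI
      have : R 0 ≤ R y := hRm.monotone hyI.1
      rw [e]; linarith
    · rintro u ⟨hu0, hut⟩
      have hcR : Continuous R := (pbR_cont hρ).comp (by fun_prop)
      have : u ∈ R '' Icc 0 (u / δ) := by
        apply intermediate_value_Icc (by positivity) hcR.continuousOn
        refine ⟨by rw [hR0]; exact hu0, ?_⟩
        have := pbR_exp hρ hδ1 hδ x (y := 0) (y' := u / δ) (by positivity)
        have e : δ * (u / δ - 0) = u := by field_simp; ring
        rw [e] at this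
        have h0 : pbR ρ (x, 0) = 0 := hR0
        rw [h0] at this; simp only [hR]; linarith
      obtain ⟨y, hy, rfl⟩ := this
      have hyV := hV0 y hy.1 hut
      exact ⟨y, ⟨hyV, hy.1, hV1 y hyV⟩, rfl⟩
  refine le_trans ?_ (measure_mono hsub)
  rw [measure_union _ measurableSet_Ico, image_add_right, measure_preimage_add_right,
    Real.volume_Ico, sub_zero, add_comm]
  rw [Set.disjoint_left]
  rintro _ ⟨_, ⟨y, ⟨hyW, hyI⟩, rfl⟩, rfl⟩ ⟨-, h2⟩
  have : R 0 ≤ R y := hRm.monotone hyI.1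
  simp only at h2
  linarith

theorem pb_density (d : Cyl → ℝ) (hd : Measurable d)
    (hd_pos : ∀ᵐ a ∂(volume.restrict annA), 0 < d a)
    (hfin : ∫⁻ a in annA, ENNReal.ofReal (d a) ≠ ⊤) (η : ℝ) (hη : 0 < η) :
    ∃ (δ : ℝ) (ρ : Cyl → ℝ), 0 < δ ∧ δ ≤ 1 ∧ Continuous ρ ∧ (∀ z, δ ≤ ρ z) ∧
      ∫⁻ a in annA, ENNReal.ofReal |ρ a - d a| ≤ ENNReal.ofReal (η * δ) := by
  set ν : Measure Cyl := volume.restrict annA with hν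
  have hνfin : IsFiniteMeasure ν := by
    constructor
    rw [hν, Measure.restrict_apply_univ, annA]
    show (volume : Measure (AddCircle (1:ℝ))).prod (volume : Measure ℝ) _ < ⊤
    rw [Measure.prod_prod]; simp
  have hInt : Integrable d ν := by
    refine ⟨hd.aestronglyMeasurable, ?_⟩
    rw [hasFiniteIntegral_iff_ofReal (hd_pos.mono fun a h => le_of_lt h)]
    exact lt_top_iff_ne_top.mpr hfin
  have hreg : ν.WeaklyRegular := inferInstance
  have hlim : Filter.Tendsto (fun n : ℕ => ν {a | d a < 1 / ((n:ℝ) + 1)}) Filter.atTop (nhds 0) := by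
    have := tendsto_measure_iInter_atTop (μ := ν) (s := fun n : ℕ => {a | d a < 1 / ((n:ℝ) + 1)})
      (fun n => (measurableSet_lt hd measurable_const).nullMeasurableSet)
      (by
        intro m n hmn a ha
        have : (1:ℝ) / (n + 1) ≤ 1 / (m + 1) := by
          apply one_div_le_one_div_of_le (by positivity)
          have : (m:ℝ) ≤ n := by exact_mod_cast hmn
          linarith
        simp only [mem_ofPred_eq] at ha ⊢; linarith)
      ⟨0, measure_ne_top _ _⟩
    have hz : ν (⋂ n : ℕ, {a | d a < 1 / ((n:ℝ) + 1)}) = 0 := by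
      have h0 : ν {a | ¬ 0 < d a} = 0 := hd_pos
      refine measure_mono_null ?_ h0
      intro a ha hpos
      obtain ⟨n, hn⟩ := exists_nat_one_div_lt hpos
      have := mem_iInter.mp ha n
      simp only [mem_ofPred_eq] at this
      linarith
    rw [hz] at this
    exact this
  have hη2 : (0:ENNReal) < ENNReal.ofReal (η / 2) := by simp; linarith
  obtain ⟨n, hn⟩ := (hlim.eventually (gt_mem_nhds hη2)).exists
  set δ : ℝ := 1 / ((n:ℝ) + 1) with hδ
  have hδ0 : 0 < δ := by positivity
  have hδ1 : δ ≤ 1 := by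
    rw [hδ, div_le_one (by positivity)]
    have : (0:ℝ) ≤ n := by positivity
    linarith
  have hInt2 : Integrable (fun a => max (d a) δ) ν := hInt.sup (integrable_const δ)
  obtain ⟨g, hg, -⟩ := hInt2.exists_boundedContinuous_lintegral_sub_le
    (ε := ENNReal.ofReal (η / 2 * δ)) (by simp; positivity)
  refine ⟨δ, fun a => max (g a) δ, hδ0, hδ1, by fun_prop, fun z => le_max_right _ _, ?_⟩
  have hpt : ∀ a, ENNReal.ofReal |max (g a) δ - d a| ≤
      ‖max (d a) δ - g a‖ₑ + ({a | d a < δ} : Set Cyl).indicator (fun _ => ENNReal.ofReal δ) a + 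
      ({a | ¬ 0 < d a} : Set Cyl).indicator (fun _ => ⊤) a := by
    intro a
    by_cases hpos : 0 < d a
    · have h1 : |max (g a) δ - d a| ≤ |max (d a) δ - g a| + (if d a < δ then δ else 0) := by
        split_ifs with h
        · rw [max_eq_right h.le]
          rcases le_total (g a) δ with h' | h'
          · rw [max_eq_right h', abs_of_nonneg (by linarith)]
            have := abs_nonneg (δ - g a); linarith
          · rw [max_eq_left h', abs_of_nonneg (by linarith), abs_of_nonpos (by linarith)]; linarith
        · push Not at h
          rw [max_eq_left h, add_zero]
          rcases le_total (g a) δ with h' | h'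
          · rw [max_eq_right h', abs_of_nonpos (by linarith), abs_of_nonneg (by linarith)]; linarith
          · rw [max_eq_left h', abs_sub_comm]
      have h2 : ENNReal.ofReal |max (g a) δ - d a| ≤
          ENNReal.ofReal |max (d a) δ - g a| + ENNReal.ofReal (if d a < δ then δ else 0) := by
        rw [← ENNReal.ofReal_add (abs_nonneg _) (by split_ifs <;> linarith)]
        exact ENNReal.ofReal_le_ofReal h1
      refine h2.trans (le_trans ?_ le_self_add)
      gcongr
      · rw [← Real.norm_eq_abs, ofReal_norm]
      · split_ifs with h <;> simp [Set.indicator, h]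
    · simp [Set.indicator, not_lt.mp hpos]
  calc ∫⁻ a, ENNReal.ofReal |max (g a) δ - d a| ∂ν
      ≤ ∫⁻ a, (‖max (d a) δ - g a‖ₑ + 
        ({a | d a < δ} : Set Cyl).indicator (fun _ => ENNReal.ofReal δ) a + 
        ({a | ¬ 0 < d a} : Set Cyl).indicator (fun _ => ⊤) a) ∂ν := lintegral_mono hpt
    _ = ∫⁻ a, ‖max (d a) δ - g a‖ₑ ∂ν + ENNReal.ofReal δ * ν {a | d a < δ} + 0 := by
        have hm1 : MeasurableSet {a | d a < δ} := measurableSet_lt hd measurable_const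
        have hm2 : MeasurableSet {a | ¬ 0 < d a} := (measurableSet_lt measurable_const hd).compl
        have hgm : Measurable (fun a => g a) := g.continuous.measurable
        rw [lintegral_add_left (by fun_prop (disch := assumption)), lintegral_add_left (by fun_prop),
          lintegral_indicator_const hm1, lintegral_indicator_const hm2]
        congr 1
        have h0 : ν {a | ¬ 0 < d a} = 0 := hd_pos
        rw [h0]; simp
    _ ≤ ENNReal.ofReal (η / 2 * δ) + ENNReal.ofReal δ * ENNReal.ofReal (η / 2) + 0 := by
        gcongr
    _ = ENNReal.ofReal (η * δ) := by
        rw [add_zero, ← ENNReal.ofReal_mul hδ0.le, ← ENNReal.ofReal_add (by positivity) (by positivity)]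
        congr 1; ring

theorem pb_fubini (ρ : Cyl → ENNReal) (hρ : Measurable ρ) (V : Set Cyl) (hV : MeasurableSet V) :
    ∫⁻ a in V ∩ annA, ρ a = ∫⁻ x : AddCircle (1:ℝ), ∫⁻ y in {y | (x, y) ∈ V} ∩ Icc (0:ℝ) 1, ρ (x, y) := by
  have hA : MeasurableSet annA := MeasurableSet.univ.prod measurableSet_Icc
  rw [← lintegral_indicator (hV.inter hA)]
  have : (volume : Measure Cyl) = (volume : Measure (AddCircle (1:ℝ))).prod (volume : Measure ℝ) := rfl
  rw [this, lintegral_prod _ ((hρ.indicator (hV.inter hA)).aemeasurable)]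
  apply lintegral_congr
  intro x
  have hm : MeasurableSet ({y | (x, y) ∈ V} ∩ Icc (0:ℝ) 1) :=
    (measurable_prodMk_left hV).inter measurableSet_Icc
  rw [← lintegral_indicator hm]
  apply lintegral_congr
  intro y
  have hiff : (x, y) ∈ V ∩ annA ↔ y ∈ {y | (x, y) ∈ V} ∩ Icc (0:ℝ) 1 := by
    constructor
    · rintro ⟨h1, h2⟩; exact ⟨h1, h2.2⟩
    · rintro ⟨h1, h2⟩; exact ⟨h1, ⟨mem_univ _, h2⟩⟩
  by_cases h : (x, y) ∈ V ∩ annA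
  · rw [indicator_of_mem h, indicator_of_mem (hiff.1 h)]
  · rw [indicator_of_notMem h, indicator_of_notMem (fun h' => h (hiff.2 h'))]

/-- Existence of the small vertical push. -/
theorem pb_T_exists (μ : Measure Cyl) [IsFiniteMeasure μ]
    (d : Cyl → ℝ) (hd_meas : Measurable d)
    (hd_pos : ∀ᵐ a ∂(volume.restrict annA), 0 < d a)
    (hdens : ∀ U : Set Cyl, U ⊆ annA → MeasurableSet U →
      μ U = ∫⁻ a in U, ENNReal.ofReal (d a) ∂volume)
    (x0 : AddCircle (1:ℝ)) (η0 : ℝ) (hη0 : 0 < η0) :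
    ∃ (T : (ℝ × ℝ) ≃ₜ (ℝ × ℝ)) (e : ℝ), 0 < e ∧ e < 1 ∧ (∀ p, (T p).1 = p.1) ∧
      (∀ p q, covProj p = covProj q → (T p).2 = (T q).2) ∧
      (∀ x y y', y ≤ y' → (T (x, y)).2 ≤ (T (x, y')).2) ∧
      (∀ p, p.2 ≤ (T p).2) ∧ (∀ p, (T p).2 < p.2 + η0) ∧
      (∀ p, p.2 ∈ Icc (0:ℝ) 1 → ‖(p.1 : AddCircle (1:ℝ)) - x0‖ ≤ 1/4 → T p = p) ∧
      (∀ p, p.2 ≤ -1 → (T p).2 = p.2 + e) ∧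
      (∀ p, p.2 ∈ Icc (-1:ℝ) 0 → (1 - e) * p.2 ≤ (T p).2) ∧
      (∀ p, 1 ≤ p.2 → p.2 + e * min 1 (p.2 - 1) ≤ (T p).2) ∧
      (∀ V V' : Set Cyl, MeasurableSet V → MeasurableSet V' →
        (∀ p, covProj p ∈ V' ↔ covProj (T p) ∈ V) →
        (∀ p, p.2 < 0 → covProj (T p) ∈ V) → (∀ z ∈ V, z.2 ≤ 1) →
        μ (V ∩ annA) ≠ μ (V' ∩ annA)) := by
  have hA : MeasurableSet annA := MeasurableSet.univ.prod measurableSet_Icc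
  obtain ⟨η, hη, hη1, hηη⟩ : ∃ η : ℝ, 0 < η ∧ η ≤ 1 ∧ η ≤ η0 :=
    ⟨min η0 1, lt_min hη0 one_pos, min_le_right _ _, min_le_left _ _⟩
  -- the bump
  obtain ⟨χ, hχ⟩ : ∃ χ : AddCircle (1:ℝ) → ℝ, χ = fun x => max 0 (‖x - x0‖ - 1/4) := ⟨_, rfl⟩
  have hχc : Continuous χ := by rw [hχ]; fun_prop
  have hχ0 : ∀ x, 0 ≤ χ x := fun x => by rw [hχ]; exact le_max_left _ _
  have hχ1 : ∀ x, χ x ≤ 1 := by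
    intro x
    rw [hχ]
    apply max_le zero_le_one
    have := AddCircle.norm_le_half_period (1:ℝ) (x := x - x0) one_ne_zero
    simp at this; linarith
  have hK0 : 0 < ∫⁻ x, ENNReal.ofReal (χ x) := by
    rw [lintegral_pos_iff_support (by fun_prop)]
    apply IsOpen.measure_pos
    · exact (ENNReal.continuous_ofReal.comp hχc).isOpen_support
    · refine ⟨x0 + ((1/2 : ℝ) : AddCircle (1:ℝ)), ?_⟩
      have : ‖(((1/2 : ℝ)) : AddCircle (1:ℝ))‖ = 1/2 := by
        have := AddCircle.norm_half_period_eq (1:ℝ)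
        simpa using this
      simp only [Function.mem_support, ne_eq, ENNReal.ofReal_eq_zero, not_le, hχ]
      rw [add_sub_cancel_left, this]
      norm_num
  have hK1 : ∫⁻ x, ENNReal.ofReal (χ x) ≠ ⊤ := by
    have : ∫⁻ x, ENNReal.ofReal (χ x) ≤ ∫⁻ x : AddCircle (1:ℝ), 1 := by
      apply lintegral_mono
      intro x
      simpa using hχ1 x
    refine ne_top_of_le_ne_top ?_ this
    simp
  set κ := (∫⁻ x, ENNReal.ofReal (χ x)).toReal with hκ
  have hκ0 : 0 < κ := ENNReal.toReal_pos hK0.ne' hK1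
  have hκe : ∫⁻ x, ENNReal.ofReal (χ x) = ENNReal.ofReal κ := (ENNReal.ofReal_toReal hK1).symm
  have hfin : ∫⁻ a in annA, ENNReal.ofReal (d a) ≠ ⊤ := by
    rw [← hdens annA subset_rfl hA]; exact measure_ne_top _ _
  obtain ⟨δ, ρ, hδ0, hδ1, hρc, hρδ, hE⟩ := pb_density d hd_meas hd_pos hfin (κ * η / 8) (by positivity)
  set e : ℝ := η * δ / 2 with he
  have he0 : 0 < e := by positivity
  have he1 : e < 1 := by
    have : η * δ ≤ 1 := mul_le_one₀ hη1 hδ0.le hδ1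
    linarith
  have hRexp := fun x y y' (h : y ≤ y') => pbR_exp hρc hδ1 hρδ x h
  have hRm : ∀ x, StrictMono fun y => pbR ρ (x, y) := by
    intro x y y' hy
    have := hRexp x y y' hy.le
    have h3 : 0 < δ * (y' - y) := mul_pos hδ0 (by linarith)
    simp only; linarith
  have hRle : ∀ x y y', pbR ρ (x, y) ≤ pbR ρ (x, y') ↔ y ≤ y' := fun x y y' => (hRm x).le_iff_le
  have hRinj : ∀ x y y', pbR ρ (x, y) = pbR ρ (x, y') → y = y' := fun x y y' h => (hRm x).injective h
  -- the push in flat coordinates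
  obtain ⟨k, hk⟩ : ∃ k : AddCircle (1:ℝ) → ℝ → ℝ, k = fun x u =>
    max (χ x) (min 1 (max (-u) (u - pbR ρ (x, 1)))) := ⟨_, rfl⟩
  have hkc : Continuous fun z : Cyl => k z.1 z.2 := by
    have := pbR_cont hρc
    rw [hk]; fun_prop
  have hkχ : ∀ x u, χ x ≤ k x u := fun x u => by rw [hk]; exact le_max_left _ _
  have hk0 : ∀ x u, 0 ≤ k x u := fun x u => (hχ0 x).trans (hkχ x u)
  have hk1 : ∀ x u, k x u ≤ 1 := fun x u => by rw [hk]; exact max_le (hχ1 x) (min_le_left _ _)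
  have hkl : ∀ x u u', u ≤ u' → k x u ≤ k x u' + (u' - u) := by
    intro x u u' h
    rw [hk]
    simp only
    apply max_le
    · have := le_max_left (χ x) (min 1 (max (-u') (u' - pbR ρ (x, 1)))); linarith
    · have h1 := le_max_right (χ x) (min 1 (max (-u') (u' - pbR ρ (x, 1))))
      have h2 : min 1 (max (-u) (u - pbR ρ (x, 1))) - (u' - u) ≤ 
          min 1 (max (-u') (u' - pbR ρ (x, 1))) := by
        apply le_min
        · have := min_le_left 1 (max (-u) (u - pbR ρ (x, 1))); linarith
        · have h3 := min_le_right 1 (max (-u) (u - pbR ρ (x, 1)))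
          have h4 : max (-u) (u - pbR ρ (x, 1)) ≤ max (-u') (u' - pbR ρ (x, 1)) + (u' - u) := by
            apply max_le
            · have := le_max_left (-u') (u' - pbR ρ (x, 1)); linarith
            · have := le_max_right (-u') (u' - pbR ρ (x, 1)); linarith
          linarith
      linarith
  have hkneg : ∀ x u, min 1 (-u) ≤ k x u := by
    intro x u; rw [hk]
    exact (min_le_min le_rfl (le_max_left _ _)).trans (le_max_right _ _)
  have hkpos : ∀ x u, min 1 (u - pbR ρ (x, 1)) ≤ k x u := by
    intro x u; rw [hk]
    exact (min_le_min le_rfl (le_max_right _ _)).trans (le_max_right _ _)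
  have hkmid : ∀ x u, 0 ≤ u → u ≤ pbR ρ (x, 1) → k x u = χ x := by
    intro x u h1 h2; rw [hk]
    apply max_eq_left
    refine (min_le_right _ _).trans (le_trans (max_le ?_ ?_) (hχ0 x)) <;> linarith
  have hproj : Continuous covProj := by
    unfold covProj
    exact ((AddCircle.continuous_mk' (1:ℝ)).comp continuous_fst).prodMk continuous_snd
  obtain ⟨Φ, hΦ⟩ := pb_fiber_homeo (fun p => pbR ρ (covProj p)) ((pbR_cont hρc).comp hproj) δ hδ0
    (fun x y y' h => hRexp _ y y' h)
  obtain ⟨Ψ, hΨ⟩ := pb_fiber_homeo (fun p => p.2 + e * k (p.1 : AddCircle (1:ℝ)) p.2)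
    (by
      have : Continuous fun p : ℝ × ℝ => k (p.1 : AddCircle (1:ℝ)) p.2 := hkc.comp hproj
      fun_prop) (1 - e) (by linarith)
    (fun x y y' h => by
      have := hkl (x : AddCircle (1:ℝ)) y y' h
      simp only
      nlinarith)
  set T : (ℝ × ℝ) ≃ₜ (ℝ × ℝ) := Φ.trans (Ψ.trans Φ.symm) with hT
  have hΦT : ∀ p, Φ (T p) = Ψ (Φ p) := by intro p; simp [hT]
  have hT1 : ∀ p, (T p).1 = p.1 := by
    intro p
    have := congrArg Prod.fst (hΦT p)
    rw [hΦ, hΨ, hΦ] at this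
    exact this
  have hT2 : ∀ p : ℝ × ℝ, pbR ρ ((p.1 : AddCircle (1:ℝ)), (T p).2) =
      pbR ρ ((p.1 : AddCircle (1:ℝ)), p.2) + 
        e * k (p.1 : AddCircle (1:ℝ)) (pbR ρ ((p.1 : AddCircle (1:ℝ)), p.2)) := by
    intro p
    have := congrArg Prod.snd (hΦT p)
    rw [hΦ, hΨ, hΦ] at this
    simp only [covProj, hT1] at this
    exact this
  have hraise : ∀ p, p.2 ≤ (T p).2 := by
    intro p
    rw [← hRle (p.1 : AddCircle (1:ℝ)), hT2]
    have := mul_nonneg he0.le (hk0 (p.1 : AddCircle (1:ℝ)) (pbR ρ ((p.1 : AddCircle (1:ℝ)), p.2)))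
    linarith
  have hcong : ∀ p q : ℝ × ℝ, covProj p = covProj q → (T p).2 = (T q).2 := by
    intro p q h
    have h1 : (p.1 : AddCircle (1:ℝ)) = q.1 := congrArg Prod.fst h
    have h2 : p.2 = q.2 := (congrArg Prod.snd h : (covProj p).2 = (covProj q).2)
    apply hRinj (p.1 : AddCircle (1:ℝ))
    rw [hT2, h1, h2, hT2]
  have hRpos : ∀ x y, 0 ≤ y → 0 ≤ pbR ρ (x, y) := by
    intro x y hy
    have h0 := pbR_nonpos ρ x (le_refl (0:ℝ))
    rw [← h0, hRle]; exact hy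
  refine ⟨T, e, he0, he1, hT1, hcong, ?_, hraise, ?_, ?_, ?_, ?_, ?_, ?_⟩
  · intro x y y' h
    rw [← hRle (x : AddCircle (1:ℝ)), hT2 (x, y), hT2 (x, y')]
    simp only
    have h1 : pbR ρ ((x : AddCircle (1:ℝ)), y) ≤ pbR ρ ((x : AddCircle (1:ℝ)), y') := (hRle _ _ _).2 h
    have := hkl (x : AddCircle (1:ℝ)) _ _ h1
    nlinarith
  · intro p
    have h1 := hRexp (p.1 : AddCircle (1:ℝ)) p.2 (T p).2 (hraise p)
    rw [hT2] at h1
    have h2 := hk1 (p.1 : AddCircle (1:ℝ)) (pbR ρ ((p.1 : AddCircle (1:ℝ)), p.2))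
    have h3 : δ * ((T p).2 - p.2) ≤ e := by nlinarith
    have h4 : (T p).2 - p.2 ≤ η / 2 := by
      by_contra hc
      push Not at hc
      have := mul_lt_mul_of_pos_left hc hδ0
      rw [he] at h3; linarith
    linarith
  · intro p hp hx
    apply Prod.ext (hT1 p)
    apply hRinj (p.1 : AddCircle (1:ℝ))
    rw [hT2, hkmid _ _ (hRpos _ _ hp.1) ((hRle _ _ _).2 hp.2)]
    have : χ (p.1 : AddCircle (1:ℝ)) = 0 := by
      rw [hχ]; exact max_eq_left (by linarith)
    rw [this]; simp
  · intro p hp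
    apply hRinj (p.1 : AddCircle (1:ℝ))
    rw [hT2, pbR_nonpos ρ _ (by linarith : p.2 ≤ 0), pbR_nonpos ρ _ (by linarith : p.2 + e ≤ 0)]
    have h1 := hkneg (p.1 : AddCircle (1:ℝ)) p.2
    rw [min_eq_left (by linarith)] at h1
    rw [le_antisymm (hk1 _ _) h1, mul_one]
  · intro p hp
    rw [← hRle (p.1 : AddCircle (1:ℝ)), hT2, pbR_nonpos ρ _ hp.2,
      pbR_nonpos ρ _ (mul_nonpos_of_nonneg_of_nonpos (by linarith) hp.2)]
    have h1 := hkneg (p.1 : AddCircle (1:ℝ)) p.2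
    rw [min_eq_right (by linarith [hp.1])] at h1
    nlinarith
  · intro p hp
    have hm : 0 ≤ min 1 (p.2 - 1) := le_min zero_le_one (by linarith)
    rw [← hRle (p.1 : AddCircle (1:ℝ)), hT2, pbR_ge ρ _ hp, 
      pbR_ge ρ _ (by nlinarith : 1 ≤ p.2 + e * min 1 (p.2 - 1))]
    have h1 := hkpos (p.1 : AddCircle (1:ℝ)) (pbR ρ ((p.1 : AddCircle (1:ℝ)), 1) + (p.2 - 1))
    rw [add_sub_cancel_left] at h1
    nlinarith
  · intro V V' hV hV' hVV hlow hup heq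
    set E := ENNReal.ofReal (κ * η / 8 * δ) with hEdef
    have hρm : Measurable fun a => ENNReal.ofReal (ρ a) := by fun_prop
    have hdm : Measurable fun a => ENNReal.ofReal (d a) := by fun_prop
    -- comparison of the two densities
    have hc1 : ∀ S : Set Cyl, ∫⁻ a in S ∩ annA, ENNReal.ofReal |ρ a - d a| ≤ E := fun S =>
      (lintegral_mono_set inter_subset_right).trans hE
    have hc2 : ∀ S : Set Cyl, MeasurableSet S →
        ∫⁻ a in S ∩ annA, ENNReal.ofReal (ρ a) ≤ μ (S ∩ annA) + E := by
      intro S hS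
      rw [hdens _ inter_subset_right (hS.inter hA)]
      calc ∫⁻ a in S ∩ annA, ENNReal.ofReal (ρ a)
          ≤ ∫⁻ a in S ∩ annA, (ENNReal.ofReal (d a) + ENNReal.ofReal |ρ a - d a|) := by
            apply lintegral_mono; intro a
            refine le_trans (ENNReal.ofReal_le_ofReal ?_) ENNReal.ofReal_add_le
            have := le_abs_self (ρ a - d a); linarith
        _ = _ := lintegral_add_left hdm _
        _ ≤ _ := by gcongr; exact hc1 S
    have hc3 : ∀ S : Set Cyl, MeasurableSet S →
        μ (S ∩ annA) ≤ (∫⁻ a in S ∩ annA, ENNReal.ofReal (ρ a)) + E := by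
      intro S hS
      rw [hdens _ inter_subset_right (hS.inter hA)]
      calc ∫⁻ a in S ∩ annA, ENNReal.ofReal (d a)
          ≤ ∫⁻ a in S ∩ annA, (ENNReal.ofReal (ρ a) + ENNReal.ofReal |ρ a - d a|) := by
            apply lintegral_mono; intro a
            refine le_trans (ENNReal.ofReal_le_ofReal ?_) ENNReal.ofReal_add_le
            have := neg_abs_le (ρ a - d a); linarith
        _ = _ := lintegral_add_left hρm _
        _ ≤ _ := by gcongr; exact hc1 S
    have hmain : ENNReal.ofReal (e * κ) + ∫⁻ a in V' ∩ annA, ENNReal.ofReal (ρ a) ≤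
        ∫⁻ a in V ∩ annA, ENNReal.ofReal (ρ a) := by
      rw [pb_fubini _ hρm V hV, pb_fubini _ hρm V' hV', ENNReal.ofReal_mul he0.le, ← hκe,
        ← lintegral_const_mul _ (by fun_prop), ← lintegral_add_left (by fun_prop)]
      apply lintegral_mono
      intro x
      obtain ⟨r, rfl⟩ := QuotientAddGroup.mk_surjective x
      simp only
      rw [← ENNReal.ofReal_mul he0.le]
      refine pb_slice hρc hδ0 hδ1 hρδ _ (measurable_prodMk_left hV) (measurable_prodMk_left hV')
        (fun y => (T (r, y)).2) _ (mul_nonneg he0.le (hχ0 _)) ?_ ?_ ?_ ?_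
      · intro y hy
        have := hT2 (r, y)
        simp only at this
        rw [hkmid _ _ (hRpos _ _ hy.1) ((hRle _ _ _).2 hy.2)] at this
        exact this
      · intro y hy
        have := (hVV (r, y)).1 hy
        simp only [covProj, hT1] at this
        exact this
      · intro y hy
        exact hup _ hy
      · intro y hy hlt
        obtain ⟨q, hq⟩ := T.surjective (r, y)
        have hq1 : q.1 = r := by rw [← hT1 q, hq]
        by_cases hq0 : q.2 < 0
        · have := hlow q hq0
          rw [hq] at this
          exact this
        · exfalso
          push Not at hq0
          have h1 := hT2 q
          rw [hq, hq1] at h1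
          simp only at h1
          have h2 := hkχ (r : AddCircle (1:ℝ)) (pbR ρ ((r : AddCircle (1:ℝ)), q.2))
          have h3 := hRpos (r : AddCircle (1:ℝ)) q.2 hq0
          have h4 : pbR ρ ((r : AddCircle (1:ℝ)), y) < e * χ (r : AddCircle (1:ℝ)) := hlt
          nlinarith
    have hfinV' : ∫⁻ a in V' ∩ annA, ENNReal.ofReal (ρ a) ≠ ⊤ := by
      refine ne_top_of_le_ne_top ?_ (hc2 V' hV')
      exact ENNReal.add_ne_top.2 ⟨measure_ne_top _ _, ENNReal.ofReal_ne_top⟩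
    have h5 : ENNReal.ofReal (e * κ) + ∫⁻ a in V' ∩ annA, ENNReal.ofReal (ρ a) ≤
        (E + E) + ∫⁻ a in V' ∩ annA, ENNReal.ofReal (ρ a) := by
      refine hmain.trans ((hc2 V hV).trans ?_)
      rw [heq]
      calc μ (V' ∩ annA) + E ≤ ((∫⁻ a in V' ∩ annA, ENNReal.ofReal (ρ a)) + E) + E := by
            gcongr; exact hc3 V' hV'
        _ = _ := by ring
    have h6 := (ENNReal.add_le_add_iff_right hfinV').1 h5
    rw [hEdef, ← ENNReal.ofReal_add (by positivity) (by positivity),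
      ENNReal.ofReal_le_ofReal_iff (by positivity)] at h6
    have h7 : 0 < κ * η * δ := by positivity
    rw [he] at h6
    linarith

/-- The orbit curve through a fundamental segment. -/
theorem pb_curve (g : ℝ × ℝ → ℝ × ℝ) (hg : Continuous g) (hinj : Function.Injective g)
    (z0 : ℝ × ℝ) (e : ℝ) (he0 : 0 < e) (hz : (g z0).2 = z0.2 + e)
    (hlow : ∀ p : ℝ × ℝ, z0.2 ≤ p.2 → z0.2 + e ≤ (g p).2) (N : ℕ) :
    ∃ C : ℝ → ℝ × ℝ, ContinuousOn C (Icc 0 N) ∧ C 0 = z0 ∧ C N = g^[N] z0 ∧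
      (∀ t, 0 ≤ t → C (t + 1) = g (C t)) ∧ (∀ t, 0 ≤ t → z0.2 ≤ (C t).2) ∧
      (∀ t ∈ Icc (0:ℝ) 1, (C t).2 ≤ z0.2 + e) ∧
      (∀ s t, 0 ≤ s → s + 1 ≤ t → C t ≠ C s) := by
  obtain ⟨C0, hC0⟩ : ∃ C0 : ℝ → ℝ × ℝ, C0 = fun t => z0 + t • (g z0 - z0) := ⟨_, rfl⟩
  have hC0c : Continuous C0 := by rw [hC0]; fun_prop
  have hC00 : C0 0 = z0 := by rw [hC0]; simp
  have hC01 : C0 1 = g z0 := by rw [hC0]; simp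
  have hC0y : ∀ t, (C0 t).2 = z0.2 + t * e := by
    intro t; rw [hC0]; simp [hz]
  obtain ⟨C, hC⟩ : ∃ C : ℝ → ℝ × ℝ, C = fun t => g^[⌊t⌋₊] (C0 (Int.fract t)) := ⟨_, rfl⟩
  have hCn : ∀ (n : ℕ) (t : ℝ), (n:ℝ) ≤ t → t ≤ n + 1 → C t = g^[n] (C0 (t - n)) := by
    intro n t h1 h2
    rcases h2.lt_or_eq with h2 | h2
    · have hf : ⌊t⌋₊ = n := (Nat.floor_eq_iff ((Nat.cast_nonneg n).trans h1)).2 ⟨h1, h2⟩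
      have hf2 : ⌊t⌋ = (n:ℤ) := Int.floor_eq_iff.2 ⟨by simpa using h1, by simpa using h2⟩
      rw [hC]; simp only [hf, Int.fract, hf2]; simp
    · have e1 : t - n = 1 := by linarith
      have e2 : t = ((n + 1 : ℕ) : ℝ) := by push_cast; exact h2
      rw [e1, hC01, hC]
      simp only
      rw [e2, Nat.floor_natCast, Int.fract_natCast, hC00, Function.iterate_succ_apply]
  have hex : ∀ t : ℝ, 0 ≤ t → ∃ n : ℕ, (n:ℝ) ≤ t ∧ t < n + 1 := fun t ht =>
    ⟨⌊t⌋₊, Nat.floor_le ht, Nat.lt_floor_add_one t⟩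
  have hit : ∀ (n : ℕ) (p : ℝ × ℝ), z0.2 ≤ p.2 → z0.2 ≤ (g^[n] p).2 := by
    intro n
    induction n with
    | zero => intro p hp; exact hp
    | succ n ih =>
      intro p hp
      rw [Function.iterate_succ_apply]
      exact ih _ (by linarith [hlow p hp])
  have hit' : ∀ (n : ℕ) (p : ℝ × ℝ), z0.2 ≤ p.2 → z0.2 + e ≤ (g^[n + 1] p).2 := by
    intro n p hp
    rw [Function.iterate_succ_apply']
    exact hlow _ (hit n p hp)
  have hC0low : ∀ t, 0 ≤ t → z0.2 ≤ (C0 t).2 := by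
    intro t ht; rw [hC0y]; nlinarith
  refine ⟨C, ?_, ?_, ?_, ?_, ?_, ?_, ?_⟩
  · induction N with
    | zero => simp
    | succ n ih =>
      have h1 : ContinuousOn C (Icc (n:ℝ) (n + 1)) := by
        have : ContinuousOn (fun t : ℝ => g^[n] (C0 (t - n))) (Icc (n:ℝ) (n + 1)) :=
          ((hg.iterate n).comp (hC0c.comp (continuous_id.sub continuous_const))).continuousOn
        exact this.congr fun t ht => hCn n t ht.1 ht.2
      have h2 : Icc (0:ℝ) ((n + 1 : ℕ) : ℝ) = Icc 0 (n:ℝ) ∪ Icc (n:ℝ) (n + 1) := by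
        rw [Icc_union_Icc_eq_Icc (by positivity) (by linarith)]; push_cast; rfl
      rw [h2]
      exact ih.union_of_isClosed h1 isClosed_Icc isClosed_Icc
  · have := hCn 0 0 (by simp) (by simp)
    rw [this]; simpa using hC00
  · have := hCn N N le_rfl (by linarith)
    rw [this]; simp [hC00]
  · intro t ht
    obtain ⟨n, h1, h2⟩ := hex t ht
    rw [hCn n t h1 h2.le, hCn (n + 1) (t + 1) (by push_cast; linarith) (by push_cast; linarith),
      Function.iterate_succ_apply']
    congr 3; push_cast; ring
  · intro t ht
    obtain ⟨n, h1, h2⟩ := hex t ht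
    rw [hCn n t h1 h2.le]
    exact hit n _ (hC0low _ (by linarith))
  · intro t ht
    rw [hCn 0 t (by simpa using ht.1) (by simpa using ht.2)]
    simp only [Function.iterate_zero, id_eq, hC0y]
    have := ht.2; norm_num; nlinarith
  · intro s t hs hst heq
    obtain ⟨m, h1, h2⟩ := hex s hs
    obtain ⟨n, h3, h4⟩ := hex t (by linarith)
    rw [hCn n t h3 h4.le, hCn m s h1 h2.le] at heq
    have hmn : m + 1 ≤ n := by
      have : (m:ℝ) < n := by linarith
      exact_mod_cast this
    obtain ⟨k, rfl⟩ := Nat.exists_eq_add_of_le hmn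
    have e1 : m + 1 + k = m + (k + 1) := by ring
    rw [e1, Function.iterate_add_apply] at heq
    have h5 := hinj.iterate m heq
    have h6 := hit' k (C0 (t - ((m + 1 + k : ℕ) : ℝ))) (hC0low _ (by linarith))
    rw [e1] at h6
    rw [h5, hC0y] at h6
    nlinarith

/-- Total winding along the orbit curve. -/
theorem pb_winding (g : ℝ × ℝ → ℝ × ℝ) (hg : Continuous g) (hinj : Function.Injective g)
    (z0 : ℝ × ℝ) (e : ℝ) (he0 : 0 < e) (he1 : e < 1) (hz : (g z0).2 = z0.2 + e)
    (hz0 : z0.2 ≤ -1)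
    (hlow : ∀ p : ℝ × ℝ, z0.2 ≤ p.2 → z0.2 + e ≤ (g p).2) (N : ℕ)
    (hN : 2 ≤ (g^[N] z0).2) (hup : ∀ p : ℝ × ℝ, p.2 < 1 → (g p).2 < 2)
    (l : ℝ × ℝ → ℂ) (hl : ContinuousOn l {p | g p ≠ p})
    (hle : ∀ p, g p ≠ p → Complex.exp (l p) = pbC (g p - p)) :
    ∃ q : ℝ × ℝ, 1 ≤ q.2 ∧ g q ≠ q ∧
      l z0 - l q = pbA (pbC (g z0 - z0)) - pbA (pbC (g q - q)) := by
  obtain ⟨C, hCc, hC0, hCN, hC1, hCl, hCu, hCne⟩ := pb_curve g hg hinj z0 e he0 hz hlow N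
  obtain ⟨M, hM, hmax⟩ := isCompact_Icc.exists_isMaxOn (s := Icc (0:ℝ) N) ⟨0, by simp⟩
    (continuous_snd.comp_continuousOn hCc)
  have hmax' : ∀ t ∈ Icc (0:ℝ) N, (C t).2 ≤ (C M).2 := fun t ht => hmax ht
  have hM2 : 2 ≤ (C M).2 := by
    have := hmax' N (by simp)
    rw [hCN] at this; linarith
  have hM1 : 1 ≤ M := by
    by_contra hc
    push Not at hc
    have := hCu M ⟨hM.1, hc.le⟩
    linarith
  have hfix : ∀ s, 0 ≤ s → g (C s) ≠ C s := by
    intro s hs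
    rw [← hC1 s hs]; exact hCne s (s+1) hs le_rfl
  have hgq : g (C (M - 1)) = C M := by
    rw [← hC1 _ (by linarith)]; simp
  refine ⟨C (M - 1), ?_, hfix _ (by linarith), ?_⟩
  · by_contra hc
    push Not at hc
    have := hup _ hc
    rw [hgq] at this; linarith
  obtain ⟨S, hS⟩ : ∃ S : ℝ × ℝ → ℝ, S = fun p => max 0 (min p.1 (M - 1)) := ⟨_, rfl⟩
  obtain ⟨T, hT⟩ : ∃ T : ℝ × ℝ → ℝ, T = fun p => max (S p + 1) (min p.2 M) := ⟨_, rfl⟩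
  have hSc : Continuous S := by rw [hS]; fun_prop
  have hTc : Continuous T := by rw [hT]; fun_prop
  have hS0 : ∀ p, 0 ≤ S p := fun p => by rw [hS]; exact le_max_left _ _
  have hSM : ∀ p, S p ≤ M - 1 := fun p => by
    rw [hS]; exact max_le (by linarith) (min_le_right _ _)
  have hTS : ∀ p, S p + 1 ≤ T p := fun p => by rw [hT]; exact le_max_left _ _
  have hTM : ∀ p, T p ≤ M := fun p => by
    rw [hT]; exact max_le (by linarith [hSM p]) (min_le_right _ _)
  have hSe : ∀ s t, 0 ≤ s → s ≤ M - 1 → S (s, t) = s := by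
    intro s t h1 h2; rw [hS]; simp [h1, h2]
  have hTe : ∀ s t, 0 ≤ s → s + 1 ≤ t → t ≤ M → T (s, t) = t := by
    intro s t h1 h2 h3
    rw [hT]; simp only
    rw [hSe s t h1 (by linarith), min_eq_left h3, max_eq_right h2]
  obtain ⟨w, hw⟩ : ∃ w : ℝ × ℝ → ℂ, w = fun p => pbC (C (T p) - C (S p)) := ⟨_, rfl⟩
  have hwc : Continuous w := by
    rw [hw]
    apply pbC_cont.comp
    apply Continuous.sub
    · exact hCc.comp_continuous hTc fun p =>
        ⟨by linarith [hTS p, hS0 p], (hTM p).trans hM.2⟩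
    · exact hCc.comp_continuous hSc fun p =>
        ⟨hS0 p, by linarith [hSM p, hM.2]⟩
  have hw0 : ∀ p, w p ≠ 0 := by
    intro p
    rw [hw]; simp only [ne_eq, pbC_eq_zero, sub_eq_zero]
    exact hCne _ _ (hS0 p) (hTS p)
  have hwe : ∀ s t, 0 ≤ s → s + 1 ≤ t → t ≤ M → w (s, t) = pbC (C t - C s) := by
    intro s t h1 h2 h3
    rw [hw]; simp only
    rw [hTe s t h1 h2 h3, hSe s t h1 (by linarith)]
  obtain ⟨lw, hlwc, hlwe⟩ := pb_log_lift w hwc hw0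
  -- leg s = 0
  have k1 := pb_log_unique (S := Icc (1:ℝ) M) isPreconnected_Icc
    (l1 := fun t => lw (0, t)) (l2 := fun t => pbA (w (0, t)))
    (by fun_prop)
    (pbA_contOn (by fun_prop) (fun t _ => hw0 _) (by
      intro t ht
      rw [hwe 0 t le_rfl (by linarith [ht.1]) ht.2]
      simp only [pbC, Prod.snd_sub, hC0]
      linarith [hCl t (by linarith [ht.1])]))
    (fun t _ => by rw [hlwe, pbA_exp (hw0 _)]) (a := 1) (b := M) ⟨le_rfl, hM1⟩ ⟨hM1, le_rfl⟩
  -- leg t = M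
  have k2 := pb_log_unique (S := Icc (0:ℝ) (M - 1)) isPreconnected_Icc
    (l1 := fun s => lw (s, M)) (l2 := fun s => pbA (w (s, M)))
    (by fun_prop)
    (pbA_contOn (by fun_prop) (fun t _ => hw0 _) (by
      intro s hs
      rw [hwe s M hs.1 (by linarith [hs.2]) le_rfl]
      simp only [pbC, Prod.snd_sub]
      linarith [hmax' s ⟨hs.1, by linarith [hs.2, hM.2]⟩]))
    (fun t _ => by rw [hlwe, pbA_exp (hw0 _)]) (a := 0) (b := M - 1)
      ⟨le_rfl, by linarith⟩ ⟨by linarith, le_rfl⟩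
  -- hypotenuse
  have k3 := pb_log_unique (S := Icc (0:ℝ) (M - 1)) isPreconnected_Icc
    (l1 := fun s => lw (s, s + 1)) (l2 := fun s => l (C s))
    (by fun_prop)
    (hl.comp (hCc.mono (Icc_subset_Icc le_rfl (by linarith [hM.2])))
      (fun s hs => hfix s hs.1))
    (fun s hs => by
      rw [hlwe, hle _ (hfix s hs.1), hwe s (s+1) hs.1 le_rfl (by linarith [hs.2]), hC1 s hs.1])
    (a := 0) (b := M - 1) ⟨le_rfl, by linarith⟩ ⟨by linarith, le_rfl⟩
  have w1 := hwe 0 1 le_rfl (by norm_num) hM1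
  have w2 := hwe (M - 1) M (by linarith) (by linarith) le_rfl
  have hC10 : C 1 = g z0 := by
    have := hC1 0 le_rfl
    rw [hC0] at this; simpa using this
  rw [hC10, hC0] at w1
  simp only [zero_add, sub_add_cancel, w1, w2, hC0] at k1 k2 k3
  rw [hgq]
  linear_combination k1 + k2 - k3

/-- Properties of the map of the plane obtained by extending a lift. -/
structure PBMap (F : (ℝ × ℝ) ≃ₜ (ℝ × ℝ)) (x0 : AddCircle (1:ℝ)) (μ : Measure Cyl) : Prop where
  per : ∀ p, F (p.1 + 1, p.2) = ((F p).1 + 1, (F p).2)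
  lo : ∀ x y, y ≤ 0 → F (x, y) = ((F (x, 0)).1, y)
  hi : ∀ x y, 1 ≤ y → F (x, y) = ((F (x, 1)).1, y)
  strip : ∀ p, p.2 ∈ Icc (0:ℝ) 1 → (F p).2 ∈ Icc (0:ℝ) 1
  lo_ne : ∀ x, (F (x, 0)).1 ≠ x
  hi_ne : ∀ x, (F (x, 1)).1 ≠ x
  fix : ∀ p, F p = p → (p.1 : AddCircle (1:ℝ)) = x0
  inv : ∀ V V' : Set Cyl, MeasurableSet V → MeasurableSet V' →
    (∀ p, covProj p ∈ V ↔ covProj (F p) ∈ V') → μ (V ∩ annA) = μ (V' ∩ annA)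

theorem covProj_cont : Continuous covProj := by
  unfold covProj
  exact ((AddCircle.continuous_mk' (1:ℝ)).comp continuous_fst).prodMk continuous_snd

theorem covProj_open : IsOpenMap covProj := by
  have : covProj = Prod.map (fun x : ℝ => (x : AddCircle (1:ℝ))) id := rfl
  rw [this]
  exact IsOpenMap.prodMap QuotientAddGroup.isOpenMap_coe IsOpenMap.id

theorem covProj_eq {p q : ℝ × ℝ} : covProj p = covProj q ↔ ∃ k : ℤ, q = (p.1 + k, p.2) := by
  constructor
  · intro h
    have h1 : (p.1 : AddCircle (1:ℝ)) = q.1 := congrArg Prod.fst h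
    have h2 : p.2 = q.2 := (congrArg Prod.snd h : (covProj p).2 = (covProj q).2)
    obtain ⟨k, hk⟩ := AddSubgroup.mem_zmultiples_iff.1 (QuotientAddGroup.eq.1 h1)
    refine ⟨k, Prod.ext ?_ h2.symm⟩
    simp at hk; simp [hk]
  · rintro ⟨k, rfl⟩
    refine Prod.ext ?_ rfl
    simp only [covProj]
    apply QuotientAddGroup.eq.2
    rw [AddSubgroup.mem_zmultiples_iff]
    exact ⟨k, by simp⟩

theorem PBMap.perk {F x0 μ} (hF : PBMap F x0 μ) (p : ℝ × ℝ) (k : ℤ) :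
    F (p.1 + k, p.2) = ((F p).1 + k, (F p).2) := by
  induction k using Int.induction_on with
  | zero => simp
  | succ n ih =>
    have := hF.per (p.1 + n, p.2)
    push_cast at ih ⊢
    rw [← add_assoc, this, ih]; simp [add_assoc]
  | pred n ih =>
    have := hF.per (p.1 + (-n - 1), p.2)
    push_cast at ih ⊢
    simp only at this
    have e1 : p.1 + (-(n:ℝ) - 1) + 1 = p.1 + -n := by ring
    rw [e1, ih] at this
    have h1 := congrArg Prod.fst this
    have h2 := congrArg Prod.snd this
    simp only at h1 h2
    apply Prod.ext
    · simp only; linarith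
    · simp only; linarith

theorem PBMap.mono {F x0 μ} (hF : PBMap F x0 μ) {c : ℝ} (hc : c ≤ 0) (p : ℝ × ℝ) (h : c ≤ p.2) :
    c ≤ (F p).2 := by
  rcases le_total p.2 0 with h1 | h1
  · rw [show p = (p.1, p.2) from rfl, hF.lo _ _ h1]; exact h
  rcases le_total p.2 1 with h2 | h2
  · exact hc.trans (hF.strip p ⟨h1, h2⟩).1
  · rw [show p = (p.1, p.2) from rfl, hF.hi _ _ h2]; exact h

theorem PBMap.le_one {F x0 μ} (hF : PBMap F x0 μ) (p : ℝ × ℝ) (h : p.2 ≤ 1) :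
    (F p).2 ≤ 1 := by
  rcases le_total p.2 0 with h1 | h1
  · rw [show p = (p.1, p.2) from rfl, hF.lo _ _ h1]; exact h
  · exact (hF.strip p ⟨h1, h⟩).2

theorem PBMap.snd_hi {F x0 μ} (hF : PBMap F x0 μ) (p : ℝ × ℝ) (h : 1 ≤ p.2) :
    (F p).2 = p.2 := by
  rw [show p = (p.1, p.2) from rfl, hF.hi _ _ h]

theorem PBMap.snd_lo {F x0 μ} (hF : PBMap F x0 μ) (p : ℝ × ℝ) (h : p.2 ≤ 0) :
    (F p).2 = p.2 := by
  rw [show p = (p.1, p.2) from rfl, hF.lo _ _ h]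

theorem pb_escape {F x0} {μ : Measure Cyl} (hF : PBMap F x0 μ) (T : (ℝ × ℝ) ≃ₜ (ℝ × ℝ)) (e : ℝ)
    (he0 : 0 < e) (he1 : e < 1) (hT1 : ∀ p, (T p).1 = p.1)
    (hTp : ∀ p q, covProj p = covProj q → (T p).2 = (T q).2)
    (hTm : ∀ x y y', y ≤ y' → (T (x, y)).2 ≤ (T (x, y')).2)
    (hTr : ∀ p, p.2 ≤ (T p).2)
    (hTl : ∀ p, p.2 ∈ Icc (-1:ℝ) 0 → (1 - e) * p.2 ≤ (T p).2)
    (hTu : ∀ p, 1 ≤ p.2 → p.2 + e * min 1 (p.2 - 1) ≤ (T p).2)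
    (hTμ : ∀ V V' : Set Cyl, MeasurableSet V → MeasurableSet V' →
        (∀ p, covProj p ∈ V' ↔ covProj (T p) ∈ V) →
        (∀ p, p.2 < 0 → covProj (T p) ∈ V) → (∀ z ∈ V, z.2 ≤ 1) →
        μ (V ∩ annA) ≠ μ (V' ∩ annA)) :
    ∃ (z0 : ℝ × ℝ) (N : ℕ), z0.2 ≤ -1 ∧ 2 ≤ ((fun p => T (F p))^[N] z0).2 := by
  set g : ℝ × ℝ → ℝ × ℝ := fun p => T (F p) with hg
  have hgo : IsOpenMap g := T.isOpenMap.comp F.isOpenMap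
  have hgon : ∀ n : ℕ, IsOpenMap g^[n] := by
    intro n
    induction n with
    | zero => exact IsOpenMap.id
    | succ n ih => rw [Function.iterate_succ]; exact ih.comp hgo
  have hgi : Function.Injective g := T.injective.comp F.injective
  have hFm : ∀ (c : ℝ) (p : ℝ × ℝ), c ≤ 0 → (F p).2 < c → p.2 < c := by
    intro c p hc h
    by_contra h'
    push Not at h'
    exact absurd (hF.mono hc p h') (not_le.2 h)
  obtain ⟨U, hU⟩ : ∃ U : Set (ℝ × ℝ), U = {z | ∃ n : ℕ, ∃ p : ℝ × ℝ, p.2 < -1 ∧ g^[n] p = z} :=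
    ⟨_, rfl⟩
  have hUm : ∀ z, z ∈ U ↔ ∃ n : ℕ, ∃ p : ℝ × ℝ, p.2 < -1 ∧ g^[n] p = z := by
    intro z; rw [hU]; rfl
  have hUo : IsOpen U := by
    have : U = ⋃ n : ℕ, g^[n] '' {p | p.2 < -1} := by
      ext z; rw [hUm]; simp [mem_iUnion]
    rw [this]
    exact isOpen_iUnion fun n => hgon n _ (isOpen_lt continuous_snd continuous_const)
  have hUg : ∀ z, z ∈ U ↔ g z ∈ U := by
    intro z
    rw [hUm, hUm]
    constructor
    · rintro ⟨n, p, hp, rfl⟩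
      exact ⟨n + 1, p, hp, Function.iterate_succ_apply' _ _ _⟩
    · rintro ⟨n, p, hp, h⟩
      cases n with
      | zero =>
        refine ⟨0, z, ?_, rfl⟩
        apply hFm _ _ (by norm_num)
        have h1 := hTr (F z)
        have h2 : T (F z) = p := h.symm
        rw [h2] at h1; linarith
      | succ n =>
        rw [Function.iterate_succ_apply'] at h
        exact ⟨n, p, hp, hgi h⟩
  have hgk : ∀ (p : ℝ × ℝ) (k : ℤ), g (p.1 + k, p.2) = ((g p).1 + k, (g p).2) := by
    intro p k
    rw [hg]; simp only
    rw [hF.perk]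
    apply Prod.ext
    · simp [hT1]
    · simp only
      exact (hTp _ _ (covProj_eq.2 ⟨k, rfl⟩)).symm
  have hgk' : ∀ (n : ℕ) (p : ℝ × ℝ) (k : ℤ),
      g^[n] (p.1 + k, p.2) = ((g^[n] p).1 + k, (g^[n] p).2) := by
    intro n
    induction n with
    | zero => intro p k; rfl
    | succ n ih =>
      intro p k
      rw [Function.iterate_succ_apply, Function.iterate_succ_apply, hgk, ih (g p) k]
  have hUp : ∀ p q, covProj p = covProj q → p ∈ U → q ∈ U := by
    intro p q h hp
    obtain ⟨k, rfl⟩ := covProj_eq.1 h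
    obtain ⟨n, r, hr, rfl⟩ := (hUm _).1 hp
    exact (hUm _).2 ⟨n, (r.1 + k, r.2), hr, hgk' n r k⟩
  have hTk : ∀ p q, covProj p = covProj q → covProj (T p) = covProj (T q) := by
    intro p q h
    refine Prod.ext ?_ (hTp p q h)
    simp only [covProj, hT1]
    exact congrArg Prod.fst h
  have hlow : ∀ (n : ℕ) (z : ℝ × ℝ), z.2 < -(1 - e)^n → ∃ p : ℝ × ℝ, p.2 < -1 ∧ g^[n] p = z := by
    intro n
    induction n with
    | zero => intro z hz; exact ⟨z, by simpa using hz, rfl⟩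
    | succ n ih =>
      intro z hz
      obtain ⟨u, rfl⟩ := T.surjective z
      obtain ⟨p', rfl⟩ := F.surjective u
      have hpow1 : (1 - e)^n ≤ 1 := pow_le_one₀ (by linarith) (by linarith)
      have hpow0 : 0 < (1 - e)^n := pow_pos (by linarith) n
      have h1 : (F p').2 < -(1 - e)^n := by
        by_contra h'
        push Not at h'
        have h2 := hTm (F p').1 _ _ h'
        have h3 := hTl ((F p').1, -(1 - e)^n) ⟨by simp only; linarith, by simp only; linarith⟩
        simp only [Prod.mk.eta] at h2 h3
        rw [pow_succ] at hz
        linarith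
      obtain ⟨p, hp, hpe⟩ := ih p' (hFm _ _ (by linarith) h1)
      exact ⟨p, hp, by rw [Function.iterate_succ_apply', hpe]⟩
  have hUlow : ∀ z : ℝ × ℝ, z.2 < 0 → z ∈ U := by
    intro z hz
    obtain ⟨n, hn⟩ := exists_pow_lt_of_lt_one (neg_pos.2 hz) (by linarith : 1 - e < 1)
    obtain ⟨p, hp, h⟩ := hlow n z (by linarith)
    exact (hUm z).2 ⟨n, p, hp, h⟩
  have hVU : ∀ p, covProj p ∈ covProj '' U ↔ p ∈ U := by
    intro p
    exact ⟨fun ⟨q, hq, h⟩ => hUp q p h hq, fun h => ⟨p, h, rfl⟩⟩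
  have hVU' : ∀ p, covProj p ∈ covProj '' (T ⁻¹' U) ↔ T p ∈ U := by
    intro p
    exact ⟨fun ⟨q, hq, h⟩ => hUp _ _ (hTk q p h) hq, fun h => ⟨p, h, rfl⟩⟩
  have hesc : ∃ z ∈ U, 1 < z.2 := by
    by_contra hc
    push Not at hc
    have m1 : MeasurableSet (covProj '' U) := (covProj_open _ hUo).measurableSet
    have m2 : MeasurableSet (covProj '' (T ⁻¹' U)) :=
      (covProj_open _ (hUo.preimage T.continuous)).measurableSet
    refine hTμ (covProj '' U) (covProj '' (T ⁻¹' U)) m1 m2 ?_ ?_ ?_ (hF.inv _ _ m1 m2 ?_)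
    · intro p; rw [hVU', hVU]
    · intro p hp
      rw [hVU]
      obtain ⟨q, rfl⟩ := F.surjective p
      exact (hUg q).1 (hUlow q (hFm 0 q le_rfl hp))
    · rintro _ ⟨z, hz, rfl⟩; exact hc z hz
    · intro p; rw [hVU, hVU', hUg]
  obtain ⟨z, hz, hz1⟩ := hesc
  obtain ⟨n, z0, hz0, hzn⟩ := (hUm z).1 hz
  have hm : 0 < e * min 1 (z.2 - 1) := mul_pos he0 (lt_min one_pos (by linarith))
  have hgrow : ∀ k : ℕ, z.2 + k * (e * min 1 (z.2 - 1)) ≤ (g^[k] z).2 := by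
    intro k
    induction k with
    | zero => simp
    | succ k ih =>
      rw [Function.iterate_succ_apply']
      have hge : z.2 ≤ (g^[k] z).2 := by
        have : 0 ≤ (k:ℝ) * (e * min 1 (z.2 - 1)) := by positivity
        linarith
      have h1 := hTu (F (g^[k] z)) (by rw [hF.snd_hi _ (by linarith)]; linarith)
      rw [hF.snd_hi _ (by linarith)] at h1
      have h2 : e * min 1 (z.2 - 1) ≤ e * min 1 ((g^[k] z).2 - 1) := by gcongr
      push_cast
      have h3 : (g (g^[k] z)).2 = (T (F (g^[k] z))).2 := rfl
      linarith
  obtain ⟨k, hk⟩ := exists_nat_gt (1 / (e * min 1 (z.2 - 1)))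
  rw [div_lt_iff₀ hm] at hk
  refine ⟨z0, k + n, hz0.le, ?_⟩
  rw [Function.iterate_add_apply, hzn]
  linarith [hgrow k]

theorem PBMap.ne_lo {F x0 μ} (hF : PBMap F x0 μ) (p : ℝ × ℝ) (h : p.2 ≤ 0) : F p ≠ p := by
  intro hc
  rw [show p = (p.1, p.2) from rfl, hF.lo _ _ h] at hc
  exact hF.lo_ne _ (Prod.ext_iff.1 hc).1

theorem PBMap.ne_hi {F x0 μ} (hF : PBMap F x0 μ) (p : ℝ × ℝ) (h : 1 ≤ p.2) : F p ≠ p := by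
  intro hc
  rw [show p = (p.1, p.2) from rfl, hF.hi _ _ h] at hc
  exact hF.hi_ne _ (Prod.ext_iff.1 hc).1

theorem pb_eta {F x0} {μ : Measure Cyl} (hF : PBMap F x0 μ) :
    ∃ η : ℝ, 0 < η ∧ η ≤ 1 ∧ ∀ p, F p ≠ p →
      ((F p).2 ∈ Icc (0:ℝ) 1 ∧ ‖((F p).1 : AddCircle (1:ℝ)) - x0‖ ≤ 1/4) ∨
      η ≤ ‖pbC (F p - p)‖ := by
  have hvc : Continuous fun p => ‖pbC (F p - p)‖ := by
    have := pbC_cont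
    have := F.continuous
    fun_prop
  have hcc : Continuous fun p => ‖((F p).1 : AddCircle (1:ℝ)) - x0‖ := by
    have h1 : Continuous fun p => ((F p).1 : AddCircle (1:ℝ)) :=
      (AddCircle.continuous_mk' (1:ℝ)).comp (continuous_fst.comp F.continuous)
    fun_prop
  obtain ⟨K, hK⟩ : ∃ K : Set (ℝ × ℝ), K = (Icc (0:ℝ) 1 ×ˢ Icc (0:ℝ) 1) ∩
      {p | 1/4 ≤ ‖((F p).1 : AddCircle (1:ℝ)) - x0‖ ∨ p.2 = 0 ∨ p.2 = 1} := ⟨_, rfl⟩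
  have hKc : IsCompact K := by
    rw [hK]
    refine (isCompact_Icc.prod isCompact_Icc).inter_right ?_
    refine IsClosed.union (isClosed_le continuous_const hcc) (IsClosed.union ?_ ?_)
    · exact isClosed_eq continuous_snd continuous_const
    · exact isClosed_eq continuous_snd continuous_const
  have hKpos : ∀ p ∈ K, 0 < ‖pbC (F p - p)‖ := by
    intro p hp
    rw [hK] at hp
    rw [norm_pos_iff, ne_eq, pbC_eq_zero, sub_eq_zero]
    intro hc
    rcases hp.2 with h | h | h
    · rw [hc, hF.fix p hc] at h; norm_num at h
    · exact hF.ne_lo p h.le hc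
    · exact hF.ne_hi p h.ge hc
  obtain ⟨η, hη, hηK⟩ := hKc.exists_forall_le' hvc.continuousOn hKpos
  have hper : ∀ p : ℝ × ℝ, pbC (F (Int.fract p.1, p.2) - (Int.fract p.1, p.2)) = pbC (F p - p) := by
    intro p
    have h1 := hF.perk p (-⌊p.1⌋)
    have h2 : p.1 + ((-⌊p.1⌋ : ℤ) : ℝ) = Int.fract p.1 := by push_cast; rw [Int.fract]; ring
    rw [h2] at h1
    rw [h1]; congr 1
    apply Prod.ext
    · simp only [Prod.fst_sub, Int.fract]; push_cast; ring
    · simp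
  have hfr : ∀ x : ℝ, Int.fract x ∈ Icc (0:ℝ) 1 := fun x =>
    ⟨Int.fract_nonneg x, (Int.fract_lt_one x).le⟩
  refine ⟨min η 1, lt_min hη one_pos, min_le_right _ _, ?_⟩
  intro p hp
  by_cases hA : (F p).2 ∈ Icc (0:ℝ) 1 ∧ ‖((F p).1 : AddCircle (1:ℝ)) - x0‖ ≤ 1/4
  · exact Or.inl hA
  right
  refine (min_le_left _ _).trans ?_
  rcases le_total p.2 0 with h0 | h0
  · have e1 : pbC (F p - p) = pbC (F (p.1, 0) - (p.1, 0)) := by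
      conv_lhs => rw [show p = (p.1, p.2) from rfl, hF.lo _ _ h0]
      rw [hF.lo p.1 0 le_rfl]; congr 1; apply Prod.ext <;> simp
    rw [e1, ← hper]
    apply hηK; rw [hK]
    exact ⟨⟨hfr _, by simp⟩, Or.inr (Or.inl rfl)⟩
  rcases le_total p.2 1 with h1 | h1
  · rw [← hper]
    apply hηK; rw [hK]
    refine ⟨⟨hfr _, ⟨h0, h1⟩⟩, Or.inl ?_⟩
    have h1 := hF.perk p (-⌊p.1⌋)
    have h2 : p.1 + ((-⌊p.1⌋ : ℤ) : ℝ) = Int.fract p.1 := by push_cast; rw [Int.fract]; ring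
    rw [h2] at h1
    have h3 : covProj (F p) = covProj (F (Int.fract p.1, p.2)) := covProj_eq.2 ⟨_, h1⟩
    have h4 : ((F p).1 : AddCircle (1:ℝ)) = (F (Int.fract p.1, p.2)).1 := congrArg Prod.fst h3
    rw [← h4]
    by_contra hc
    push Not at hc
    exact hA ⟨hF.strip p ⟨h0, by assumption⟩, hc.le⟩
  · have e1 : pbC (F p - p) = pbC (F (p.1, 1) - (p.1, 1)) := by
      conv_lhs => rw [show p = (p.1, p.2) from rfl, hF.hi _ _ h1]
      rw [hF.hi p.1 1 le_rfl]; congr 1; apply Prod.ext <;> simp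
    rw [e1, ← hper]
    apply hηK; rw [hK]
    exact ⟨⟨hfr _, by simp⟩, Or.inr (Or.inr rfl)⟩

theorem pb_main {F x0} {μ : Measure Cyl} [IsFiniteMeasure μ] (hF : PBMap F x0 μ)
    (d : Cyl → ℝ) (hd_meas : Measurable d)
    (hd_pos : ∀ᵐ a ∂(volume.restrict annA), 0 < d a)
    (hdens : ∀ U : Set Cyl, U ⊆ annA → MeasurableSet U →
      μ U = ∫⁻ a in U, ENNReal.ofReal (d a) ∂volume)
    (l : ℝ × ℝ → ℂ) (hl : ContinuousOn l {p | F p ≠ p})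
    (hle : ∀ p, F p ≠ p → Complex.exp (l p) = pbC (F p - p)) :
    ∃ z q : ℝ × ℝ, z.2 ≤ 0 ∧ 1 ≤ q.2 ∧
      l z - l q = pbA (pbC (F z - z)) - pbA (pbC (F q - q)) := by
  obtain ⟨η, hη0, hη1, hη⟩ := pb_eta hF
  obtain ⟨T, e, he0, he1, hT1, hTp, hTm, hTr, hTη, hTfix, hTe, hTl, hTu, hTμ⟩ :=
    pb_T_exists μ d hd_meas hd_pos hdens x0 η hη0
  obtain ⟨z0, N, hz0, hN⟩ := pb_escape hF T e he0 he1 hT1 hTp hTm hTr hTl hTu hTμ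
  have hv0 : ∀ p, F p ≠ p → pbC (F p - p) ≠ 0 := by
    intro p hp
    rw [ne_eq, pbC_eq_zero, sub_eq_zero]; exact hp
  have hre : ∀ p, F p ≠ p → 0 < (pbC (T (F p) - p) / pbC (F p - p)).re := by
    intro p hp
    have hv := hv0 p hp
    have ht : (T (F p)).2 - (F p).2 < ‖pbC (F p - p)‖ := by
      rcases hη p hp with h | h
      · rw [hTfix _ h.1 h.2, sub_self]; exact norm_pos_iff.2 hv
      · linarith [hTη (F p)]
    have ht0 := hTr (F p)
    set t := (T (F p)).2 - (F p).2 with ht'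
    have e1 : pbC (T (F p) - p) = pbC (F p - p) + (t:ℂ) * Complex.I := by
      apply Complex.ext <;> simp [pbC, hT1, ht']
    rw [e1, add_div, div_self hv, Complex.add_re, Complex.one_re]
    have h2 : ‖(t:ℂ) * Complex.I / pbC (F p - p)‖ < 1 := by
      rw [norm_div, div_lt_one (norm_pos_iff.2 hv)]
      rw [norm_mul, Complex.norm_I, mul_one, Complex.norm_real, Real.norm_eq_abs,
        abs_of_nonneg (by linarith)]
      exact ht
    have h3 := (abs_le.1 (Complex.abs_re_le_norm ((t:ℂ) * Complex.I / pbC (F p - p)))).1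
    linarith
  have hfixeq : ∀ p, T (F p) = p ↔ F p = p := by
    intro p
    constructor
    · intro h
      by_contra hc
      have := hre p hc
      rw [h, sub_self, pbC_eq_zero.2 rfl] at this
      simp at this
    · intro h
      rw [h]
      apply hTfix
      · constructor
        · by_contra hc; exact hF.ne_lo p (not_le.1 hc).le h
        · by_contra hc; exact hF.ne_hi p (not_le.1 hc).le h
      · rw [hF.fix p h]; norm_num
  have hgc : Continuous fun p => T (F p) := T.continuous.comp F.continuous
  obtain ⟨q, hq1, hq2, hq3⟩ := pb_winding (fun p => T (F p)) hgc (T.injective.comp F.injective)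
    z0 e he0 he1 
    (by rw [hTe _ (by rw [hF.snd_lo _ (by linarith)]; exact hz0), hF.snd_lo _ (by linarith)])
    hz0
    (by
      intro p hp
      have h1 := hF.mono (by linarith) p hp
      have h2 := hTm (F p).1 _ _ h1
      rw [hTe ((F p).1, z0.2) hz0] at h2
      exact h2) N hN
    (by
      intro p hp
      linarith [hTη (F p), hF.le_one p hp.le])
    (fun p => l p + Complex.log (pbC (T (F p) - p) / pbC (F p - p)))
    (by
      have hs : {p | T (F p) ≠ p} = {p | F p ≠ p} := by
        ext p; simp [hfixeq]
      simp only [hs]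
      refine hl.add (ContinuousOn.clog ?_ ?_)
      · refine ContinuousOn.div ?_ ?_ (fun p hp => hv0 p hp)
        · exact (pbC_cont.comp (hgc.sub continuous_id)).continuousOn
        · exact (pbC_cont.comp (F.continuous.sub continuous_id)).continuousOn
      · intro p hp
        exact Or.inl (hre p hp))
    (by
      intro p hp
      have hp' : F p ≠ p := fun h => hp ((hfixeq p).2 h)
      have h1 := hre p hp'
      have h2 : pbC (T (F p) - p) / pbC (F p - p) ≠ 0 := by
        intro hh; rw [hh] at h1; simp at h1
      have h3 := hv0 p hp'
      rw [Complex.exp_add, hle p hp', Complex.exp_log h2]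
      field_simp)
  have hz0F := hF.ne_lo z0 (by linarith)
  have hqF := hF.ne_hi q hq1
  refine ⟨z0, q, by linarith, hq1, ?_⟩
  rw [pbA_mul (hv0 z0 hz0F) (by simp [pbC, hF.snd_lo z0 (by linarith)]) (hre z0 hz0F),
    pbA_mul (hv0 q hqF) (by simp [pbC, hF.snd_hi q hq1]) (hre q hqF)] at hq3
  linear_combination hq3

theorem pb_slit_log (b : ℝ) (S : Set ℝ) (hS : IsClosed S) (w : ℝ × ℝ → ℂ)
    (hw : ContinuousOn w {p | p.2 < b ∨ p.1 ∉ S}) (h0 : ∀ p ∈ {p : ℝ × ℝ | p.2 < b ∨ p.1 ∉ S}, w p ≠ 0) :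
    IsOpen {p : ℝ × ℝ | p.2 < b ∨ p.1 ∉ S} ∧ IsPreconnected {p : ℝ × ℝ | p.2 < b ∨ p.1 ∉ S} ∧
    ∃ l : ℝ × ℝ → ℂ, ContinuousOn l {p | p.2 < b ∨ p.1 ∉ S} ∧
      ∀ p ∈ {p : ℝ × ℝ | p.2 < b ∨ p.1 ∉ S}, Complex.exp (l p) = w p := by
  set Ω : Set (ℝ × ℝ) := {p | p.2 < b ∨ p.1 ∉ S} with hΩ
  have hΩm : ∀ p : ℝ × ℝ, p ∈ Ω ↔ p.2 < b ∨ p.1 ∉ S := fun p => Iff.rfl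
  have hΩo : IsOpen Ω :=
    (isOpen_lt continuous_snd continuous_const).union (hS.isOpen_compl.preimage continuous_fst)
  have hbase : ∀ x : ℝ, (x, b - 1) ∈ Ω := fun x => Or.inl (by simp)
  have hvert : ∀ (t : unitInterval) (p : Ω),
      (p.1.1, (1 - (t:ℝ)) * p.1.2 + (t:ℝ) * (b - 1)) ∈ Ω := by
    rintro t ⟨p, hp⟩
    rcases hp with hp | hp
    · left
      have h1 := t.2.1
      have h2 := t.2.2
      simp only
      rcases h1.eq_or_lt with h | h
      · rw [← h]; simpa using hp
      · nlinarith
    · right; exact hp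
  let r : C(Ω, Ω) := ⟨fun p => ⟨(p.1.1, b - 1), hbase _⟩, by fun_prop⟩
  let H1 : ContinuousMap.Homotopy (ContinuousMap.id Ω) r :=
    { toFun := fun q => ⟨(q.2.1.1, (1 - (q.1:ℝ)) * q.2.1.2 + (q.1:ℝ) * (b - 1)), hvert q.1 q.2⟩
      continuous_toFun := by fun_prop
      map_zero_left := by intro p; apply Subtype.ext; simp
      map_one_left := by intro p; apply Subtype.ext; simp [r] }
  let H2 : ContinuousMap.Homotopy r (ContinuousMap.const Ω ⟨(0, b - 1), hbase 0⟩) :=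
    { toFun := fun q => ⟨((1 - (q.1:ℝ)) * q.2.1.1, b - 1), hbase _⟩
      continuous_toFun := by fun_prop
      map_zero_left := by intro p; apply Subtype.ext; simp [r]
      map_one_left := by intro p; apply Subtype.ext; simp }
  have hc : ContractibleSpace Ω := by
    rw [contractible_iff_id_nullhomotopic]
    exact ⟨_, ⟨H1.trans H2⟩⟩
  have hlpc : LocallyPathConnectedSpace Ω := hΩo.locallyPathConnectedSpace
  have hpre : IsPreconnected Ω := isPreconnected_iff_preconnectedSpace.2 inferInstance
  obtain ⟨l, hl, hle⟩ := pb_log_lift (fun p : Ω => w p) hw.domRestrict (fun p => h0 p p.2)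
  classical
  refine ⟨hΩo, hpre, fun p => if h : p ∈ Ω then l ⟨p, h⟩ else 0, ?_, ?_⟩
  · rw [continuousOn_iff_continuous_domRestrict]
    convert hl using 1
    funext p
    simp
  · intro p hp
    simp only [hp, dif_pos]
    exact hle ⟨p, hp⟩

theorem pb_slit_log' (b : ℝ) (S : Set ℝ) (hS : IsClosed S) (w : ℝ × ℝ → ℂ)
    (hw : ContinuousOn w {p | b < p.2 ∨ p.1 ∉ S}) (h0 : ∀ p ∈ {p : ℝ × ℝ | b < p.2 ∨ p.1 ∉ S}, w p ≠ 0) :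
    IsOpen {p : ℝ × ℝ | b < p.2 ∨ p.1 ∉ S} ∧ IsPreconnected {p : ℝ × ℝ | b < p.2 ∨ p.1 ∉ S} ∧
    ∃ l : ℝ × ℝ → ℂ, ContinuousOn l {p | b < p.2 ∨ p.1 ∉ S} ∧
      ∀ p ∈ {p : ℝ × ℝ | b < p.2 ∨ p.1 ∉ S}, Complex.exp (l p) = w p := by
  obtain ⟨φ, hφ⟩ : ∃ φ : ℝ × ℝ → ℝ × ℝ, φ = fun p => (p.1, -p.2) := ⟨_, rfl⟩
  have hφc : Continuous φ := by rw [hφ]; fun_prop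
  have hφφ : ∀ p, φ (φ p) = p := by intro p; rw [hφ]; simp
  have h1 : ∀ p ∈ {p : ℝ × ℝ | p.2 < -b ∨ p.1 ∉ S}, φ p ∈ {p : ℝ × ℝ | b < p.2 ∨ p.1 ∉ S} := by
    intro p hp
    rw [hφ]
    rcases hp with h | h
    · left; simp only; linarith
    · right; exact h
  have h2 : ∀ p ∈ {p : ℝ × ℝ | b < p.2 ∨ p.1 ∉ S}, φ p ∈ {p : ℝ × ℝ | p.2 < -b ∨ p.1 ∉ S} := by
    intro p hp
    rw [hφ]
    rcases hp with h | h
    · left; simp only; linarith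
    · right; exact h
  obtain ⟨ho, hp, l, hl, hle⟩ := pb_slit_log (-b) S hS (fun p => w (φ p))
    (hw.comp hφc.continuousOn h1) (fun p hp => h0 _ (h1 p hp))
  have him : {p : ℝ × ℝ | b < p.2 ∨ p.1 ∉ S} = φ '' {p : ℝ × ℝ | p.2 < -b ∨ p.1 ∉ S} := by
    ext p
    exact ⟨fun h => ⟨φ p, h2 p h, hφφ p⟩, fun ⟨q, hq, h⟩ => h ▸ h1 q hq⟩
  refine ⟨(isOpen_lt continuous_const continuous_snd).union (hS.isOpen_compl.preimage continuous_fst),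
    ?_, fun p => l (φ p), hl.comp hφc.continuousOn h2, ?_⟩
  · rw [him]; exact hp.image _ hφc.continuousOn
  · intro p hp
    rw [hle _ (h2 p hp), hφφ]

/-- On a set where the vector field points upwards or is horizontal, the branches agree. -/
theorem pb_branch {v l : ℝ × ℝ → ℂ} {S : Set (ℝ × ℝ)} (hS : IsPreconnected S)
    (hv : Continuous v) (hl : ContinuousOn l S) (h0 : ∀ p ∈ S, v p ≠ 0)
    (hi : ∀ p ∈ S, 0 ≤ (v p).im) (he : ∀ p ∈ S, Complex.exp (l p) = v p) {p q : ℝ × ℝ}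
    (hp : p ∈ S) (hq : q ∈ S) : l p - pbA (v p) = l q - pbA (v q) :=
  pb_log_unique hS hl (pbA_contOn hv.continuousOn h0 hi)
    (fun x hx => by rw [he x hx, pbA_exp (h0 x hx)]) hp hq

theorem pb_lo_preconn : IsPreconnected {p : ℝ × ℝ | p.2 ≤ 0} :=
  (convex_halfSpace_le (f := fun p : ℝ × ℝ => p.2) (IsLinearMap.mk (fun _ _ => rfl) (fun _ _ => rfl)) 0).isPreconnected

theorem pb_hi_preconn : IsPreconnected {p : ℝ × ℝ | 1 ≤ p.2} :=
  (convex_halfSpace_ge (f := fun p : ℝ × ℝ => p.2) (IsLinearMap.mk (fun _ _ => rfl) (fun _ _ => rfl)) 1).isPreconnected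

theorem pb_log_exists {F x0} {μ : Measure Cyl} (hF : PBMap F x0 μ)
    (hfix1 : ∀ p q, F p = p → F q = q → covProj p = covProj q) :
    ∃ l : ℝ × ℝ → ℂ, ContinuousOn l {p | F p ≠ p} ∧
      ∀ p, F p ≠ p → Complex.exp (l p) = pbC (F p - p) := by
  obtain ⟨v, hv⟩ : ∃ v : ℝ × ℝ → ℂ, v = fun p => pbC (F p - p) := ⟨_, rfl⟩
  have hvc : Continuous v := by
    rw [hv]; exact pbC_cont.comp (F.continuous.sub continuous_id)
  have hv0 : ∀ p, F p ≠ p → v p ≠ 0 := by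
    intro p hp
    rw [hv]; simp only [ne_eq, pbC_eq_zero, sub_eq_zero]; exact hp
  have hvp : ∀ p : ℝ × ℝ, v (p.1 + 1, p.2) = v p := by
    intro p
    rw [hv]; simp only [hF.per]
    congr 1; apply Prod.ext <;> simp
  have hvlo : ∀ p : ℝ × ℝ, p.2 ≤ 0 → (v p).im = 0 := by
    intro p hp; rw [hv]; simp [pbC, hF.snd_lo p hp]
  have hvhi : ∀ p : ℝ × ℝ, 1 ≤ p.2 → (v p).im = 0 := by
    intro p hp; rw [hv]; simp [pbC, hF.snd_hi p hp]
  suffices h : ∃ l : ℝ × ℝ → ℂ, ContinuousOn l {p | F p ≠ p} ∧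
      ∀ p, F p ≠ p → Complex.exp (l p) = v p by rw [hv] at h; exact h
  by_cases hne : ∃ p, F p = p
  swap
  · push Not at hne
    obtain ⟨l, hl, hle⟩ := pb_log_lift v hvc (fun p => hv0 p (hne p))
    exact ⟨l, hl.continuousOn, fun p _ => hle p⟩
  obtain ⟨⟨a, b⟩, hab⟩ := hne
  have hb0 : 0 < b := by
    by_contra hc; exact hF.ne_lo (a, b) (not_lt.1 hc) hab
  have hb1 : b < 1 := by
    by_contra hc; exact hF.ne_hi (a, b) (not_lt.1 hc) hab
  obtain ⟨S, hS⟩ : ∃ S : Set ℝ, S = {x : ℝ | (x : AddCircle (1:ℝ)) = (a : AddCircle (1:ℝ))} := ⟨_, rfl⟩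
  have hSc : IsClosed S := by
    rw [hS]; exact isClosed_eq (AddCircle.continuous_mk' (1:ℝ)) continuous_const
  have hSm : ∀ x, x ∈ S ↔ ∃ k : ℤ, x = a + k := by
    intro x
    rw [hS]
    constructor
    · intro h
      have h' : covProj (a, b) = covProj (x, b) := Prod.ext (Eq.symm h) rfl
      obtain ⟨k, hk⟩ := covProj_eq.1 h'
      exact ⟨k, congrArg Prod.fst hk⟩
    · rintro ⟨k, rfl⟩
      have h' : covProj (a, b) = covProj (a + k, b) := covProj_eq.2 ⟨k, rfl⟩
      exact (congrArg Prod.fst h').symm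
  have hfixm : ∀ p, F p = p ↔ p.2 = b ∧ p.1 ∈ S := by
    intro p
    constructor
    · intro h
      obtain ⟨k, rfl⟩ := covProj_eq.1 (hfix1 _ _ hab h)
      exact ⟨rfl, (hSm _).2 ⟨k, rfl⟩⟩
    · rintro ⟨h1, h2⟩
      obtain ⟨k, hk⟩ := (hSm _).1 h2
      have := hF.perk (a, b) k
      rw [hab] at this
      have e1 : p = (a + k, b) := Prod.ext hk h1
      rw [e1]; exact this
  have hneU : ∀ p ∈ {p : ℝ × ℝ | p.2 < b ∨ p.1 ∉ S}, F p ≠ p := by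
    intro p hp h
    have h' := (hfixm p).1 h
    rcases hp with h1 | h1
    · exact h1.ne h'.1
    · exact h1 h'.2
  have hneD : ∀ p ∈ {p : ℝ × ℝ | b < p.2 ∨ p.1 ∉ S}, F p ≠ p := by
    intro p hp h
    have h' := (hfixm p).1 h
    rcases hp with h1 | h1
    · exact h1.ne' h'.1
    · exact h1 h'.2
  obtain ⟨hUo, hUc, lu, hlu, hlue⟩ := pb_slit_log b S hSc v hvc.continuousOn (fun p hp => hv0 p (hneU p hp))
  obtain ⟨hDo, hDc, ld, hld, hlde⟩ := pb_slit_log' b S hSc v hvc.continuousOn (fun p hp => hv0 p (hneD p hp))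
  have hSp : ∀ x, x ∈ S ↔ x + 1 ∈ S := by
    intro x
    rw [hSm, hSm]
    constructor
    · rintro ⟨k, rfl⟩; exact ⟨k + 1, by push_cast; ring⟩
    · rintro ⟨k, h⟩; exact ⟨k - 1, by push_cast; linarith⟩
  have hτ : Continuous fun p : ℝ × ℝ => (p.1 + 1, p.2) := by fun_prop
  have hUτ : ∀ p ∈ {p : ℝ × ℝ | p.2 < b ∨ p.1 ∉ S}, (p.1 + 1, p.2) ∈ {p : ℝ × ℝ | p.2 < b ∨ p.1 ∉ S} := by
    intro p hp
    rcases hp with h | h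
    · exact Or.inl h
    · right; rw [hSp] at h; exact h
  have hDτ : ∀ p ∈ {p : ℝ × ℝ | b < p.2 ∨ p.1 ∉ S}, (p.1 + 1, p.2) ∈ {p : ℝ × ℝ | b < p.2 ∨ p.1 ∉ S} := by
    intro p hp
    rcases hp with h | h
    · exact Or.inl h
    · right; rw [hSp] at h; exact h
  -- periodicity of the two branches
  have hluper : ∀ p ∈ {p : ℝ × ℝ | p.2 < b ∨ p.1 ∉ S}, lu (p.1 + 1, p.2) = lu p := by
    intro p hp
    have hsub : {p : ℝ × ℝ | p.2 ≤ 0} ⊆ {p : ℝ × ℝ | p.2 < b ∨ p.1 ∉ S} :=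
      fun q hq => Or.inl (lt_of_le_of_lt hq hb0)
    have k0 := pb_branch (v := v) pb_lo_preconn hvc (hlu.mono hsub)
      (fun q hq => hv0 q (hneU q (hsub hq))) (fun q hq => (hvlo q hq).ge) (fun q hq => hlue q (hsub hq))
      (p := (0 + 1, 0)) (q := (0, 0)) (by simp) (by simp)
    rw [hvp (0, 0)] at k0
    have k1 := pb_log_unique hUc (l1 := fun p => lu (p.1 + 1, p.2)) (l2 := lu)
      (hlu.comp hτ.continuousOn hUτ) hlu
      (fun q hq => by rw [hlue _ (hUτ q hq), hlue q hq, hvp]) hp (b := (0, 0)) (Or.inl hb0)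
    simp only at k1
    linear_combination k1 + k0
  have hldper : ∀ p ∈ {p : ℝ × ℝ | b < p.2 ∨ p.1 ∉ S}, ld (p.1 + 1, p.2) = ld p := by
    intro p hp
    have hsub : {p : ℝ × ℝ | 1 ≤ p.2} ⊆ {p : ℝ × ℝ | b < p.2 ∨ p.1 ∉ S} :=
      fun q hq => Or.inl (lt_of_lt_of_le hb1 hq)
    have k0 := pb_branch (v := v) pb_hi_preconn hvc (hld.mono hsub)
      (fun q hq => hv0 q (hneD q (hsub hq))) (fun q hq => (hvhi q hq).ge) (fun q hq => hlde q (hsub hq))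
      (p := (0 + 1, 1)) (q := (0, 1)) (by simp) (by simp)
    rw [hvp (0, 1)] at k0
    have k1 := pb_log_unique hDc (l1 := fun p => ld (p.1 + 1, p.2)) (l2 := ld)
      (hld.comp hτ.continuousOn hDτ) hld
      (fun q hq => by rw [hlde _ (hDτ q hq), hlde q hq, hvp]) hp (b := (0, 1)) (Or.inl hb1)
    simp only at k1
    linear_combination k1 + k0
  -- agreement on the strips
  obtain ⟨κ, hκ⟩ : ∃ κ : ℂ, κ = lu (a + 1/2, 0) - ld (a + 1/2, 0) := ⟨_, rfl⟩
  have hstrip : ∀ x y : ℝ, a < x → x < a + 1 → x ∉ S := by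
    intro x y h1 h2 h3
    obtain ⟨k, rfl⟩ := (hSm x).1 h3
    have h4 : (0:ℝ) < k := by linarith
    have h5 : (k:ℝ) < 1 := by linarith
    have h4' : 0 < k := by exact_mod_cast h4
    have h5' : k < 1 := by exact_mod_cast h5
    omega
  have hag0 : ∀ x y : ℝ, a < x → x < a + 1 → lu (x, y) - ld (x, y) = κ := by
    intro x y h1 h2
    rw [hκ]
    have hpc : IsPreconnected (Ioo a (a + 1) ×ˢ (univ : Set ℝ)) :=
      isPreconnected_Ioo.prod isPreconnected_univ
    have hout : ∀ p ∈ Ioo a (a + 1) ×ˢ (univ : Set ℝ), p.1 ∉ S :=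
      fun p hp => hstrip p.1 p.2 hp.1.1 hp.1.2
    refine pb_log_unique hpc (hlu.mono fun p hp => Or.inr (hout p hp))
      (hld.mono fun p hp => Or.inr (hout p hp)) ?_ ⟨⟨h1, h2⟩, mem_univ _⟩
      ⟨⟨by simp only; linarith, by simp only; linarith⟩, mem_univ _⟩
    intro p hp
    rw [hlue p (Or.inr (hout p hp)), hlde p (Or.inr (hout p hp))]
  have hagk : ∀ (k : ℤ) (x y : ℝ), a + k < x → x < a + k + 1 → lu (x, y) - ld (x, y) = κ := by
    intro k
    induction k using Int.induction_on with
    | zero => intro x y h1 h2; exact hag0 x y (by simpa using h1) (by simpa using h2)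
    | succ n ih =>
      intro x y h1 h2
      push_cast at h1 h2 ih
      have hx : x - 1 ∉ S := by
        intro h
        obtain ⟨k, hk⟩ := (hSm _).1 h
        have h4 : ((n:ℤ):ℝ) < k := by push_cast; linarith
        have h5 : (k:ℝ) < ((n:ℤ):ℝ) + 1 := by push_cast; linarith
        have h4' : (n:ℤ) < k := by exact_mod_cast h4
        have h5' : k < (n:ℤ) + 1 := by exact_mod_cast h5
        omega
      have e1 := hluper (x - 1, y) (Or.inr hx)
      have e2 := hldper (x - 1, y) (Or.inr hx)
      simp only [sub_add_cancel] at e1 e2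
      rw [e1, e2]
      exact ih _ _ (by linarith) (by linarith)
    | pred n ih =>
      intro x y h1 h2
      push_cast at h1 h2 ih
      have hx : x ∉ S := by
        intro h
        obtain ⟨k, hk⟩ := (hSm _).1 h
        have h4 : ((-n - 1:ℤ):ℝ) < k := by push_cast; linarith
        have h5 : (k:ℝ) < ((-n - 1:ℤ):ℝ) + 1 := by push_cast; linarith
        have h4' : (-n - 1:ℤ) < k := by exact_mod_cast h4
        have h5' : k < (-n - 1:ℤ) + 1 := by exact_mod_cast h5
        omega
      have e1 := hluper (x, y) (Or.inr hx)
      have e2 := hldper (x, y) (Or.inr hx)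
      simp only at e1 e2
      rw [← e1, ← e2]
      exact ih _ _ (by linarith) (by linarith)
  have hag : ∀ p : ℝ × ℝ, p.1 ∉ S → lu p = ld p + κ := by
    intro p hp
    have h1 := Int.floor_le (p.1 - a)
    have h2 := Int.lt_floor_add_one (p.1 - a)
    have h3 : a + ⌊p.1 - a⌋ ≠ p.1 := fun h => hp ((hSm _).2 ⟨_, h.symm⟩)
    have h4 : a + ⌊p.1 - a⌋ < p.1 := lt_of_le_of_ne (by linarith) h3
    have := hagk ⌊p.1 - a⌋ p.1 p.2 h4 (by linarith)
    simp only [Prod.mk.eta] at this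
    linear_combination this
  have hexpκ : Complex.exp κ = 1 := by
    have hx : ((a + 1/2, 0) : ℝ × ℝ).1 ∉ S := hstrip _ 0 (by simp) (by simp only; linarith)
    rw [hκ, Complex.exp_sub, hlue _ (Or.inr hx), hlde _ (Or.inr hx), div_self]
    exact hv0 _ (hneU _ (Or.inr hx))
  classical
  obtain ⟨l, hl⟩ : ∃ l : ℝ × ℝ → ℂ, l = fun p => if p.2 < b ∨ p.1 ∉ S then lu p else ld p + κ :=
    ⟨_, rfl⟩
  have hlU : ∀ p ∈ {p : ℝ × ℝ | p.2 < b ∨ p.1 ∉ S}, l p = lu p := by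
    intro p hp; rw [hl]; exact if_pos hp
  have hlD : ∀ p ∈ {p : ℝ × ℝ | b < p.2 ∨ p.1 ∉ S}, l p = ld p + κ := by
    intro p hp; rw [hl]; simp only
    split_ifs with h
    · apply hag
      rcases hp with h1 | h1
      · rcases h with h2 | h2
        · exact absurd h1 (not_lt.2 h2.le)
        · exact h2
      · exact h1
    · rfl
  have hcov : ∀ p, F p ≠ p → p ∈ {p : ℝ × ℝ | p.2 < b ∨ p.1 ∉ S} ∨ p ∈ {p : ℝ × ℝ | b < p.2 ∨ p.1 ∉ S} := by
    intro p hp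
    by_cases h1 : p.1 ∈ S
    · have h2 : p.2 ≠ b := fun h => hp ((hfixm p).2 ⟨h, h1⟩)
      rcases lt_or_gt_of_ne h2 with h | h
      · exact Or.inl (Or.inl h)
      · exact Or.inr (Or.inl h)
    · exact Or.inl (Or.inr h1)
  refine ⟨l, ?_, ?_⟩
  · intro p hp
    apply ContinuousAt.continuousWithinAt
    rcases hcov p hp with h | h
    · exact (hlu.congr hlU).continuousAt (hUo.mem_nhds h)
    · exact ((hld.add continuousOn_const).congr hlD).continuousAt (hDo.mem_nhds h)
  · intro p hp
    rcases hcov p hp with h | h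
    · rw [hlU p h, hlue p h]
    · rw [hlD p h, Complex.exp_add, hlde p h, hexpκ, mul_one]

/-- clamp to the unit interval -/
def pbCl (y : ℝ) : ℝ := max 0 (min y 1)

theorem pbCl_cont : Continuous pbCl := by unfold pbCl; fun_prop
theorem pbCl_mem (y : ℝ) : pbCl y ∈ Icc (0:ℝ) 1 :=
  ⟨le_max_left _ _, max_le zero_le_one (min_le_right _ _)⟩
theorem pbCl_lo {y : ℝ} (h : y ≤ 0) : pbCl y = 0 :=
  max_eq_left ((min_le_left _ _).trans h)
theorem pbCl_mid {y : ℝ} (h : y ∈ Icc (0:ℝ) 1) : pbCl y = y := by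
  unfold pbCl; rw [min_eq_left h.2, max_eq_right h.1]
theorem pbCl_hi {y : ℝ} (h : 1 ≤ y) : pbCl y = 1 := by
  unfold pbCl; rw [min_eq_right h, max_eq_right zero_le_one]

/-- extension of a strip map to the plane -/
def pbExt (F : ℝ × ℝ → ℝ × ℝ) (p : ℝ × ℝ) : ℝ × ℝ :=
  ((F (p.1, pbCl p.2)).1, (F (p.1, pbCl p.2)).2 + (p.2 - pbCl p.2))

/-- a continuous self map of the strip preserving the boundary components -/
structure PBStrip (F : ℝ × ℝ → ℝ × ℝ) : Prop where
  cont : ContinuousOn F stripA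
  maps : MapsTo F stripA stripA
  b0 : ∀ x : ℝ, (F (x, 0)).2 = 0
  b1 : ∀ x : ℝ, (F (x, 1)).2 = 1

theorem pbExt_cont {F} (hF : PBStrip F) : Continuous (pbExt F) := by
  have h1 : Continuous fun p : ℝ × ℝ => F (p.1, pbCl p.2) := by
    apply hF.cont.comp_continuous
    · have := pbCl_cont; fun_prop
    · intro p; exact ⟨mem_univ _, pbCl_mem _⟩
  unfold pbExt
  exact h1.fst.prodMk (h1.snd.add (continuous_snd.sub (pbCl_cont.comp continuous_snd)))

theorem pbExt_lo {F} (hF : PBStrip F) (p : ℝ × ℝ) (h : p.2 ≤ 0) :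
    pbExt F p = ((F (p.1, 0)).1, p.2) := by
  unfold pbExt; rw [pbCl_lo h, hF.b0]; simp

theorem pbExt_hi {F} (hF : PBStrip F) (p : ℝ × ℝ) (h : 1 ≤ p.2) :
    pbExt F p = ((F (p.1, 1)).1, p.2) := by
  unfold pbExt; rw [pbCl_hi h, hF.b1]; simp

theorem pbExt_mid {F : ℝ × ℝ → ℝ × ℝ} (p : ℝ × ℝ) (h : p ∈ stripA) : pbExt F p = F p := by
  unfold pbExt; rw [pbCl_mid h.2]; simp

theorem pbExt_inv {F G} (hF : PBStrip F) (hG : PBStrip G) (h : ∀ p ∈ stripA, G (F p) = p)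
    (p : ℝ × ℝ) : pbExt G (pbExt F p) = p := by
  rcases le_total p.2 0 with h0 | h0
  · rw [pbExt_lo hF p h0, pbExt_lo hG ((F (p.1, 0)).1, p.2) h0]
    have e1 : ((F (p.1, 0)).1, (0:ℝ)) = F (p.1, 0) := Prod.ext rfl (hF.b0 _).symm
    simp only
    rw [e1, h _ ⟨mem_univ _, by simp⟩]
  rcases le_total p.2 1 with h1 | h1
  · have hp : p ∈ stripA := ⟨mem_univ _, h0, h1⟩
    rw [pbExt_mid p hp, pbExt_mid _ (hF.maps hp), h p hp]
  · rw [pbExt_hi hF p h1, pbExt_hi hG ((F (p.1, 1)).1, p.2) h1]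
    have e1 : ((F (p.1, 1)).1, (1:ℝ)) = F (p.1, 1) := Prod.ext rfl (hF.b1 _).symm
    simp only
    rw [e1, h _ ⟨mem_univ _, by simp⟩]

theorem pb_surj (φ : ℝ → ℝ) (hφ : Continuous φ) (h : ∀ x, φ (x + 1) = φ x + 1) (c : ℝ) :
    ∃ x, φ x = c := by
  have hk : ∀ k : ℤ, φ k = φ 0 + k := by
    intro k
    induction k using Int.induction_on with
    | zero => simp
    | succ n ih => push_cast at ih ⊢; rw [h, ih]; ring
    | pred n ih =>
      have := h (-n - 1)
      push_cast at ih ⊢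
      rw [sub_add_cancel] at this
      linarith
  have h1 := Int.floor_le (c - φ 0)
  have h2 := Int.lt_floor_add_one (c - φ 0)
  have h3 := hk (⌊c - φ 0⌋)
  have h4 := hk (⌊c - φ 0⌋ + 1)
  push_cast at h4
  exact intermediate_value_univ (⌊c - φ 0⌋ : ℝ) ((⌊c - φ 0⌋ : ℝ) + 1) hφ
    ⟨by rw [h3]; linarith, by rw [h4]; linarith⟩

/-- A map with a continuous branch of the logarithm cannot be a twist. -/
theorem pb_contra {H : (ℝ × ℝ) ≃ₜ (ℝ × ℝ)} {x0} {μ : Measure Cyl} [IsFiniteMeasure μ]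
    (hH : PBMap H x0 μ) (hHs : PBMap H.symm x0 μ)
    (hfix1 : ∀ p q, H p = p → H q = q → covProj p = covProj q)
    (ht0 : ∀ p : ℝ × ℝ, p.2 ≤ 0 → (H p).1 < p.1) (ht1 : ∀ p : ℝ × ℝ, 1 ≤ p.2 → p.1 < (H p).1)
    (d : Cyl → ℝ) (hd_meas : Measurable d)
    (hd_pos : ∀ᵐ a ∂(volume.restrict annA), 0 < d a)
    (hdens : ∀ U : Set Cyl, U ⊆ annA → MeasurableSet U →
      μ U = ∫⁻ a in U, ENNReal.ofReal (d a) ∂volume) : False := by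
  obtain ⟨l, hl, hle⟩ := pb_log_exists hH hfix1
  obtain ⟨z, q, hz, hq, hzq⟩ := pb_main hH d hd_meas hd_pos hdens l hl hle
  have hne : ∀ p, H.symm p ≠ p → H (H.symm p) ≠ H.symm p := by
    intro p hp
    rw [H.apply_symm_apply]; exact hp.symm
  obtain ⟨z', q', hz', hq', hzq'⟩ := pb_main hHs d hd_meas hd_pos hdens
    (fun p => l (H.symm p) + Real.pi * Complex.I)
    ((hl.comp H.symm.continuous.continuousOn (fun p hp => hne p hp)).add continuousOn_const)
    (by
      intro p hp
      rw [Complex.exp_add, Complex.exp_pi_mul_I, hle _ (hne p hp), H.apply_symm_apply,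
        pbC_sub, pbC_sub]
      ring)
  have hvc : Continuous fun p => pbC (H p - p) := pbC_cont.comp (H.continuous.sub continuous_id)
  have hv0 : ∀ p, H p ≠ p → pbC (H p - p) ≠ 0 := by
    intro p hp
    rw [ne_eq, pbC_eq_zero, sub_eq_zero]; exact hp
  have hw : (H.symm z').2 ≤ 0 := by rw [hHs.snd_lo _ hz']; exact hz'
  have hr : 1 ≤ (H.symm q').2 := by rw [hHs.snd_hi _ hq']; exact hq'
  have b1 := pb_branch (v := fun p => pbC (H p - p)) pb_lo_preconn hvc
    (hl.mono fun p hp => hH.ne_lo p hp) (fun p hp => hv0 p (hH.ne_lo p hp))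
    (fun p hp => by simp [pbC, hH.snd_lo p hp]) (fun p hp => hle p (hH.ne_lo p hp))
    (p := z) (q := H.symm z') hz hw
  have b2 := pb_branch (v := fun p => pbC (H p - p)) pb_hi_preconn hvc
    (hl.mono fun p hp => hH.ne_hi p hp) (fun p hp => hv0 p (hH.ne_hi p hp))
    (fun p hp => by simp [pbC, hH.snd_hi p hp]) (fun p hp => hle p (hH.ne_hi p hp))
    (p := q) (q := H.symm q') hq hr
  have i1 : ∀ p : ℝ × ℝ, p.2 ≤ 0 → (pbA (pbC (H p - p))).im = Real.pi := by
    intro p hp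
    apply pbA_neg
    · simp [pbC, ht0 p hp]
    · simp [pbC, hH.snd_lo p hp]
  have i2 : ∀ p : ℝ × ℝ, 1 ≤ p.2 → (pbA (pbC (H p - p))).im = 0 := by
    intro p hp
    apply pbA_pos
    · simp [pbC, ht1 p hp]
    · simp [pbC, hH.snd_hi p hp]
  have i3 : (pbA (pbC (H.symm z' - z'))).im = 0 := by
    apply pbA_pos
    · have := ht0 (H.symm z') hw
      rw [H.apply_symm_apply] at this
      simp [pbC, this]
    · simp [pbC, hHs.snd_lo z' hz']
  have i4 : (pbA (pbC (H.symm q' - q'))).im = Real.pi := by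
    apply pbA_neg
    · have := ht1 (H.symm q') hr
      rw [H.apply_symm_apply] at this
      simp [pbC, this]
    · simp [pbC, hHs.snd_hi q' hq']
  have c1 := congrArg Complex.im hzq
  have c2 := congrArg Complex.im hzq'
  have c3 := congrArg Complex.im b1
  have c4 := congrArg Complex.im b2
  simp only [Complex.sub_im, Complex.add_im] at c1 c2 c3 c4
  rw [i1 z hz, i2 q hq] at c1
  rw [i3, i4] at c2
  rw [i1 z hz, i1 _ hw] at c3
  rw [i2 q hq, i2 _ hr] at c4
  linarith [Real.pi_pos]

/-- **Poincaré–Birkhoff (Theorem 1).** If `f : A → A` is a C¹ diffeomorphism of the standard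
annulus mapping each boundary component to itself, is a twist map, and admits a positive
integral invariant, then `f` has at least two fixed points. -/
theorem two_fixed_points_of_twist_map_with_positive_integral_invariant
    (f : Cyl → Cyl) (F G : ℝ × ℝ → ℝ × ℝ)
    -- `F` is a lift of `f`: `π ∘ f̃ = f ∘ π`
    (hlift : ∀ p ∈ stripA, covProj (F p) = f (covProj p))
    -- equivariance of the lift: `f̃(x+1, y) = f̃(x, y) + (1, 0)`
    (hper : ∀ p ∈ stripA, F (p.1 + 1, p.2) = ((F p).1 + 1, (F p).2))
    -- `f` is a C¹ diffeomorphism (through its lift): C¹, bijective on the strip,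
    -- with a C¹ inverse lift `G`
    (hFC1 : ContDiffOn ℝ 1 F stripA)
    (hFbij : Set.BijOn F stripA stripA)
    (hGC1 : ContDiffOn ℝ 1 G stripA)
    (hGmaps : Set.MapsTo G stripA stripA)
    (hGF : ∀ p ∈ stripA, G (F p) = p)
    (hFG : ∀ p ∈ stripA, F (G p) = p)
    -- each boundary component is mapped to itself
    (hbdry0 : ∀ x : ℝ, (F (x, 0)).2 = 0)
    (hbdry1 : ∀ x : ℝ, (F (x, 1)).2 = 1)
    -- twist condition for the normalized lift
    (htwist0 : ∀ x : ℝ, (F (x, 0)).1 < x)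
    (htwist1 : ∀ x : ℝ, x < (F (x, 1)).1)
    -- `f` admits a positive integral invariant: a finite measure `μ` with density `d`
    -- positive almost everywhere w.r.t. Lebesgue measure, invariant under `f`
    (μ : Measure Cyl) [IsFiniteMeasure μ]
    (d : Cyl → ℝ) (hd_meas : Measurable d)
    (hd_pos : ∀ᵐ a ∂(volume.restrict annA), 0 < d a)
    (hdens : ∀ U : Set Cyl, U ⊆ annA → MeasurableSet U →
      μ U = ∫⁻ a in U, ENNReal.ofReal (d a) ∂volume)
    (hinv : ∀ U : Set Cyl, U ⊆ annA → MeasurableSet U → μ (f '' U) = μ U)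
    :
    ∃ a b : Cyl, a ∈ annA ∧ b ∈ annA ∧ f a = a ∧ f b = b ∧ a ≠ b := by
  by_contra hgoal
  have hFs : PBStrip F := ⟨hFC1.continuousOn, hFbij.mapsTo, hbdry0, hbdry1⟩
  have hm0 : ∀ x : ℝ, ((x, 0) : ℝ × ℝ) ∈ stripA := fun x => ⟨mem_univ _, by simp⟩
  have hm1 : ∀ x : ℝ, ((x, 1) : ℝ × ℝ) ∈ stripA := fun x => ⟨mem_univ _, by simp⟩
  have hG0 : ∀ x : ℝ, (G (x, 0)).2 = 0 := by
    intro c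
    obtain ⟨x, hx⟩ := pb_surj (fun x => (F (x, 0)).1)
      (continuous_fst.comp (hFs.cont.comp_continuous (by fun_prop) hm0))
      (fun x => by have := hper (x, 0) (hm0 x); simp only at this; rw [this]) c
    have e1 : F (x, 0) = (c, 0) := Prod.ext hx (hbdry0 x)
    rw [← e1, hGF _ (hm0 x)]
  have hG1 : ∀ x : ℝ, (G (x, 1)).2 = 1 := by
    intro c
    obtain ⟨x, hx⟩ := pb_surj (fun x => (F (x, 1)).1)
      (continuous_fst.comp (hFs.cont.comp_continuous (by fun_prop) hm1))
      (fun x => by have := hper (x, 1) (hm1 x); simp only at this; rw [this]) c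
    have e1 : F (x, 1) = (c, 1) := Prod.ext hx (hbdry1 x)
    rw [← e1, hGF _ (hm1 x)]
  have hGs : PBStrip G := ⟨hGC1.continuousOn, hGmaps, hG0, hG1⟩
  obtain ⟨H, hHF, hHG⟩ : ∃ H : (ℝ × ℝ) ≃ₜ (ℝ × ℝ), (∀ p, H p = pbExt F p) ∧
      (∀ p, H.symm p = pbExt G p) :=
    ⟨{ toFun := pbExt F
       invFun := pbExt G
       left_inv := pbExt_inv hFs hGs hGF
       right_inv := pbExt_inv hGs hFs hFG
       continuous_toFun := pbExt_cont hFs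
       continuous_invFun := pbExt_cont hGs }, fun _ => rfl, fun _ => rfl⟩
  have hHper : ∀ p : ℝ × ℝ, H (p.1 + 1, p.2) = ((H p).1 + 1, (H p).2) := by
    intro p
    have := hper (p.1, pbCl p.2) ⟨mem_univ _, pbCl_mem _⟩
    simp only at this
    rw [hHF, hHF]; unfold pbExt
    simp only [this]
  have hHlo : ∀ p : ℝ × ℝ, p.2 ≤ 0 → H p = ((F (p.1, 0)).1, p.2) := fun p hp => by
    rw [hHF, pbExt_lo hFs p hp]
  have hHhi : ∀ p : ℝ × ℝ, 1 ≤ p.2 → H p = ((F (p.1, 1)).1, p.2) := fun p hp => by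
    rw [hHF, pbExt_hi hFs p hp]
  have hHmid : ∀ p ∈ stripA, H p = F p := fun p hp => by rw [hHF, pbExt_mid p hp]
  have hSlo : ∀ p : ℝ × ℝ, p.2 ≤ 0 → H.symm p = ((G (p.1, 0)).1, p.2) := fun p hp => by
    rw [hHG, pbExt_lo hGs p hp]
  have hShi : ∀ p : ℝ × ℝ, 1 ≤ p.2 → H.symm p = ((G (p.1, 1)).1, p.2) := fun p hp => by
    rw [hHG, pbExt_hi hGs p hp]
  have hSmid : ∀ p ∈ stripA, H.symm p = G p := fun p hp => by rw [hHG, pbExt_mid p hp]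
  have ht0 : ∀ p : ℝ × ℝ, p.2 ≤ 0 → (H p).1 < p.1 := fun p hp => by
    rw [hHlo p hp]; exact htwist0 _
  have ht1 : ∀ p : ℝ × ℝ, 1 ≤ p.2 → p.1 < (H p).1 := fun p hp => by
    rw [hHhi p hp]; exact htwist1 _
  have hfixs : ∀ p, H p = p → p ∈ stripA := by
    intro p hp
    refine ⟨mem_univ _, ?_, ?_⟩
    · by_contra hc
      have := ht0 p (not_le.1 hc).le
      rw [hp] at this; exact lt_irrefl _ this
    · by_contra hc
      have := ht1 p (not_le.1 hc).le
      rw [hp] at this; exact lt_irrefl _ this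
  have hfixf : ∀ p, H p = p → f (covProj p) = covProj p := by
    intro p hp
    have h1 := hfixs p hp
    rw [← hlift p h1, ← hHmid p h1, hp]
  have hann : ∀ p ∈ stripA, covProj p ∈ annA := fun p hp => ⟨mem_univ _, hp.2⟩
  have hfix1 : ∀ p q, H p = p → H q = q → covProj p = covProj q := by
    intro p q hp hq
    by_contra hc
    exact hgoal ⟨_, _, hann p (hfixs p hp), hann q (hfixs q hq), hfixf p hp, hfixf q hq, hc⟩
  obtain ⟨x0, hx0⟩ : ∃ x0 : AddCircle (1:ℝ), ∀ p, H p = p → (p.1 : AddCircle (1:ℝ)) = x0 := by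
    by_cases h : ∃ p, H p = p
    · obtain ⟨q, hq⟩ := h
      exact ⟨(q.1 : AddCircle (1:ℝ)), fun p hp => congrArg Prod.fst (hfix1 p q hp hq)⟩
    · push Not at h
      exact ⟨0, fun p hp => absurd hp (h p)⟩
  have hA : MeasurableSet annA := MeasurableSet.univ.prod measurableSet_Icc
  have hlifts : ∀ a ∈ annA, ∃ p ∈ stripA, covProj p = a := by
    rintro ⟨a, y⟩ ha
    obtain ⟨r, rfl⟩ := QuotientAddGroup.mk_surjective a
    exact ⟨(r, y), ⟨mem_univ _, ha.2⟩, rfl⟩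
  have hHinv : ∀ V V' : Set Cyl, MeasurableSet V → MeasurableSet V' →
      (∀ p, covProj p ∈ V ↔ covProj (H p) ∈ V') → μ (V ∩ annA) = μ (V' ∩ annA) := by
    intro V V' hV hV' h
    rw [← hinv (V ∩ annA) inter_subset_right (hV.inter hA)]
    congr 1
    ext c
    constructor
    · rintro ⟨a, ⟨haV, haA⟩, rfl⟩
      obtain ⟨p, hp, rfl⟩ := hlifts a haA
      have h1 := (h p).1 haV
      rw [hHmid p hp] at h1
      rw [← hlift p hp]
      exact ⟨h1, hann _ (hFbij.mapsTo hp)⟩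
    · rintro ⟨hcV, hcA⟩
      obtain ⟨r, hr, rfl⟩ := hlifts c hcA
      have hp := hGmaps hr
      have h1 := hFG r hr
      refine ⟨covProj (G r), ⟨(h _).2 ?_, hann _ hp⟩, ?_⟩
      · rw [hHmid _ hp, h1]; exact hcV
      · rw [← hlift _ hp, h1]
  have hH : PBMap H x0 μ :=
    { per := hHper
      lo := fun x y hy => by rw [hHlo _ hy, hHlo (x, 0) le_rfl]
      hi := fun x y hy => by rw [hHhi _ hy, hHhi (x, 1) le_rfl]
      strip := fun p hp => by
        rw [hHmid p ⟨mem_univ _, hp⟩]; exact (hFbij.mapsTo ⟨mem_univ _, hp⟩).2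
      lo_ne := fun x => (ht0 (x, 0) le_rfl).ne
      hi_ne := fun x => (ht1 (x, 1) le_rfl).ne'
      fix := hx0
      inv := hHinv }
  have hHs : PBMap H.symm x0 μ :=
    { per := fun p => by
        rw [H.symm_apply_eq, hHper, H.apply_symm_apply]
      lo := fun x y hy => by rw [hSlo _ hy, hSlo (x, 0) le_rfl]
      hi := fun x y hy => by rw [hShi _ hy, hShi (x, 1) le_rfl]
      strip := fun p hp => by
        rw [hSmid p ⟨mem_univ _, hp⟩]; exact (hGmaps ⟨mem_univ _, hp⟩).2
      lo_ne := fun x hc => by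
        have h1 : H.symm (x, 0) = (x, 0) :=
          Prod.ext hc (by rw [hSlo (x, 0) le_rfl])
        rw [H.symm_apply_eq] at h1
        have h2 := ht0 (x, 0) le_rfl
        rw [← h1] at h2; exact lt_irrefl _ h2
      hi_ne := fun x hc => by
        have h1 : H.symm (x, 1) = (x, 1) :=
          Prod.ext hc (by rw [hShi (x, 1) le_rfl])
        rw [H.symm_apply_eq] at h1
        have h2 := ht1 (x, 1) le_rfl
        rw [← h1] at h2; exact lt_irrefl _ h2
      fix := fun p hp => hx0 p (by rw [H.symm_apply_eq] at hp; exact hp.symm)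
      inv := fun V V' hV hV' h => (hHinv V' V hV' hV (fun p => by
        rw [h (H p), H.symm_apply_apply])).symm }
  exact pb_contra hH hHs hfix1 ht0 ht1 d hd_meas hd_pos hdens
end
end

section
/- (Poincaré's Last Geometric Theorem) If f : A → A is a C¹ diffeomorphism of the standard annulus which maps each boundary component to itself, is a twist map, and preserves Lebesgue measure (area) on A, then f has at least two fixed points. -/
open Set MeasureTheory

noncomputable section

namespace PB

/-- Continuity glued along integer slabs of a continuous function `r`. -/
lemma glue {X Y : Type*} [TopologicalSpace X] [TopologicalSpace Y] {D : Set X} {r : X → ℝ}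
    (hr : Continuous r) {g : X → Y}
    (h : ∀ k : ℤ, ContinuousOn g {x | x ∈ D ∧ (k : ℝ) ≤ r x ∧ r x ≤ k + 1}) :
    ContinuousOn g D := by
  intro p hp
  set n := ⌊r p⌋ with hn
  have h1 : (n : ℝ) ≤ r p := Int.floor_le _
  have h2 : r p < n + 1 := Int.lt_floor_add_one _
  have hA := h n p ⟨hp, h1, h2.le⟩
  rcases h1.lt_or_eq with h1 | h1
  · refine hA.mono_of_mem_nhdsWithin ?_
    have e1 : ∀ᶠ x in nhds p, (n : ℝ) < r x := hr.continuousAt.eventually (lt_mem_nhds h1)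
    have e2 : ∀ᶠ x in nhds p, r x < n + 1 := hr.continuousAt.eventually (gt_mem_nhds h2)
    filter_upwards [self_mem_nhdsWithin, nhdsWithin_le_nhds e1, nhdsWithin_le_nhds e2]
      with x a b c using ⟨a, b.le, c.le⟩
  · have hB := h (n - 1) p ⟨hp, by push_cast; linarith, by push_cast; linarith⟩
    refine (hA.union hB).mono_of_mem_nhdsWithin ?_
    have e1 : ∀ᶠ x in nhds p, (n : ℝ) - 1 < r x :=
      hr.continuousAt.eventually (lt_mem_nhds (by linarith))
    have e2 : ∀ᶠ x in nhds p, r x < n + 1 := hr.continuousAt.eventually (gt_mem_nhds h2)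
    filter_upwards [self_mem_nhdsWithin, nhdsWithin_le_nhds e1, nhdsWithin_le_nhds e2]
      with x a b c
    rcases le_total (n : ℝ) (r x) with d | d
    · exact Or.inl ⟨a, d, c.le⟩
    · exact Or.inr ⟨a, by push_cast; linarith, by push_cast; linarith⟩

/-- Continuous logarithms exist on star-convex sets. -/
lemma exists_log {E : Type*} [AddCommGroup E] [Module ℝ E] [TopologicalSpace E]
    [ContinuousAdd E] [ContinuousSMul ℝ E]
    {K : Set E} {x₀ : E} (hx₀ : x₀ ∈ K) (hK : StarConvex ℝ x₀ K) {v : E → ℂ}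
    (hv : ContinuousOn v K) (hne : ∀ x ∈ K, v x ≠ 0) :
    ∃ L : E → ℂ, ContinuousOn L K ∧ ∀ x ∈ K, Complex.exp (L x) = v x := by
  classical
  have hmem : ∀ q : unitInterval × K, ((1 - (q.1 : ℝ)) • x₀ + (q.1 : ℝ) • (q.2 : E)) ∈ K := by
    rintro ⟨t, x⟩
    exact hK x.2 (by linarith [t.2.2]) t.2.1 (by ring)
  have hc : Continuous fun q : unitInterval × K =>
      v ((1 - (q.1 : ℝ)) • x₀ + (q.1 : ℝ) • (q.2 : E)) := by
    refine hv.comp_continuous ?_ hmem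
    fun_prop
  let H : C(unitInterval × K, {z : ℂ // z ≠ 0}) :=
    ⟨fun q => ⟨v ((1 - (q.1 : ℝ)) • x₀ + (q.1 : ℝ) • (q.2 : E)), hne _ (hmem q)⟩,
      hc.subtype_mk _⟩
  let f : C(K, ℂ) := ContinuousMap.const _ (Complex.log (v x₀))
  have H0 : ∀ a, H (0, a) = ⟨_, (f a).exp_ne_zero⟩ := by
    intro a
    apply Subtype.ext
    simp [H, f, Complex.exp_log (hne _ hx₀)]
  let Lh := Complex.isCoveringMap_exp.liftHomotopy H f H0
  have hl := Complex.isCoveringMap_exp.liftHomotopy_lifts H f H0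
  refine ⟨fun x => if h : x ∈ K then Lh (1, ⟨x, h⟩) else 0, ?_, ?_⟩
  · rw [continuousOn_iff_continuous_domRestrict]
    have : K.domRestrict (fun x => if h : x ∈ K then Lh (1, ⟨x, h⟩) else 0)
        = fun x : K => Lh (1, x) := by
      funext x
      simp [Set.domRestrict]
    rw [this]
    fun_prop
  · intro x hx
    have := congrArg Subtype.val (congrFun hl (1, ⟨x, hx⟩))
    simp only [hx, dif_pos]
    simpa [H, Lh] using this

/-- A continuous logarithm of `1` on a preconnected set is constant. -/
lemma log_const {X : Type*} [TopologicalSpace X] {K : Set X} (hK : IsPreconnected K)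
    {h : X → ℂ} (hc : ContinuousOn h K) (he : ∀ x ∈ K, Complex.exp (h x) = 1)
    {x y : X} (hx : x ∈ K) (hy : y ∈ K) : h x = h y := by
  have key : ∀ x ∈ K, ∃ n : ℤ, h x = n * (2 * Real.pi * Complex.I) :=
    fun x hx => Complex.exp_eq_one_iff.1 (he x hx)
  have hpi := Real.pi_pos
  let k : X → ℝ := fun x => (h x).im / (2 * Real.pi)
  have hk : ContinuousOn k K := (Complex.continuous_im.comp_continuousOn hc).div_const _
  have hkn : ∀ x ∈ K, ∃ n : ℤ, k x = n := by
    intro x hx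
    obtain ⟨n, hn⟩ := key x hx
    refine ⟨n, ?_⟩
    simp only [k, hn]
    simp
  have hh : ∀ x ∈ K, h x = (k x : ℂ) * (2 * Real.pi * Complex.I) := by
    intro x hx
    obtain ⟨n, hn⟩ := key x hx
    have : k x = n := by
      simp only [k, hn]
      simp
    rw [hn, this]; simp
  have hkr : ContinuousOn (fun x => round (k x)) K := by
    intro x hx
    obtain ⟨n, hn⟩ := hkn x hx
    have e : ∀ᶠ y in nhdsWithin x K, |k y - n| < 1 / 2 := by
      have := (hk x hx).eventually (Metric.ball_mem_nhds (k x) (by norm_num : (0:ℝ) < 1/2))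
      filter_upwards [this] with y hy
      rw [← hn]; exact hy
    refine ContinuousWithinAt.congr_of_eventuallyEq (f := fun _ => round (k x))
      continuousWithinAt_const ?_ rfl
    filter_upwards [e, self_mem_nhdsWithin] with y hy hyK
    obtain ⟨m, hm⟩ := hkn y hyK
    rw [hm, hn]
    rw [hm] at hy
    have : |((m - n : ℤ) : ℝ)| < 1 := by push_cast; linarith
    have h2 : |m - n| < 1 := by exact_mod_cast this
    have h3 := Int.abs_lt_one_iff.1 h2
    have : m = n := by omega
    rw [this]
  have := hK.constant hkr hx hy
  obtain ⟨n, hn⟩ := hkn x hx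
  obtain ⟨m, hm⟩ := hkn y hy
  simp only [hn, hm, round_intCast] at this
  rw [hh x hx, hh y hy, hn, hm, this]

/-- Two continuous logarithms of the same function differ by a constant. -/
lemma log_sub_const {X : Type*} [TopologicalSpace X] {K : Set X} (hK : IsPreconnected K)
    {l m : X → ℂ} (hl : ContinuousOn l K) (hm : ContinuousOn m K)
    (he : ∀ x ∈ K, Complex.exp (l x) = Complex.exp (m x))
    {x y : X} (hx : x ∈ K) (hy : y ∈ K) : l x - l y = m x - m y := by
  have := log_const hK (hl.sub hm) (fun x hx => by
    rw [Pi.sub_apply, Complex.exp_sub, he x hx, div_self (Complex.exp_ne_zero _)]) hx hy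
  simp only [Pi.sub_apply] at this
  linear_combination this

/-- Truncation of a real to `[0,1]`. -/
def cl (y : ℝ) : ℝ := max 0 (min 1 y)

lemma cl_cont : Continuous cl := by unfold cl; fun_prop
lemma cl_mem (y : ℝ) : cl y ∈ Set.Icc (0 : ℝ) 1 := by
  unfold cl; constructor <;> simp
lemma cl_of_mem {y : ℝ} (h0 : 0 ≤ y) (h1 : y ≤ 1) : cl y = y := by
  unfold cl; simp [h0, h1]
lemma cl_of_le {y : ℝ} (h0 : y ≤ 0) : cl y = 0 := by
  unfold cl; rw [max_eq_left]; exact (min_le_right _ _).trans h0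
lemma cl_of_ge {y : ℝ} (h0 : 1 ≤ y) : cl y = 1 := by
  unfold cl; simp [h0]

lemma mem_strip {p : ℝ × ℝ} : p ∈ stripA ↔ 0 ≤ p.2 ∧ p.2 ≤ 1 := by
  simp [stripA, Set.mem_prod]

/-- The (topological) hypotheses on the lift `F` with inverse `G`. -/
structure Tw (F G : ℝ × ℝ → ℝ × ℝ) : Prop where
  cF : ContinuousOn F stripA
  cG : ContinuousOn G stripA
  mF : Set.MapsTo F stripA stripA
  mG : Set.MapsTo G stripA stripA
  GF : ∀ p ∈ stripA, G (F p) = p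
  FG : ∀ p ∈ stripA, F (G p) = p
  per : ∀ p ∈ stripA, F (p.1 + 1, p.2) = ((F p).1 + 1, (F p).2)
  b0 : ∀ x : ℝ, (F (x, 0)).2 = 0
  b1 : ∀ x : ℝ, (F (x, 1)).2 = 1
  t0 : ∀ x : ℝ, (F (x, 0)).1 < x
  t1 : ∀ x : ℝ, x < (F (x, 1)).1

/-- Extension of a map of the strip to the whole plane. -/
def hat (F : ℝ × ℝ → ℝ × ℝ) (p : ℝ × ℝ) : ℝ × ℝ :=
  ((F (p.1, cl p.2)).1, (F (p.1, cl p.2)).2 + (p.2 - cl p.2))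

lemma strip_cl (x y : ℝ) : (x, cl y) ∈ stripA := mem_strip.2 (cl_mem y)

lemma hat_cont {F : ℝ × ℝ → ℝ × ℝ} (hF : ContinuousOn F stripA) : Continuous (hat F) := by
  have h : Continuous fun p : ℝ × ℝ => F (p.1, cl p.2) :=
    hF.comp_continuous (by have := cl_cont; fun_prop) (fun p => strip_cl _ _)
  exact h.fst.prodMk (h.snd.add (continuous_snd.sub (cl_cont.comp continuous_snd)))

lemma hat_mem {F : ℝ × ℝ → ℝ × ℝ} {p : ℝ × ℝ} (h : p ∈ stripA) : hat F p = F p := by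
  have := mem_strip.1 h
  unfold hat
  rw [cl_of_mem this.1 this.2]
  simp

lemma hat_inv {F G : ℝ × ℝ → ℝ × ℝ} (mF : Set.MapsTo F stripA stripA)
    (GF : ∀ p ∈ stripA, G (F p) = p) (b0 : ∀ x : ℝ, (F (x, 0)).2 = 0)
    (b1 : ∀ x : ℝ, (F (x, 1)).2 = 1) (p : ℝ × ℝ) : hat G (hat F p) = p := by
  obtain ⟨x, y⟩ := p
  by_cases hy0 : y < 0
  · have e : hat F (x, y) = ((F (x, 0)).1, y) := by simp [hat, cl_of_le hy0.le, b0]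
    have e2 : F (x, 0) = ((F (x, 0)).1, 0) := Prod.ext rfl (b0 x)
    have e3 : G ((F (x, 0)).1, 0) = (x, 0) := by
      rw [← e2, GF]; exact mem_strip.2 (by norm_num)
    rw [e]
    simp [hat, cl_of_le hy0.le, e3]
  by_cases hy1 : 1 < y
  · have e : hat F (x, y) = ((F (x, 1)).1, y) := by simp [hat, cl_of_ge hy1.le, b1]
    have e2 : F (x, 1) = ((F (x, 1)).1, 1) := Prod.ext rfl (b1 x)
    have e3 : G ((F (x, 1)).1, 1) = (x, 1) := by
      rw [← e2, GF]; exact mem_strip.2 (by norm_num)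
    rw [e]
    simp [hat, cl_of_ge hy1.le, e3]
  have hm : (x, y) ∈ stripA := mem_strip.2 ⟨not_lt.1 hy0, not_lt.1 hy1⟩
  rw [hat_mem hm, hat_mem (mF hm), GF _ hm]

lemma surj_of_per {g : ℝ → ℝ} (hc : Continuous g) (hp : ∀ x, g (x + 1) = g x + 1) (y : ℝ) :
    ∃ x, g x = y := by
  have hn : ∀ n : ℕ, g n = g 0 + n := by
    intro n
    induction n with
    | zero => simp
    | succ k ih => push_cast; rw [hp, ih]; ring
  have hn' : ∀ n : ℕ, g (-n) = g 0 - n := by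
    intro n
    induction n with
    | zero => simp
    | succ k ih =>
      have := hp (-((k + 1 : ℕ) : ℝ))
      rw [show -((k + 1 : ℕ) : ℝ) + 1 = -k by push_cast; ring, ih] at this
      push_cast at this ⊢
      linarith
  obtain ⟨n, h1⟩ := exists_nat_ge (|y - g 0|)
  have h2 := abs_le.1 h1
  refine mem_range_of_exists_le_of_exists_ge hc ⟨-n, ?_⟩ ⟨n, ?_⟩
  · rw [hn']; linarith
  · rw [hn]; linarith

variable {F G : ℝ × ℝ → ℝ × ℝ}

lemma Tw.cont_line (h : Tw F G) {y : ℝ} (h0 : 0 ≤ y) (h1 : y ≤ 1) :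
    Continuous fun x : ℝ => F (x, y) :=
  h.cF.comp_continuous (by fun_prop) (fun _ => mem_strip.2 ⟨h0, h1⟩)

lemma Tw.gb0 (h : Tw F G) (x : ℝ) : (G (x, 0)).2 = 0 := by
  obtain ⟨u, hu⟩ := surj_of_per (g := fun x => (F (x, 0)).1)
    ((h.cont_line le_rfl zero_le_one).fst)
    (fun x => by have := h.per (x, 0) (mem_strip.2 (by norm_num)); simp [this]) x
  have e : F (u, 0) = (x, 0) := Prod.ext hu (h.b0 u)
  rw [← e, h.GF _ (mem_strip.2 (by norm_num))]

lemma Tw.gb1 (h : Tw F G) (x : ℝ) : (G (x, 1)).2 = 1 := by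
  obtain ⟨u, hu⟩ := surj_of_per (g := fun x => (F (x, 1)).1)
    ((h.cont_line zero_le_one le_rfl).fst)
    (fun x => by have := h.per (x, 1) (mem_strip.2 (by norm_num)); simp [this]) x
  have e : F (u, 1) = (x, 1) := Prod.ext hu (h.b1 u)
  rw [← e, h.GF _ (mem_strip.2 (by norm_num))]

/-- The extension as a homeomorphism of the plane. -/
def hatH (h : Tw F G) : (ℝ × ℝ) ≃ₜ (ℝ × ℝ) where
  toFun := hat F
  invFun := hat G
  left_inv := hat_inv h.mF h.GF h.b0 h.b1
  right_inv := hat_inv h.mG h.FG h.gb0 h.gb1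
  continuous_toFun := hat_cont h.cF
  continuous_invFun := hat_cont h.cG

/-- Vertical shear, together with a stretch above height one. -/
def st (W : C(AddCircle (1 : ℝ), ℝ)) : (ℝ × ℝ) ≃ₜ (ℝ × ℝ) where
  toFun p := (p.1, p.2 + W p.1 + max 0 (p.2 - 1))
  invFun p := (p.1, min (p.2 - W p.1) ((p.2 - W p.1 + 1) / 2))
  left_inv p := by
    obtain ⟨x, y⟩ := p
    refine Prod.ext rfl ?_
    simp only
    rcases le_total y 1 with hy | hy
    · rw [max_eq_left (by linarith), min_eq_left (by linarith)]; ring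
    · rw [max_eq_right (by linarith), min_eq_right (by linarith)]; ring
  right_inv p := by
    obtain ⟨x, y⟩ := p
    refine Prod.ext rfl ?_
    simp only
    rcases le_total (y - W x) 1 with hy | hy
    · rw [min_eq_left (by linarith), max_eq_left (by linarith)]; ring
    · rw [min_eq_right (by linarith), max_eq_right (by linarith)]; ring
  continuous_toFun := by
    have : Continuous fun p : ℝ × ℝ => W ((p.1 : ℝ) : AddCircle (1 : ℝ)) :=
      W.continuous.comp ((AddCircle.continuous_mk' 1).comp continuous_fst)
    fun_prop
  continuous_invFun := by
    have : Continuous fun p : ℝ × ℝ => W ((p.1 : ℝ) : AddCircle (1 : ℝ)) :=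
      W.continuous.comp ((AddCircle.continuous_mk' 1).comp continuous_fst)
    fun_prop

/-- The perturbed map. -/
def Phi (h : Tw F G) (W : C(AddCircle (1 : ℝ), ℝ)) : (ℝ × ℝ) ≃ₜ (ℝ × ℝ) :=
  (hatH h).trans (st W)

lemma Phi_apply (h : Tw F G) (W : C(AddCircle (1 : ℝ), ℝ)) (p : ℝ × ℝ) :
    Phi h W p = ((hat F p).1,
      (hat F p).2 + W (hat F p).1 + max 0 ((hat F p).2 - 1)) := rfl

lemma hat_le0 (h : Tw F G) {p : ℝ × ℝ} (hp : p.2 ≤ 0) : hat F p = ((F (p.1, 0)).1, p.2) := by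
  simp [hat, cl_of_le hp, h.b0]

lemma hat_ge1 (h : Tw F G) {p : ℝ × ℝ} (hp : 1 ≤ p.2) : hat F p = ((F (p.1, 1)).1, p.2) := by
  simp [hat, cl_of_ge hp, h.b1]

lemma hat_pos (h : Tw F G) {p : ℝ × ℝ} (hp : 0 < p.2) : 0 < (hat F p).2 := by
  by_contra hc
  have hc := not_lt.1 hc
  have e : hat G (hat F p) = p := hat_inv h.mF h.GF h.b0 h.b1 p
  have : (hat G (hat F p)).2 = (hat F p).2 := by
    simp [hat.eq_1 G, cl_of_le hc, h.gb0]
  rw [e] at this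
  linarith

lemma hat_le1 (h : Tw F G) {p : ℝ × ℝ} (hp : p.2 ≤ 1) : (hat F p).2 ≤ 1 := by
  rcases le_total p.2 0 with h0 | h0
  · rw [hat_le0 h h0]; exact hp
  · have hm := mem_strip.2 ⟨h0, hp⟩
    rw [hat_mem hm]
    exact (mem_strip.1 (h.mF hm)).2

lemma hat_per (h : Tw F G) (p : ℝ × ℝ) : hat F (p.1 + 1, p.2) = ((hat F p).1 + 1, (hat F p).2) := by
  have := h.per (p.1, cl p.2) (strip_cl _ _)
  simp only at this
  simp [hat, this]

lemma coe_add_one (x : ℝ) : ((x + 1 : ℝ) : AddCircle (1 : ℝ)) = x := by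
  rw [AddCircle.coe_add, AddCircle.coe_period, add_zero]

lemma Phi_per (h : Tw F G) (W : C(AddCircle (1 : ℝ), ℝ)) (p : ℝ × ℝ) :
    Phi h W (p + (1, 0)) = Phi h W p + (1, 0) := by
  have e : p + (1, 0) = (p.1 + 1, p.2) := by ext <;> simp
  rw [e]
  simp only [Phi_apply, hat_per h, coe_add_one]
  simp

lemma Phi_pos (h : Tw F G) (W : C(AddCircle (1 : ℝ), ℝ)) {p : ℝ × ℝ} (hp : 0 < p.2) :
    W (Phi h W p).1 < (Phi h W p).2 := by
  have := hat_pos h hp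
  have := le_max_left 0 ((hat F p).2 - 1)
  simp only [Phi_apply]
  linarith

lemma Phi_zero (h : Tw F G) (W : C(AddCircle (1 : ℝ), ℝ)) {p : ℝ × ℝ} (hp : p.2 = 0) :
    Phi h W p = ((F (p.1, 0)).1, W (F (p.1, 0)).1) := by
  simp [Phi_apply, hat_le0 h hp.le, hp]

lemma Phi_nonneg (h : Tw F G) (W : C(AddCircle (1 : ℝ), ℝ)) {p : ℝ × ℝ} (hp : 0 ≤ p.2) :
    W (Phi h W p).1 ≤ (Phi h W p).2 := by
  rcases hp.lt_or_eq with hp | hp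
  · exact (Phi_pos h W hp).le
  · rw [Phi_zero h W hp.symm]

lemma Phi_top (h : Tw F G) (W : C(AddCircle (1 : ℝ), ℝ)) {p : ℝ × ℝ} (hp : 1 ≤ p.2) :
    Phi h W p = ((F (p.1, 1)).1, 2 * p.2 - 1 + W (F (p.1, 1)).1) := by
  simp only [Phi_apply, hat_ge1 h hp]
  rw [max_eq_right (by linarith)]
  refine Prod.ext rfl ?_
  simp only
  ring

lemma Phi_le (h : Tw F G) (W : C(AddCircle (1 : ℝ), ℝ)) {p : ℝ × ℝ} (hp : p.2 ≤ 1) :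
    Phi h W p = ((hat F p).1, (hat F p).2 + W (hat F p).1) := by
  have := hat_le1 h hp
  simp only [Phi_apply]
  rw [max_eq_left (by linarith), add_zero]

/-- The shear on the cylinder. -/
def sh (W : C(AddCircle (1 : ℝ), ℝ)) (z : Cyl) : Cyl := (z.1, z.2 + W z.1)

lemma sh_mp (W : C(AddCircle (1 : ℝ), ℝ)) : MeasurePreserving (sh W) volume volume := by
  have := (MeasurePreserving.id (volume : Measure (AddCircle (1 : ℝ)))).skew_product
    (μc := (volume : Measure ℝ)) (μd := (volume : Measure ℝ))
    (g := fun x y => y + W x) (by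
      have := W.continuous.measurable
      unfold Function.uncurry
      fun_prop) (Filter.Eventually.of_forall fun x =>
        (measurePreserving_add_right volume (W x)).map_eq)
  exact this

lemma sh_inj (W : C(AddCircle (1 : ℝ), ℝ)) : Function.Injective (sh W) := by
  rintro ⟨a, b⟩ ⟨c, d⟩ h
  simp only [sh, Prod.mk.injEq] at h
  obtain ⟨rfl, h⟩ := h
  simpa using h

lemma covProj_open : IsOpenMap covProj := by
  have h1 : IsOpenMap (fun x : ℝ => (x : AddCircle (1 : ℝ))) := QuotientAddGroup.isOpenMap_coe
  exact h1.prodMap IsOpenMap.id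

lemma covProj_eq {p q : ℝ × ℝ} (h : covProj p = covProj q) : ∃ k : ℤ, p = q + ((k : ℝ), 0) := by
  simp only [covProj, Prod.mk.injEq] at h
  obtain ⟨h1, h2⟩ := h
  have h3 : ((p.1 - q.1 : ℝ) : AddCircle (1 : ℝ)) = 0 := by
    rw [AddCircle.coe_sub, h1, sub_self]
  obtain ⟨k, hk⟩ := (AddCircle.coe_eq_zero_iff (1 : ℝ)).1 h3
  refine ⟨k, Prod.ext ?_ ?_⟩
  · simp at hk ⊢; linarith
  · simpa using h2

lemma covProj_add (p : ℝ × ℝ) (k : ℤ) : covProj (p + ((k : ℝ), 0)) = covProj p := by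
  simp [covProj]

lemma Phi_per_int (h : Tw F G) (W : C(AddCircle (1 : ℝ), ℝ)) (p : ℝ × ℝ) (k : ℤ) :
    Phi h W (p + ((k : ℝ), 0)) = Phi h W p + ((k : ℝ), 0) := by
  induction k with
  | zero => simp [← Prod.zero_eq_mk]
  | succ i hi =>
    have e : ∀ q : ℝ × ℝ, q + (((i + 1 : ℤ) : ℝ), 0) = q + ((i : ℝ), 0) + (1, 0) := by
      intro q; ext <;> simp; ring
    rw [e, e, Phi_per]
    have hi' := hi
    push_cast at hi'
    rw [hi']
  | pred i hi =>
    have e : ∀ q : ℝ × ℝ, q + ((((-i : ℤ)) : ℝ), 0) = q + (((-i - 1 : ℤ) : ℝ), 0) + (1, 0) := by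
      intro q; ext <;> simp; ring
    rw [e, e, Phi_per] at hi
    exact add_right_cancel hi

lemma Phi_iter_per (h : Tw F G) (W : C(AddCircle (1 : ℝ), ℝ)) (p : ℝ × ℝ) (k : ℤ) (n : ℕ) :
    (Phi h W)^[n] (p + ((k : ℝ), 0)) = (Phi h W)^[n] p + ((k : ℝ), 0) := by
  induction n with
  | zero => rfl
  | succ n ih => rw [Function.iterate_succ_apply', ih, Phi_per_int, Function.iterate_succ_apply']

lemma Phi_iter_pos (h : Tw F G) (W : C(AddCircle (1 : ℝ), ℝ)) (hW0 : ∀ x, 0 ≤ W x)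
    {p : ℝ × ℝ} (hp : 0 < p.2) (n : ℕ) : 0 < ((Phi h W)^[n] p).2 := by
  induction n with
  | zero => exact hp
  | succ n ih =>
    rw [Function.iterate_succ_apply']
    exact (hW0 _).trans_lt (Phi_pos h W ih)

lemma escape (h : Tw F G) (W : C(AddCircle (1 : ℝ), ℝ)) (hW0 : ∀ x, 0 ≤ W x)
    (f : Cyl → Cyl) (hlift : ∀ p ∈ stripA, covProj (F p) = f (covProj p))
    (hinv : ∀ U : Set Cyl, U ⊆ annA → MeasurableSet U → volume (f '' U) = volume U)
    (hpos : ∃ x : ℝ, 0 < W x) :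
    ∃ (q : ℝ × ℝ) (n : ℕ), 0 < q.2 ∧ q.2 < W q.1 ∧ 1 < ((Phi h W)^[n] q).2 := by
  by_contra hcon
  push Not at hcon
  let U : Set (ℝ × ℝ) := {q | 0 < q.2 ∧ q.2 < W q.1}
  let V : ℕ → Set (ℝ × ℝ) := fun n => (Phi h W)^[n] '' U
  have hV : ∀ n, V (n + 1) = Phi h W '' V n := by
    intro n
    simp only [V]
    rw [Function.iterate_succ', image_comp]
  have hUo : IsOpen U := by
    have : Continuous fun p : ℝ × ℝ => W ((p.1 : ℝ) : AddCircle (1 : ℝ)) :=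
      W.continuous.comp ((AddCircle.continuous_mk' 1).comp continuous_fst)
    exact (isOpen_lt continuous_const continuous_snd).inter (isOpen_lt continuous_snd this)
  have hVo : ∀ n, IsOpen (V n) := by
    intro n
    induction n with
    | zero => simpa [V] using hUo
    | succ n ih => rw [hV]; exact (Phi h W).isOpenMap _ ih
  have hVs : ∀ n, V n ⊆ stripA := by
    rintro n _ ⟨q, hq, rfl⟩
    exact mem_strip.2 ⟨(Phi_iter_pos h W hW0 hq.1 n).le, hcon q n hq.1 hq.2⟩
  let S : ℕ → Set Cyl := fun n => covProj '' V n
  have hSo : ∀ n, IsOpen (S n) := fun n => covProj_open _ (hVo n)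
  have hSA : ∀ n, S n ⊆ annA := by
    rintro n _ ⟨q, hq, rfl⟩
    have := mem_strip.1 (hVs n hq)
    simp [annA, covProj, this.1, this.2]
  have hconj : ∀ p ∈ stripA, covProj (Phi h W p) = sh W (f (covProj p)) := by
    intro p hp
    rw [← hlift p hp, Phi_le h W (mem_strip.1 hp).2, hat_mem hp]
    rfl
  have hvol : ∀ n, volume (S (n + 1)) = volume (S n) := by
    intro n
    rw [← hinv (S n) (hSA n) (hSo n).measurableSet]
    have : f '' S n = sh W ⁻¹' S (n + 1) := by
      ext z
      simp only [S, hV, mem_preimage, image_image]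
      constructor
      · rintro ⟨p, hp, rfl⟩
        exact ⟨p, hp, hconj p (hVs n hp)⟩
      · rintro ⟨p, hp, he⟩
        simp only [hconj p (hVs n hp)] at he
        exact ⟨p, hp, sh_inj W he⟩
    rw [this, (sh_mp W).measure_preimage (hSo _).measurableSet.nullMeasurableSet]
  have hvol0 : ∀ n, volume (S n) = volume (S 0) := by
    intro n
    induction n with
    | zero => rfl
    | succ n ih => rw [hvol, ih]
  have hS0 : volume (S 0) ≠ 0 := by
    obtain ⟨x, hx⟩ := hpos
    refine ((hSo 0).measure_pos volume ⟨covProj (x, W x / 2), ?_⟩).ne'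
    refine ⟨_, ⟨(x, W x / 2), ⟨?_, ?_⟩, rfl⟩, rfl⟩ <;> simp <;> linarith
  have hdis : Pairwise (Function.onFun Disjoint S) := by
    have key : ∀ n k, Disjoint (S n) (S (n + (k + 1))) := by
      intro n k
      rw [Set.disjoint_left]
      rintro z ⟨_, ⟨p, hp, rfl⟩, rfl⟩ ⟨_, ⟨q, hq, rfl⟩, he⟩
      obtain ⟨j, hj⟩ := covProj_eq he.symm
      rw [← Phi_iter_per, Function.iterate_add_apply] at hj
      have hj := ((Phi h W).injective.iterate n) hj
      rw [Function.iterate_succ_apply'] at hj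
      have h1 : 0 < ((Phi h W)^[k] (q + ((j : ℝ), 0))).2 := by
        apply Phi_iter_pos h W hW0
        simpa using hq.1
      have := Phi_pos h W h1
      rw [← hj] at this
      exact lt_asymm this hp.2
    intro m n hmn
    rcases lt_or_gt_of_ne hmn with hl | hl
    · obtain ⟨k, rfl⟩ := Nat.exists_eq_add_of_lt hl
      exact key m k
    · obtain ⟨k, rfl⟩ := Nat.exists_eq_add_of_lt hl
      exact (key n k).symm
  have hun := measure_iUnion (μ := volume) hdis (fun n => (hSo n).measurableSet)
  simp only [hvol0] at hun
  rw [ENNReal.tsum_const_eq_top_of_ne_zero hS0] at hun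
  have hle : volume (⋃ n, S n) ≤ volume annA := measure_mono (iUnion_subset hSA)
  rw [hun, annA, Measure.volume_eq_prod, Measure.prod_prod] at hle
  simp at hle

lemma g_mono (h : Tw F G) : StrictMono fun x : ℝ => (F (x, 0)).1 := by
  have hp : ∀ x, (F (x + 1, 0)).1 = (F (x, 0)).1 + 1 := fun x => by
    have := h.per (x, 0) (mem_strip.2 (by norm_num)); simp [this]
  rcases Continuous.strictMono_of_inj (f := fun x : ℝ => (F (x, 0)).1)
    ((h.cont_line le_rfl zero_le_one).fst) (by
      intro x y hxy
      have e : F (x, 0) = F (y, 0) := Prod.ext hxy (by rw [h.b0, h.b0])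
      have := congrArg G e
      rw [h.GF _ (mem_strip.2 (by norm_num)), h.GF _ (mem_strip.2 (by norm_num))] at this
      exact congrArg Prod.fst this) with hm | hm
  · exact hm
  · have h1 := hm (show (0 : ℝ) < 0 + 1 by norm_num)
    simp only [hp] at h1
    linarith

/-- Points of the closed upper half plane whose iterate lands on the axis stay on the axis
and move to the left. -/
lemma Phi_iter_axis (h : Tw F G) (W : C(AddCircle (1 : ℝ), ℝ)) (hW0 : ∀ x, 0 ≤ W x)
    (n : ℕ) (p : ℝ × ℝ) (hp : 0 ≤ p.2) (hn : ((Phi h W)^[n] p).2 = 0) :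
    p.2 = 0 ∧ ((Phi h W)^[n] p).1 ≤ p.1 := by
  induction n generalizing p with
  | zero => exact ⟨hn, le_rfl⟩
  | succ n ih =>
    rw [Function.iterate_succ_apply] at hn ⊢
    have h1 : 0 ≤ (Phi h W p).2 := (hW0 _).trans (Phi_nonneg h W hp)
    obtain ⟨h2, h3⟩ := ih _ h1 hn
    have hp0 : p.2 = 0 := by
      by_contra hne
      have := Phi_pos h W (lt_of_le_of_ne hp (Ne.symm hne))
      have := hW0 (Phi h W p).1
      linarith
    refine ⟨hp0, h3.trans ?_⟩
    rw [Phi_zero h W hp0]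
    exact (h.t0 _).le

/-- The basic arc: first left along the axis, then vertically up. -/
def arc (x₀ x₁ y₁ : ℝ) (t : ℝ) : ℝ × ℝ :=
  (x₀ + min 1 (2 * t) * (x₁ - x₀), max 0 (2 * t - 1) * y₁)

lemma arc_cont (x₀ x₁ y₁ : ℝ) : Continuous (arc x₀ x₁ y₁) := by
  unfold arc; fun_prop

/-- The invariant curve. -/
lemma curve (h : Tw F G) (W : C(AddCircle (1 : ℝ), ℝ)) (hW0 : ∀ x, 0 ≤ W x)
    (q : ℝ × ℝ) (n₀ : ℕ) (hq0 : 0 < q.2) (hq1 : q.2 < W q.1)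
    (hn₀ : 1 < ((Phi h W)^[n₀] q).2) :
    ∃ c : ℝ → ℝ × ℝ, ContinuousOn c (Ici 0) ∧ (∀ t, 0 ≤ t → c (t + 1) = Phi h W (c t)) ∧
      (c 0).2 = 0 ∧ (∀ t, 0 ≤ t → 0 ≤ (c t).2) ∧
      (∀ s t, 0 ≤ s → s + 1 ≤ t → c s ≠ c t) ∧ ∃ t, 0 ≤ t ∧ 1 < (c t).2 := by
  obtain ⟨x₀, hx₀⟩ := surj_of_per (g := fun x => (F (x, 0)).1)
    ((h.cont_line le_rfl zero_le_one).fst)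
    (fun x => by have := h.per (x, 0) (mem_strip.2 (by norm_num)); simp [this]) q.1
  have hWq : 0 < W q.1 := hq0.trans hq1
  let γ := arc x₀ q.1 (W q.1)
  have hγ0 : γ 0 = (x₀, 0) := by simp [γ, arc]
  have hγ1 : γ 1 = (q.1, W q.1) := by
    simp only [γ, arc]
    norm_num
  have hlink : Phi h W (γ 0) = γ 1 := by
    rw [hγ0, Phi_zero h W rfl, hγ1]
    simp [hx₀]
  have hγnn : ∀ t, 0 ≤ (γ t).2 := fun t => mul_nonneg (le_max_left _ _) hWq.le
  let c : ℝ → ℝ × ℝ := fun t => (Phi h W)^[⌊t⌋₊] (γ (t - ⌊t⌋₊))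
  have hc : ∀ (n : ℕ) (t : ℝ), (n : ℝ) ≤ t → t ≤ n + 1 → c t = (Phi h W)^[n] (γ (t - n)) := by
    intro n t h1 h2
    rcases h2.lt_or_eq with h2 | h2
    · have : ⌊t⌋₊ = n := by
        rw [Nat.floor_eq_iff (by have := n.cast_nonneg (α := ℝ); linarith)]; exact ⟨h1, h2⟩
      simp only [c, this]
    · have : ⌊t⌋₊ = n + 1 := by
        rw [h2]; exact_mod_cast Nat.floor_natCast (R := ℝ) (n + 1)
      simp only [c, this]
      rw [h2]
      push_cast
      rw [sub_self, Function.iterate_succ_apply, hlink]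
      congr 2
      ring
  have hcn : ∀ t, 0 ≤ t → 0 ≤ (c t).2 := by
    intro t _
    simp only [c]
    generalize ⌊t⌋₊ = n
    generalize t - _ = u
    induction n with
    | zero => exact hγnn _
    | succ n ih =>
      rw [Function.iterate_succ_apply']
      exact (hW0 _).trans (Phi_nonneg h W ih)
  refine ⟨c, ?_, ?_, ?_, hcn, ?_, ?_⟩
  · apply glue continuous_id
    intro k
    by_cases hk : 0 ≤ k
    · lift k to ℕ using hk
      have : ContinuousOn (fun t : ℝ => (Phi h W)^[k] (γ (t - k)))
          {x | x ∈ Ici (0 : ℝ) ∧ ((k : ℤ) : ℝ) ≤ id x ∧ id x ≤ ((k : ℤ) : ℝ) + 1} :=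
        (((Phi h W).continuous.iterate k).comp
          ((arc_cont _ _ _).comp (continuous_id.sub continuous_const))).continuousOn
      refine this.congr ?_
      rintro t ⟨-, h1, h2⟩
      simp only [Int.cast_natCast, id] at h1 h2
      exact hc k t h1 h2
    · refine (continuousOn_singleton c 0).mono ?_
      rintro t ⟨h0, -, h2⟩
      have hk' : k + 1 ≤ 0 := by omega
      have hk'' : (k : ℝ) + 1 ≤ 0 := by exact_mod_cast hk'
      exact le_antisymm (h2.trans hk'') h0
  · intro t ht
    simp only [c]
    rw [Nat.floor_add_one ht, Function.iterate_succ_apply']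
    congr 3
    push_cast
    ring
  · simp [c, hγ0]
  · intro s t hs hst he
    have hσ0 : (0 : ℝ) ≤ s - ⌊s⌋₊ := sub_nonneg.2 (Nat.floor_le hs)
    have hσ1 : s - ⌊s⌋₊ < 1 := by have := Nat.lt_floor_add_one s; linarith
    have hτ0 : (0 : ℝ) ≤ t - ⌊t⌋₊ := sub_nonneg.2 (Nat.floor_le (by linarith))
    have hle : ⌊s⌋₊ + 1 ≤ ⌊t⌋₊ := by
      rw [← Nat.floor_add_one hs]; exact Nat.floor_le_floor hst
    obtain ⟨k, hk⟩ := Nat.exists_eq_add_of_le hle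
    simp only [c] at he
    set σ := s - ⌊s⌋₊
    set τ := t - ⌊t⌋₊
    rw [hk, show ⌊s⌋₊ + 1 + k = ⌊s⌋₊ + (k + 1) by ring, Function.iterate_add_apply] at he
    have he := ((Phi h W).injective.iterate _) he
    have hz : 0 ≤ ((Phi h W)^[k] (γ τ)).2 := by
      generalize k = k
      clear he hk
      induction k with
      | zero => exact hγnn _
      | succ n ih =>
        rw [Function.iterate_succ_apply']
        exact (hW0 _).trans (Phi_nonneg h W ih)
    have h1 := Phi_nonneg h W hz
    rw [← Function.iterate_succ_apply' (Phi h W) k, ← he] at h1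
    have hq : q.1 < x₀ := by rw [← hx₀]; exact h.t0 _
    rcases le_or_gt σ (1 / 2) with hh | hh
    · have hy : (γ σ).2 = 0 := by
        simp only [γ, arc]
        rw [max_eq_left (by linarith), zero_mul]
      have hx : q.1 ≤ (γ σ).1 := by
        simp only [γ, arc]
        rw [min_eq_right (by linarith)]
        nlinarith
      have hW : W (γ σ).1 = 0 := le_antisymm (by linarith) (hW0 _)
      have ha := Phi_iter_axis h W hW0 (k + 1) (γ τ) (hγnn τ) (by rw [← he]; exact hy)
      have hxτ : (γ τ).1 ≤ x₀ := by
        simp only [γ, arc]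
        have : 0 ≤ min 1 (2 * τ) := le_min zero_le_one (by linarith)
        nlinarith
      rw [Function.iterate_succ_apply] at he
      have hb := Phi_iter_axis h W hW0 k (Phi h W (γ τ))
        ((hW0 _).trans (Phi_nonneg h W (hγnn τ))) (by rw [← he]; exact hy)
      rw [← he, Phi_zero h W ha.1] at hb
      have := (g_mono h).monotone hxτ
      simp only [hx₀] at this
      have e : (γ σ).1 = q.1 := le_antisymm (hb.2.trans this) hx
      rw [e] at hW
      linarith
    · have hx : (γ σ).1 = q.1 := by
        simp only [γ, arc]
        rw [min_eq_left (by linarith)]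
        ring
      have hy : (γ σ).2 = (2 * σ - 1) * W q.1 := by
        simp only [γ, arc]
        rw [max_eq_right (by linarith)]
      rw [hx, hy] at h1
      nlinarith
  · set u := q.2 / W q.1 with hu
    have hu0 : 0 < u := div_pos hq0 hWq
    have hu1 : u < 1 := (div_lt_one hWq).2 hq1
    have hγu : γ ((1 + u) / 2) = q := by
      simp only [γ, arc]
      rw [min_eq_left (by linarith), max_eq_right (by linarith)]
      refine Prod.ext (by simp) ?_
      simp only [hu]
      field_simp
      ring
    have hnn : (0 : ℝ) ≤ n₀ := n₀.cast_nonneg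
    refine ⟨n₀ + (1 + u) / 2, by linarith, ?_⟩
    rw [hc n₀ _ (by linarith) (by linarith), show (n₀ : ℝ) + (1 + u) / 2 - n₀ = (1 + u) / 2 by ring,
      hγu]
    exact hn₀

/-- A time at which the curve reaches its greatest height so far. -/
lemma top_time (h : Tw F G) (W : C(AddCircle (1 : ℝ), ℝ)) (hW0 : ∀ x, 0 ≤ W x)
    (hW1 : ∀ x, W x ≤ 1) (c : ℝ → ℝ × ℝ) (hc : ContinuousOn c (Ici 0))
    (hs : ∀ t, 0 ≤ t → c (t + 1) = Phi h W (c t)) (t₁ : ℝ) (ht₁ : 0 ≤ t₁) (h1 : 1 < (c t₁).2) :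
    ∃ T, 1 ≤ T ∧ (∀ t, 0 ≤ t → t ≤ T → (c t).2 ≤ (c T).2) ∧ 1 ≤ (c (T - 1)).2 := by
  have hup : ∀ t, 0 ≤ t → 1 < (c t).2 → 2 * (c t).2 - 1 ≤ (c (t + 1)).2 := by
    intro t ht hy
    rw [hs t ht, Phi_top h W hy.le]
    have := hW0 (F ((c t).1, 1)).1
    simp only
    linarith
  have hgrow : ∀ n : ℕ, 1 + (n + 1) * ((c t₁).2 - 1) ≤ (c (t₁ + n)).2 := by
    intro n
    induction n with
    | zero => simp
    | succ n ih =>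
      have hn : (0 : ℝ) ≤ n := n.cast_nonneg
      have := hup (t₁ + n) (by linarith) (by nlinarith)
      push_cast
      rw [← add_assoc]
      nlinarith
  obtain ⟨n, hn⟩ := exists_nat_gt (2 / ((c t₁).2 - 1))
  rw [div_lt_iff₀ (by linarith)] at hn
  have hN := hgrow n
  set N := t₁ + n with hNdef
  have hN0 : 0 ≤ N := by positivity
  obtain ⟨T, ⟨hT0, hT1⟩, hmax⟩ := (isCompact_Icc (a := (0 : ℝ)) (b := N + 1)).exists_isMaxOn
    ⟨0, by constructor <;> linarith⟩
    (f := fun t => (c t).2) ((continuous_snd.comp_continuousOn hc).mono fun t ht => ht.1)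
  have hTN : (c N).2 ≤ (c T).2 := hmax ⟨hN0, by linarith⟩
  have hT3 : N < T := by
    by_contra hle
    have hle := not_lt.1 hle
    have h2 := hup T hT0 (by linarith)
    have h3 : (c (T + 1)).2 ≤ (c T).2 := hmax ⟨by linarith, by linarith⟩
    linarith
  have hn1 : (1 : ℝ) ≤ n := by
    have h0 : (n : ℝ) ≠ 0 := by
      intro h0
      rw [h0] at hn
      linarith
    have : n ≠ 0 := by exact_mod_cast h0
    exact_mod_cast Nat.one_le_iff_ne_zero.2 this
  refine ⟨T, by linarith, fun t h2 h3 => hmax ⟨h2, by linarith⟩, ?_⟩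
  by_contra hlt
  have hlt := not_le.1 hlt
  have h2 := hs (T - 1) (by linarith)
  rw [sub_add_cancel, Phi_le h W hlt.le] at h2
  have h3 := hat_le1 h hlt.le
  have h4 := hW1 (hat F (c (T - 1))).1
  have h5 : (c T).2 ≤ 2 := by rw [h2]; simp only; linarith
  nlinarith

/-- Plane vectors as complex numbers. -/
def toC (p : ℝ × ℝ) : ℂ := ⟨p.1, p.2⟩

lemma toC_cont : Continuous toC := by
  have : toC = fun p => (p.1 : ℂ) + p.2 * Complex.I := by
    funext p; apply Complex.ext <;> simp [toC]
  rw [this]; fun_prop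

lemma toC_ne {p : ℝ × ℝ} (h : p ≠ 0) : toC p ≠ 0 := by
  intro he
  apply h
  have h1 := congrArg Complex.re he
  have h2 := congrArg Complex.im he
  exact Prod.ext h1 h2

lemma up_slit {z : ℂ} (hz : z ≠ 0) (h : 0 ≤ z.im) : -Complex.I * z ∈ Complex.slitPlane := by
  rw [Complex.mem_slitPlane_iff]
  simp only [Complex.mul_re, Complex.mul_im, Complex.neg_re, Complex.neg_im, Complex.I_re,
    Complex.I_im]
  rcases h.lt_or_eq with h | h
  · left; linarith
  · right
    intro hc
    apply hz
    apply Complex.ext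
    · simp at hc ⊢; exact hc
    · exact h.symm

/-- Change of angle along the curve, computed by the triangle homotopy. -/
lemma triangle (c : ℝ → ℝ × ℝ) (hc : ContinuousOn c (Ici 0)) (T : ℝ) (hT : 1 ≤ T)
    (h0 : (c 0).2 = 0) (hnn : ∀ t, 0 ≤ t → 0 ≤ (c t).2)
    (hne : ∀ s t, 0 ≤ s → s + 1 ≤ t → c s ≠ c t)
    (hmax : ∀ t, 0 ≤ t → t ≤ T → (c t).2 ≤ (c T).2) (l : ℝ → ℂ)
    (hl : ContinuousOn l (Icc 0 (T - 1)))
    (hexp : ∀ s ∈ Icc 0 (T - 1), Complex.exp (l s) = toC (c (s + 1) - c s)) :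
    l (T - 1) - l 0 = Complex.log (-Complex.I * toC (c T - c (T - 1)))
      - Complex.log (-Complex.I * toC (c 1 - c 0)) := by
  let K : Set (ℝ × ℝ) := {q | 0 ≤ q.1 ∧ q.1 + 1 ≤ q.2 ∧ q.2 ≤ T}
  let v : ℝ × ℝ → ℂ := fun q => toC (c q.2 - c q.1)
  have hK0 : ((0 : ℝ), (1 : ℝ)) ∈ K := ⟨le_rfl, by norm_num, hT⟩
  have hKc : Convex ℝ K := by
    rintro ⟨s, t⟩ ⟨h1, h2, h3⟩ ⟨s', t'⟩ ⟨h1', h2', h3'⟩ a b ha hb hab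
    simp only at h1 h2 h3 h1' h2' h3'
    simp only [K, mem_ofPred_eq, Prod.smul_mk, Prod.mk_add_mk, smul_eq_mul]
    refine ⟨by positivity, ?_, ?_⟩
    · nlinarith
    · nlinarith
  have hv : ContinuousOn v K := by
    apply toC_cont.comp_continuousOn
    apply ContinuousOn.sub
    · exact hc.comp continuousOn_snd (fun q hq => by
        have := hq.1; have := hq.2.1; simp only [mem_Ici]; linarith)
    · exact hc.comp continuousOn_fst (fun q hq => hq.1)
  have hvne : ∀ q ∈ K, v q ≠ 0 := by
    intro q hq
    apply toC_ne
    rw [sub_ne_zero]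
    exact (hne q.1 q.2 hq.1 hq.2.1).symm
  obtain ⟨M, hM, hMe⟩ := exists_log hK0 (hKc.starConvex hK0) hv hvne
  have c1 : ∀ s ∈ Icc 0 (T - 1), (s, s + 1) ∈ K := fun s hs =>
    ⟨hs.1, le_rfl, by simp only; linarith [hs.2]⟩
  have c2 : ∀ t ∈ Icc 1 T, ((0 : ℝ), t) ∈ K := fun t ht =>
    ⟨le_rfl, by simpa using ht.1, ht.2⟩
  have c3 : ∀ s ∈ Icc 0 (T - 1), (s, T) ∈ K := fun s hs =>
    ⟨hs.1, by simp only; linarith [hs.2], le_rfl⟩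
  have e1 := log_sub_const (isPreconnected_Icc (a := (0 : ℝ)) (b := T - 1)) hl
    (m := fun s => M (s, s + 1)) (hM.comp (by fun_prop) c1)
    (fun s hs => by rw [hexp s hs, hMe _ (c1 s hs)])
    (x := T - 1) (y := 0) (by constructor <;> linarith) (by constructor <;> linarith)
  have hlogc : ∀ (q : ℝ → ℝ × ℝ) (S : Set ℝ), ContinuousOn q S → MapsTo q S K →
      (∀ s ∈ S, 0 ≤ (v (q s)).im) →
      ContinuousOn (fun s => Complex.log (-Complex.I * v (q s)) + Real.pi / 2 * Complex.I) S := by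
    intro q S hq hm hi
    apply ContinuousOn.add _ continuousOn_const
    apply ContinuousOn.clog
    · exact continuousOn_const.mul (hv.comp hq hm)
    · intro s hs
      exact up_slit (hvne _ (hm hs)) (hi s hs)
  have hloge : ∀ q ∈ K, Complex.exp (M q) =
      Complex.exp (Complex.log (-Complex.I * v q) + Real.pi / 2 * Complex.I) := by
    intro q hq
    rw [hMe q hq, Complex.exp_add, Complex.exp_log
      (mul_ne_zero (neg_ne_zero.2 Complex.I_ne_zero) (hvne q hq)), Complex.exp_pi_div_two_mul_I]
    linear_combination (v q) * Complex.I_mul_I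
  have e2 := log_sub_const (isPreconnected_Icc (a := (1 : ℝ)) (b := T))
    (l := fun t => M (0, t)) (hM.comp (by fun_prop) c2)
    (hlogc (fun t => (0, t)) (Icc 1 T) (by fun_prop) c2 (fun t ht => by
      simp only [v, toC, Prod.snd_sub, h0, sub_zero]; exact hnn t (by linarith [ht.1])))
    (fun t ht => hloge _ (c2 t ht))
    (x := T) (y := 1) ⟨hT, le_rfl⟩ ⟨le_rfl, hT⟩
  have e3 := log_sub_const (isPreconnected_Icc (a := (0 : ℝ)) (b := T - 1))
    (l := fun s => M (s, T)) (hM.comp (by fun_prop) c3)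
    (hlogc (fun s => (s, T)) (Icc 0 (T - 1)) (by fun_prop) c3 (fun t ht => by
      simp only [v, toC, Prod.snd_sub, sub_nonneg]; exact hmax t ht.1 (by linarith [ht.2])))
    (fun t ht => hloge _ (c3 t ht))
    (x := T - 1) (y := 0) (by constructor <;> linarith) (by constructor <;> linarith)
  simp only [sub_add_cancel, zero_add, v] at e1 e2 e3
  rw [e1]
  linear_combination e2 + e3

lemma ratio_re (V : ℂ) (hV : V ≠ 0) (β : ℝ) (h : V.im = 0 ∨ |β| < ‖V‖) :
    0 < ((V + β * Complex.I) / V).re := by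
  have hpos : 0 < Complex.normSq V := Complex.normSq_pos.2 hV
  have e : ((V + β * Complex.I) / V).re = (Complex.normSq V + β * V.im) / Complex.normSq V := by
    rw [Complex.div_re]
    simp [Complex.normSq_apply]
    field_simp
    ring
  rw [e]
  apply div_pos _ hpos
  rcases h with h | h
  · rw [h]; simpa using hpos
  · have h1 : |V.im| ≤ ‖V‖ := Complex.abs_im_le_norm V
    have h2 : 0 < ‖V‖ := norm_pos_iff.2 hV
    have h3 : |β * V.im| < Complex.normSq V := by
      rw [abs_mul, Complex.normSq_eq_norm_sq]
      have := abs_nonneg V.im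
      have := abs_nonneg β
      nlinarith
    linarith [(abs_lt.1 h3).1]

lemma arg_rot (r : ℂ) (hr : 0 < r.re) (a : ℝ) (ha : 0 < a) :
    (Complex.log (r * (a * Complex.I))).im = (Complex.log r).im + Real.pi / 2 ∧
    (Complex.log (r * (-(a * Complex.I)))).im = (Complex.log r).im - Real.pi / 2 := by
  have h1 : |r.arg| < Real.pi / 2 := Complex.abs_arg_lt_pi_div_two_iff.2 (Or.inl hr)
  have h2 := abs_lt.1 h1
  have hr0 : r ≠ 0 := by rintro rfl; simp at hr
  have hpi := Real.pi_pos
  have a1 : ((a : ℂ) * Complex.I).arg = Real.pi / 2 := by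
    rw [Complex.arg_real_mul _ ha, Complex.arg_I]
  have a2 : (-((a : ℂ) * Complex.I)).arg = -(Real.pi / 2) := by
    rw [← mul_neg, Complex.arg_real_mul _ ha, Complex.arg_neg_I]
  have n1 : ((a : ℂ) * Complex.I) ≠ 0 := mul_ne_zero (by exact_mod_cast ha.ne') Complex.I_ne_zero
  simp only [Complex.log_im]
  constructor
  · rw [Complex.arg_mul hr0 n1, a1]
    rw [a1]; constructor <;> linarith
  · rw [Complex.arg_mul hr0 (neg_ne_zero.2 n1), a2]
    · ring
    · rw [a2]; constructor <;> linarith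

/-- The main computation: the angle of the displacement drops by `π` from bottom to top. -/
lemma up_lemma (h : Tw F G) (W : C(AddCircle (1 : ℝ), ℝ)) (hW0 : ∀ x, 0 ≤ W x)
    (hW1 : ∀ x, W x ≤ 1)
    (f : Cyl → Cyl) (hlift : ∀ p ∈ stripA, covProj (F p) = f (covProj p))
    (hinv : ∀ U : Set Cyl, U ⊆ annA → MeasurableSet U → volume (f '' U) = volume U)
    (hpos : ∃ x : ℝ, 0 < W x)
    (hZ : ∀ p ∈ stripA, F p = p → W p.1 = 0)
    (hsmall : ∀ p ∈ stripA, F p ≠ p → W (F p).1 < ‖toC (F p - p)‖)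
    (L : ℝ × ℝ → ℂ) (hL : ContinuousOn L {p | p ∈ stripA ∧ F p ≠ p})
    (hLe : ∀ p ∈ stripA, F p ≠ p → Complex.exp (L p) = toC (F p - p)) :
    ∃ x x' : ℝ, (L (x', 1)).im = (L (x, 0)).im - Real.pi := by
  obtain ⟨q, n, hq0, hq1, hn⟩ := escape h W hW0 f hlift hinv hpos
  obtain ⟨c, hc, hs, h0, hnn, hne, t₁, ht₁, h1⟩ := curve h W hW0 q n hq0 hq1 hn
  obtain ⟨T, hT, hmax, htop⟩ := top_time h W hW0 hW1 c hc hs t₁ ht₁ h1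
  let κ : ℝ × ℝ → ℝ × ℝ := fun p => (p.1, cl p.2)
  have hκc : Continuous κ := continuous_fst.prodMk (cl_cont.comp continuous_snd)
  have hκs : ∀ p, κ p ∈ stripA := fun p => strip_cl _ _
  have hκV : ∀ p, hat F p - p = F (κ p) - κ p := by
    intro p
    apply Prod.ext <;> simp [hat, κ]
    ring
  have hκD : ∀ s, 0 ≤ s → F (κ (c s)) ≠ κ (c s) := by
    intro s hs0 he
    have hy0 : 0 < (c s).2 := by
      by_contra hle
      have e : κ (c s) = ((c s).1, 0) := by simp [κ, cl_of_le (not_lt.1 hle)]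
      rw [e] at he
      have := h.t0 (c s).1
      rw [he] at this
      exact lt_irrefl _ this
    have hy1 : (c s).2 < 1 := by
      by_contra hle
      have e : κ (c s) = ((c s).1, 1) := by simp [κ, cl_of_ge (not_lt.1 hle)]
      rw [e] at he
      have := h.t1 (c s).1
      rw [he] at this
      exact lt_irrefl _ this
    have e : κ (c s) = c s := by simp [κ, cl_of_mem hy0.le hy1.le]
    have hst : c s ∈ stripA := mem_strip.2 ⟨hy0.le, hy1.le⟩
    rw [e] at he
    apply hne s (s + 1) hs0 le_rfl
    rw [hs s hs0, Phi_le h W hy1.le, hat_mem hst, he, hZ _ hst he, add_zero]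
  let V : ℝ × ℝ → ℂ := fun p => toC (hat F p - p)
  let Ve : ℝ × ℝ → ℂ := fun p => toC (Phi h W p - p)
  let β : ℝ × ℝ → ℝ := fun p => W (hat F p).1 + max 0 ((hat F p).2 - 1)
  have hVe : ∀ p, Ve p = V p + β p * Complex.I := by
    intro p
    apply Complex.ext
    · simp [Ve, V, β, toC, Phi_apply]
    · simp [Ve, V, β, toC, Phi_apply]; ring
  have hV0 : ∀ s, 0 ≤ s → V (c s) ≠ 0 := by
    intro s hs0
    simp only [V, hκV]
    apply toC_ne
    rw [sub_ne_zero]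
    exact hκD s hs0
  have hre : ∀ s, 0 ≤ s → 0 < (Ve (c s) / V (c s)).re := by
    intro s hs0
    rw [hVe]
    apply ratio_re _ (hV0 s hs0)
    rcases le_total (c s).2 1 with hy | hy
    · right
      have e1 := hat_le1 h hy
      simp only [β, V, hκV]
      rw [max_eq_left (by linarith), add_zero, abs_of_nonneg (hW0 _)]
      exact hsmall _ (hκs _) (hκD s hs0)
    · left
      simp [V, toC, hat_ge1 h hy]
  have hmap : MapsTo (fun s => κ (c s)) (Ici 0) {p | p ∈ stripA ∧ F p ≠ p} :=
    fun s hs0 => ⟨hκs _, hκD s hs0⟩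
  have hVc : Continuous V := toC_cont.comp ((hat_cont h.cF).sub continuous_id)
  have hVec : Continuous Ve := toC_cont.comp ((Phi h W).continuous.sub continuous_id)
  let l : ℝ → ℂ := fun s => L (κ (c s)) + Complex.log (Ve (c s) / V (c s))
  have hl : ContinuousOn l (Ici 0) := by
    apply ContinuousOn.add
    · exact hL.comp (hκc.comp_continuousOn hc) hmap
    · apply ContinuousOn.clog
      · exact (hVec.comp_continuousOn hc).div (hVc.comp_continuousOn hc) (fun s hs0 => hV0 s hs0)
      · intro s hs0
        exact Complex.mem_slitPlane_iff.2 (Or.inl (hre s hs0))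
  have hlexp : ∀ s, 0 ≤ s → Complex.exp (l s) = Ve (c s) := by
    intro s hs0
    have hr0 : Ve (c s) / V (c s) ≠ 0 := by
      intro h0
      have := hre s hs0
      rw [h0] at this
      simp at this
    simp only [l]
    rw [Complex.exp_add, Complex.exp_log hr0, hLe _ (hκs _) (hκD s hs0), ← hκV]
    exact mul_div_cancel₀ _ (hV0 s hs0)
  have hres := triangle c hc T hT h0 hnn hne hmax l (hl.mono fun s hs0 => hs0.1)
    (fun s hs0 => by rw [hlexp s hs0.1, hs s hs0.1])
  have hT1 : c T = Phi h W (c (T - 1)) := by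
    rw [← hs (T - 1) (by linarith), sub_add_cancel]
  have h01 : c 1 = Phi h W (c 0) := by rw [← hs 0 le_rfl, zero_add]
  have hf1 : Complex.log (-Complex.I * toC (c T - c (T - 1)))
      = Complex.log (-Complex.I * Ve (c (T - 1))) := by rw [hT1]
  have hf0 : Complex.log (-Complex.I * toC (c 1 - c 0))
      = Complex.log (-Complex.I * Ve (c 0)) := by rw [h01]
  rw [hf1, hf0] at hres
  have hVT : V (c (T - 1)) = (((F ((c (T - 1)).1, 1)).1 - (c (T - 1)).1 : ℝ) : ℂ) := by
    apply Complex.ext <;> simp [V, toC, hat_ge1 h htop]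
  have hVO : V (c 0) = -(((c 0).1 - (F ((c 0).1, 0)).1 : ℝ) : ℂ) := by
    apply Complex.ext <;> simp [V, toC, hat_le0 h h0.le]
  have r1 := (arg_rot _ (hre (T - 1) (by linarith)) _
    (sub_pos.2 (h.t1 (c (T - 1)).1))).2
  have r0 := (arg_rot _ (hre 0 le_rfl) _ (sub_pos.2 (h.t0 (c 0).1))).1
  have m1 : -Complex.I * Ve (c (T - 1)) = Ve (c (T - 1)) / V (c (T - 1)) *
      (-((((F ((c (T - 1)).1, 1)).1 - (c (T - 1)).1 : ℝ) : ℂ) * Complex.I)) := by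
    rw [← hVT]
    have := hV0 (T - 1) (by linarith)
    field_simp
  have m0 : -Complex.I * Ve (c 0) = Ve (c 0) / V (c 0) *
      ((((c 0).1 - (F ((c 0).1, 0)).1 : ℝ) : ℂ) * Complex.I) := by
    have e : ((((c 0).1 - (F ((c 0).1, 0)).1 : ℝ) : ℂ)) = - V (c 0) := by rw [hVO, neg_neg]
    rw [e]
    have := hV0 0 le_rfl
    field_simp
  rw [m1, m0] at hres
  have him := congrArg Complex.im hres
  simp only [Complex.sub_im, l, Complex.add_im] at him
  rw [r1, r0] at him
  refine ⟨(c 0).1, (c (T - 1)).1, ?_⟩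
  have k0 : κ (c 0) = ((c 0).1, 0) := by simp [κ, cl_of_le h0.le]
  have k1 : κ (c (T - 1)) = ((c (T - 1)).1, 1) := by simp [κ, cl_of_ge htop]
  rw [k0, k1] at him
  linarith

lemma per_int (h : Tw F G) {p : ℝ × ℝ} (hp : p ∈ stripA) (k : ℤ) :
    F (p + ((k : ℝ), 0)) = F p + ((k : ℝ), 0) := by
  have key : ∀ p ∈ stripA, Phi h 0 p = F p := by
    intro p hp
    rw [Phi_le h 0 (mem_strip.1 hp).2, hat_mem hp]
    simp
  have hp' : p + ((k : ℝ), 0) ∈ stripA := by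
    rw [mem_strip] at hp ⊢; simpa using hp
  rw [← key _ hp', ← key _ hp, Phi_per_int]

lemma line_const {S : Set ℝ} (hS : IsPreconnected S) {l : ℝ → ℂ} {r : ℝ → ℝ} {σ : ℂ} (hσ : σ ≠ 0)
    (hl : ContinuousOn l S) (hr : ContinuousOn r S) (hpos : ∀ x ∈ S, 0 < r x)
    (he : ∀ x ∈ S, Complex.exp (l x) = σ * r x) {x y : ℝ} (hx : x ∈ S) (hy : y ∈ S) :
    l x - l y = ((Real.log (r x) - Real.log (r y) : ℝ) : ℂ) := by
  have := log_sub_const hS hl (m := fun x => Complex.log σ + (Real.log (r x) : ℂ))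
    (continuousOn_const.add (Complex.continuous_ofReal.comp_continuousOn
      (hr.log fun x hx => (hpos x hx).ne'))) (fun x hx => by
      rw [he x hx, Complex.exp_add, Complex.exp_log hσ, ← Complex.ofReal_exp,
        Real.exp_log (hpos x hx)]) hx hy
  rw [this]
  push_cast
  ring

lemma bot_V (h : Tw F G) (x : ℝ) :
    toC (F (x, 0) - (x, 0)) = (-1 : ℂ) * ((x - (F (x, 0)).1 : ℝ) : ℂ) := by
  apply Complex.ext <;> simp [toC, h.b0]

lemma top_V (h : Tw F G) (x : ℝ) :
    toC (F (x, 1) - (x, 1)) = (1 : ℂ) * (((F (x, 1)).1 - x : ℝ) : ℂ) := by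
  apply Complex.ext <;> simp [toC, h.b1]

lemma bot_ne (h : Tw F G) (x : ℝ) : F (x, 0) ≠ (x, 0) := by
  intro he; have := h.t0 x; rw [he] at this; exact lt_irrefl _ this

lemma top_ne (h : Tw F G) (x : ℝ) : F (x, 1) ≠ (x, 1) := by
  intro he; have := h.t1 x; rw [he] at this; exact lt_irrefl _ this

lemma s0 (x : ℝ) : (x, (0 : ℝ)) ∈ stripA := mem_strip.2 (by norm_num)
lemma s1 (x : ℝ) : (x, (1 : ℝ)) ∈ stripA := mem_strip.2 (by norm_num)

lemma bot_const (h : Tw F G) {S : Set ℝ} (hS : IsPreconnected S) {L : ℝ × ℝ → ℂ}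
    (hL : ContinuousOn (fun x => L (x, 0)) S)
    (hLe : ∀ x ∈ S, Complex.exp (L (x, 0)) = toC (F (x, 0) - (x, 0)))
    {x y : ℝ} (hx : x ∈ S) (hy : y ∈ S) : L (x, 0) - L (y, 0) =
      ((Real.log (x - (F (x, 0)).1) - Real.log (y - (F (y, 0)).1) : ℝ) : ℂ) :=
  line_const hS (σ := -1) (by norm_num) hL
    (continuous_id.sub (h.cont_line le_rfl zero_le_one).fst).continuousOn
    (fun x _ => sub_pos.2 (h.t0 x)) (fun x hx => by rw [hLe x hx, bot_V h]; rfl) hx hy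

lemma top_const (h : Tw F G) {S : Set ℝ} (hS : IsPreconnected S) {L : ℝ × ℝ → ℂ}
    (hL : ContinuousOn (fun x => L (x, 1)) S)
    (hLe : ∀ x ∈ S, Complex.exp (L (x, 1)) = toC (F (x, 1) - (x, 1)))
    {x y : ℝ} (hx : x ∈ S) (hy : y ∈ S) : L (x, 1) - L (y, 1) =
      ((Real.log ((F (x, 1)).1 - x) - Real.log ((F (y, 1)).1 - y) : ℝ) : ℂ) :=
  line_const hS (σ := 1) (by norm_num) hL
    ((h.cont_line zero_le_one le_rfl).fst.sub continuous_id).continuousOn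
    (fun x _ => sub_pos.2 (h.t1 x)) (fun x hx => by rw [hLe x hx, top_V h]; rfl) hx hy

/-- A global continuous logarithm of the displacement off the fixed points. -/
lemma exists_L (h : Tw F G) (z : ℝ × ℝ)
    (hz0 : 0 < z.2) (hz1 : z.2 < 1)
    (hfix : ∀ p ∈ stripA, F p = p → ∃ k : ℤ, p = z + ((k : ℝ), 0)) :
    ∃ L : ℝ × ℝ → ℂ, ContinuousOn L {p | p ∈ stripA ∧ F p ≠ p} ∧
      ∀ p ∈ stripA, F p ≠ p → Complex.exp (L p) = toC (F p - p) := by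
  let B : Set (ℝ × ℝ) := {p | (p ∈ stripA ∧ F p ≠ p) ∧ z.1 ≤ p.1 ∧ p.1 ≤ z.1 + 1}
  have hin : ∀ p ∈ stripA, z.1 < p.1 → p.1 < z.1 + 1 → F p ≠ p := by
    intro p hp h1 h2 he
    obtain ⟨k, hk⟩ := hfix p hp he
    have e : p.1 = z.1 + k := by rw [hk]; simp
    rw [e] at h1 h2
    have h3 : (0 : ℝ) < k := by linarith
    have h4 : (k : ℝ) < 1 := by linarith
    have h5 : 0 < k := by exact_mod_cast h3
    have h6 : k < 1 := by exact_mod_cast h4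
    omega
  have hvne : ∀ p ∈ stripA, p.2 ≠ z.2 → F p ≠ p := by
    intro p hp h1 he
    obtain ⟨k, hk⟩ := hfix p hp he
    apply h1
    rw [hk]; simp
  have hc0 : (z.1 + 1 / 2, z.2) ∈ B := by
    have hm : (z.1 + 1 / 2, z.2) ∈ stripA := mem_strip.2 ⟨hz0.le, hz1.le⟩
    exact ⟨⟨hm, hin _ hm (by simp) (by simp; norm_num)⟩, by simp, by simp; norm_num⟩
  have hstar : StarConvex ℝ (z.1 + 1 / 2, z.2) B := by
    rintro ⟨x, y⟩ hp a b ha hb hab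
    rcases ha.eq_or_lt with ha | ha
    · have : b = 1 := by linarith
      rw [← ha, this]
      simpa using hp
    · obtain ⟨⟨hs, -⟩, hx0, hx1⟩ := hp
      have hs := mem_strip.1 hs
      simp only at hs hx0 hx1
      have hm : a • (z.1 + 1 / 2, z.2) + b • (x, y) ∈ stripA := by
        rw [mem_strip]
        simp only [Prod.smul_mk, Prod.mk_add_mk, smul_eq_mul]
        constructor
        · have := mul_nonneg ha.le hz0.le
          have := mul_nonneg hb hs.1
          linarith
        · nlinarith
      have hb' : b = 1 - a := by linarith
      have e1 : z.1 < (a • (z.1 + 1 / 2, z.2) + b • (x, y) : ℝ × ℝ).1 := by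
        simp only [Prod.smul_mk, Prod.mk_add_mk, smul_eq_mul]
        have := mul_le_mul_of_nonneg_left hx0 hb
        have e : a * z.1 + b * z.1 = z.1 := by rw [← add_mul, hab, one_mul]
        have e4 : a * (z.1 + 1 / 2) = a * z.1 + a / 2 := by ring
        linarith
      have e2 : (a • (z.1 + 1 / 2, z.2) + b • (x, y) : ℝ × ℝ).1 < z.1 + 1 := by
        simp only [Prod.smul_mk, Prod.mk_add_mk, smul_eq_mul]
        have := mul_le_mul_of_nonneg_left hx1 hb
        have e : a * z.1 + b * z.1 = z.1 := by rw [← add_mul, hab, one_mul]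
        have e4 : a * (z.1 + 1 / 2) = a * z.1 + a / 2 := by ring
        have e5 : b * (z.1 + 1) = b * z.1 + b := by ring
        linarith
      exact ⟨⟨hm, hin _ hm e1 e2⟩, e1.le, e2.le⟩
  obtain ⟨M, hM, hMe⟩ := exists_log (v := fun p => toC (F p - p)) hc0 hstar
    (toC_cont.comp_continuousOn ((h.cF.mono fun p hp => hp.1.1).sub continuousOn_id))
    (fun p hp => toC_ne (sub_ne_zero.2 hp.1.2))
  have hper : ∀ y, (z.1, y) ∈ stripA → F (z.1 + 1, y) = F (z.1, y) + (1, 0) := by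
    intro y hy
    have := per_int h hy 1
    simpa using this
  have hsh : ∀ y, (z.1, y) ∈ stripA → F (z.1, y) ≠ (z.1, y) →
      (z.1, y) ∈ B ∧ (z.1 + 1, y) ∈ B := by
    intro y hy hne
    refine ⟨⟨⟨hy, hne⟩, le_rfl, by simp⟩, ⟨⟨mem_strip.2 (mem_strip.1 hy), ?_⟩, by simp, le_rfl⟩⟩
    intro he
    rw [hper y hy] at he
    apply hne
    have : ((z.1 + 1, y) : ℝ × ℝ) = (z.1, y) + (1, 0) := by simp
    rw [this] at he
    exact add_right_cancel he
  have hseg : ∀ S : Set ℝ, IsPreconnected S →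
      (∀ y ∈ S, (z.1, y) ∈ stripA ∧ F (z.1, y) ≠ (z.1, y)) → ∀ y ∈ S, ∀ y' ∈ S,
      M (z.1, y) - M (z.1, y') = M (z.1 + 1, y) - M (z.1 + 1, y') := by
    intro S hS hm y hy y' hy'
    refine log_sub_const hS (l := fun y => M (z.1, y)) (m := fun y => M (z.1 + 1, y))
      (hM.comp (by fun_prop) fun y hy => (hsh y (hm y hy).1 (hm y hy).2).1)
      (hM.comp (by fun_prop) fun y hy => (hsh y (hm y hy).1 (hm y hy).2).2) ?_ hy hy'
    intro y hy
    rw [hMe _ (hsh y (hm y hy).1 (hm y hy).2).1, hMe _ (hsh y (hm y hy).1 (hm y hy).2).2,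
      hper y (hm y hy).1]
    congr 1
    ext <;> simp
  have hb0 : M (z.1, 0) = M (z.1 + 1, 0) := by
    have hm : ∀ x ∈ Icc z.1 (z.1 + 1), (x, (0 : ℝ)) ∈ B := fun x hx =>
      ⟨⟨s0 x, bot_ne h x⟩, hx.1, hx.2⟩
    have := bot_const h (isPreconnected_Icc (a := z.1) (b := z.1 + 1)) (L := M)
      (hM.comp (by fun_prop) hm) (fun x hx => hMe _ (hm x hx)) (x := z.1) (y := z.1 + 1)
      (by simp) (by simp)
    rw [hper 0 (s0 _)] at this
    simp at this
    exact sub_eq_zero.1 this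
  have hb1 : M (z.1, 1) = M (z.1 + 1, 1) := by
    have hm : ∀ x ∈ Icc z.1 (z.1 + 1), (x, (1 : ℝ)) ∈ B := fun x hx =>
      ⟨⟨s1 x, top_ne h x⟩, hx.1, hx.2⟩
    have := top_const h (isPreconnected_Icc (a := z.1) (b := z.1 + 1)) (L := M)
      (hM.comp (by fun_prop) hm) (fun x hx => hMe _ (hm x hx)) (x := z.1) (y := z.1 + 1)
      (by simp) (by simp)
    rw [hper 1 (s1 _)] at this
    simp at this
    exact sub_eq_zero.1 this
  have hedge : ∀ y, (z.1, y) ∈ stripA → F (z.1, y) ≠ (z.1, y) → M (z.1, y) = M (z.1 + 1, y) := by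
    intro y hy hne
    have hy' := mem_strip.1 hy
    simp only at hy'
    rcases le_total y z.2 with hle | hle
    · have := hseg (Icc 0 y) isPreconnected_Icc (fun u hu => by
        have hm : (z.1, u) ∈ stripA := mem_strip.2 ⟨hu.1, hu.2.trans hy'.2⟩
        refine ⟨hm, ?_⟩
        rcases hu.2.eq_or_lt with e | e
        · rw [e]; exact hne
        · exact hvne _ hm (by simp only; linarith)) y ⟨hy'.1, le_rfl⟩ 0 ⟨le_rfl, hy'.1⟩
      rw [hb0] at this
      exact sub_left_injective this
    · have := hseg (Icc y 1) isPreconnected_Icc (fun u hu => by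
        have hm : (z.1, u) ∈ stripA := mem_strip.2 ⟨hy'.1.trans hu.1, hu.2⟩
        refine ⟨hm, ?_⟩
        rcases hu.1.eq_or_lt with e | e
        · rw [← e]; exact hne
        · exact hvne _ hm (by simp only; linarith)) y ⟨le_rfl, hy'.2⟩ 1 ⟨hy'.2, le_rfl⟩
      rw [hb1] at this
      exact sub_left_injective this
  have hshift : ∀ p ∈ stripA, F p ≠ p → ∀ k : ℤ, ((p.1 - k, p.2) : ℝ × ℝ) ∈ stripA ∧
      F (p.1 - k, p.2) ≠ (p.1 - k, p.2) ∧
      F (p.1 - k, p.2) - (p.1 - k, p.2) = F p - p := by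
    intro p hp hne k
    have e : ((p.1 - k, p.2) : ℝ × ℝ) = p + (((-k : ℤ) : ℝ), 0) := by
      ext <;> simp; ring
    have e2 : F (p.1 - k, p.2) - (p.1 - k, p.2) = F p - p := by
      rw [e, per_int h hp]; abel
    refine ⟨mem_strip.2 (mem_strip.1 hp), ?_, e2⟩
    rw [← sub_ne_zero, e2, sub_ne_zero]
    exact hne
  refine ⟨fun p => M (p.1 - (⌊p.1 - z.1⌋ : ℤ), p.2), ?_, ?_⟩
  · apply glue (r := fun p => p.1 - z.1) (by fun_prop)
    intro k
    have hm : MapsTo (fun p : ℝ × ℝ => ((p.1 - k, p.2) : ℝ × ℝ))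
        {x | x ∈ {p | p ∈ stripA ∧ F p ≠ p} ∧ (k : ℝ) ≤ x.1 - z.1 ∧ x.1 - z.1 ≤ k + 1} B := by
      rintro p ⟨⟨hp, hne⟩, h1, h2⟩
      have := hshift p hp hne k
      exact ⟨⟨this.1, this.2.1⟩, by simp only; linarith, by simp only; linarith⟩
    refine (hM.comp (by fun_prop) hm).congr ?_
    rintro p ⟨⟨hp, hne⟩, h1, h2⟩
    simp only [Function.comp]
    rcases h2.eq_or_lt with h2 | h2
    · have hfl : ⌊p.1 - z.1⌋ = k + 1 := by
        rw [h2]; exact_mod_cast Int.floor_intCast (R := ℝ) (k + 1)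
      rw [hfl]
      have := hshift p hp hne (k + 1)
      have e1 : p.1 - ((k + 1 : ℤ) : ℝ) = z.1 := by push_cast; linarith
      have e2 : p.1 - (k : ℝ) = z.1 + 1 := by linarith
      rw [e1] at this
      rw [e1, e2]
      exact hedge _ this.1 this.2.1
    · have hfl : ⌊p.1 - z.1⌋ = k := Int.floor_eq_iff.2 ⟨h1, h2⟩
      rw [hfl]
  · intro p hp hne
    have := hshift p hp hne ⌊p.1 - z.1⌋
    have f1 := Int.floor_le (p.1 - z.1)
    have f2 := Int.lt_floor_add_one (p.1 - z.1)
    rw [hMe _ ⟨⟨this.1, this.2.1⟩, by simp only; linarith, by simp only; linarith⟩, this.2.2]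

/-- Existence of the small perturbation, combined with the main computation. -/
lemma core (h : Tw F G) (z : ℝ × ℝ)
    (hfix : ∀ p ∈ stripA, F p = p → ∃ k : ℤ, p = z + ((k : ℝ), 0))
    (f : Cyl → Cyl) (hlift : ∀ p ∈ stripA, covProj (F p) = f (covProj p))
    (hinv : ∀ U : Set Cyl, U ⊆ annA → MeasurableSet U → volume (f '' U) = volume U)
    (L : ℝ × ℝ → ℂ) (hL : ContinuousOn L {p | p ∈ stripA ∧ F p ≠ p})
    (hLe : ∀ p ∈ stripA, F p ≠ p → Complex.exp (L p) = toC (F p - p)) :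
    ∃ x x' : ℝ, (L (x', 1)).im = (L (x, 0)).im - Real.pi := by
  let N : AddCircle (1 : ℝ) → ℝ := fun θ => ‖θ - (z.1 : AddCircle (1 : ℝ))‖
  have hN : Continuous N := by fun_prop
  have hfixN : ∀ p ∈ stripA, F p = p → N p.1 = 0 := by
    intro p hp he
    obtain ⟨k, hk⟩ := hfix p hp he
    have := congrArg Prod.fst (covProj_add z k)
    rw [← hk] at this
    simp only [covProj] at this
    simp only [N, this, sub_self, norm_zero]
  let C : Set (ℝ × ℝ) := (Icc 0 1 ×ˢ Icc 0 1) ∩ (fun p => N ((F p).1 : ℝ)) ⁻¹' Ici (1 / 4)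
  have hsub : (Icc 0 1 ×ˢ Icc 0 1 : Set (ℝ × ℝ)) ⊆ stripA := fun p hp => ⟨trivial, hp.2⟩
  have hCc : IsCompact C := by
    have hcl : IsClosed C := by
      refine ContinuousOn.preimage_isClosed_of_isClosed ?_ (isClosed_Icc.prod isClosed_Icc)
        isClosed_Ici
      exact hN.comp_continuousOn ((AddCircle.continuous_mk' 1).comp_continuousOn
        (continuous_fst.comp_continuousOn (h.cF.mono hsub)))
    exact (isCompact_Icc.prod isCompact_Icc).of_isClosed_subset hcl inter_subset_left
  obtain ⟨m, hm0, hm⟩ := hCc.exists_forall_le' (f := fun p => ‖toC (F p - p)‖) (a := 0)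
    ((toC_cont.comp_continuousOn
      ((h.cF.mono (inter_subset_left.trans hsub)).sub continuousOn_id)).norm) (by
      intro p hp
      apply norm_pos_iff.2
      apply toC_ne
      rw [sub_ne_zero]
      intro he
      have h1 := hfixN p (hsub hp.1) he
      have h2 : (1 / 4 : ℝ) ≤ N ((F p).1 : ℝ) := hp.2
      rw [he, h1] at h2
      norm_num at h2)
  have hm' : ∀ p ∈ stripA, 1 / 4 ≤ N ((F p).1 : ℝ) → m ≤ ‖toC (F p - p)‖ := by
    intro p hp hq
    set k := ⌊p.1⌋
    have e : F (p + (((-k : ℤ) : ℝ), 0)) = F p + (((-k : ℤ) : ℝ), 0) := per_int h hp (-k)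
    have := hm (p + (((-k : ℤ) : ℝ), 0)) ⟨⟨?_, ?_⟩, ?_⟩
    · rw [e] at this
      simpa using this
    · have f1 := Int.floor_le p.1
      have f2 := Int.lt_floor_add_one p.1
      constructor
      · simp only [Prod.fst_add]; push_cast; linarith
      · simp only [Prod.fst_add]; push_cast; linarith
    · simpa using mem_strip.1 hp
    · have := congrArg Prod.fst (covProj_add (F p) (-k))
      simp only [covProj] at this
      simp only [mem_preimage, mem_Ici]
      rw [e, this]
      exact hq
  have hNle : ∀ θ, N θ ≤ 1 / 2 := by
    intro θ
    have := AddCircle.norm_le_half_period (1 : ℝ) (x := θ - (z.1 : AddCircle (1 : ℝ))) one_ne_zero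
    simpa using this
  set ε := min 1 m with hε
  have hε0 : 0 < ε := lt_min one_pos hm0
  let W : C(AddCircle (1 : ℝ), ℝ) := ⟨fun θ => ε * max 0 (N θ - 1 / 4), by fun_prop⟩
  have hWle : ∀ θ, W θ ≤ ε * (1 / 4) := fun θ =>
    mul_le_mul_of_nonneg_left (max_le (by norm_num) (by linarith [hNle θ])) hε0.le
  have hW0 : ∀ θ, 0 ≤ W θ := fun θ => mul_nonneg hε0.le (le_max_left _ _)
  refine up_lemma h W hW0 ?_ f hlift hinv ?_ ?_ ?_ L hL hLe
  · intro θ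
    have := hWle θ
    have := min_le_left 1 m
    linarith
  · refine ⟨z.1 + 1 / 2, ?_⟩
    have : N ((z.1 + 1 / 2 : ℝ) : AddCircle (1 : ℝ)) = 1 / 2 := by
      simp only [N]
      rw [← AddCircle.coe_sub, add_sub_cancel_left]
      have := AddCircle.norm_half_period_eq (1 : ℝ)
      simpa using this
    simp only [W, ContinuousMap.coe_mk, this]
    apply mul_pos hε0
    norm_num
  · intro p hp he
    simp only [W, ContinuousMap.coe_mk, hfixN p hp he]
    norm_num
  · intro p hp hne
    rcases le_or_gt (1 / 4) (N ((F p).1 : ℝ)) with hq | hq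
    · have h1 := hm' p hp hq
      have h2 := hWle (F p).1
      have h3 := min_le_right 1 m
      linarith
    · have : W ((F p).1 : ℝ) = 0 := by
        simp only [W, ContinuousMap.coe_mk]
        rw [max_eq_left (by linarith), mul_zero]
      rw [this]
      exact norm_pos_iff.2 (toC_ne (sub_ne_zero.2 hne))

/-- The half turn of the strip. -/
def R (p : ℝ × ℝ) : ℝ × ℝ := (-p.1, 1 - p.2)

lemma R_R (p : ℝ × ℝ) : R (R p) = p := by simp [R]
lemma R_cont : Continuous R := by unfold R; fun_prop
lemma R_strip {p : ℝ × ℝ} (hp : p ∈ stripA) : R p ∈ stripA := by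
  have := mem_strip.1 hp
  exact mem_strip.2 ⟨by simp only [R]; linarith, by simp only [R]; linarith⟩

lemma Tw.rot (h : Tw F G) : Tw (fun p => R (F (R p))) (fun p => R (G (R p))) where
  cF := R_cont.comp_continuousOn (h.cF.comp R_cont.continuousOn fun _ hp => R_strip hp)
  cG := R_cont.comp_continuousOn (h.cG.comp R_cont.continuousOn fun _ hp => R_strip hp)
  mF := fun _ hp => R_strip (h.mF (R_strip hp))
  mG := fun _ hp => R_strip (h.mG (R_strip hp))
  GF := fun p hp => by simp only [R_R, h.GF _ (R_strip hp)]
  FG := fun p hp => by simp only [R_R, h.FG _ (R_strip hp)]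
  per := fun p hp => by
    have e : R (p.1 + 1, p.2) = R p + (((-1 : ℤ) : ℝ), 0) := by
      simp [R]; ring
    rw [e, per_int h (R_strip hp)]
    simp [R]
    ring
  b0 := fun x => by simp [R, h.b1]
  b1 := fun x => by simp [R, h.b0]
  t0 := fun x => by
    have := h.t1 (-x)
    simp [R]; linarith
  t1 := fun x => by
    have := h.t0 (-x)
    simp [R]; linarith

/-- The half turn of the annulus. -/
def rho (z : Cyl) : Cyl := (-z.1, 1 - z.2)

lemma rho_inv : Function.Involutive rho := by intro z; simp [rho]

lemma rho_mp : MeasurePreserving rho volume volume :=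
  (Measure.measurePreserving_neg (volume : Measure (AddCircle (1 : ℝ)))).prod
    (Measure.measurePreserving_sub_left (volume : Measure ℝ) 1)

lemma rho_cov (p : ℝ × ℝ) : covProj (R p) = rho (covProj p) := by
  simp [covProj, R, rho]

lemma rho_vol (S : Set Cyl) : volume (rho '' S) = volume S := by
  rw [rho_inv.image_eq_preimage_symm]
  exact rho_mp.measure_preimage_equiv (f := MeasurableEquiv.ofInvolutive rho rho_inv
    rho_mp.measurable) S

end PB

/-- **Poincaré's Last Geometric Theorem (Corollary 1).** If `f : A → A` is a C¹
diffeomorphism of the standard annulus mapping each boundary component to itself, is a twist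
map, and preserves Lebesgue measure (area) on `A`, then `f` has at least two fixed points. -/
theorem poincare_last_geometric_theorem
    (f : Cyl → Cyl) (F G : ℝ × ℝ → ℝ × ℝ)
    -- `F` is a lift of `f`: `π ∘ f̃ = f ∘ π`
    (hlift : ∀ p ∈ stripA, covProj (F p) = f (covProj p))
    -- equivariance of the lift: `f̃(x+1, y) = f̃(x, y) + (1, 0)`
    (hper : ∀ p ∈ stripA, F (p.1 + 1, p.2) = ((F p).1 + 1, (F p).2))
    -- `f` is a C¹ diffeomorphism (through its lift): C¹, bijective on the strip,
    -- with a C¹ inverse lift `G`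
    (hFC1 : ContDiffOn ℝ 1 F stripA)
    (hFbij : Set.BijOn F stripA stripA)
    (hGC1 : ContDiffOn ℝ 1 G stripA)
    (hGmaps : Set.MapsTo G stripA stripA)
    (hGF : ∀ p ∈ stripA, G (F p) = p)
    (hFG : ∀ p ∈ stripA, F (G p) = p)
    -- each boundary component is mapped to itself
    (hbdry0 : ∀ x : ℝ, (F (x, 0)).2 = 0)
    (hbdry1 : ∀ x : ℝ, (F (x, 1)).2 = 1)
    -- twist condition for the normalized lift
    (htwist0 : ∀ x : ℝ, (F (x, 0)).1 < x)
    (htwist1 : ∀ x : ℝ, x < (F (x, 1)).1)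
    -- `f` preserves Lebesgue measure (area) on `A`
    (hinv : ∀ U : Set Cyl, U ⊆ annA → MeasurableSet U → volume (f '' U) = volume U) :
    ∃ a b : Cyl, a ∈ annA ∧ b ∈ annA ∧ f a = a ∧ f b = b ∧ a ≠ b := by
  classical
  by_contra hcon
  push Not at hcon
  have h : PB.Tw F G :=
    { cF := hFC1.continuousOn, cG := hGC1.continuousOn, mF := hFbij.mapsTo, mG := hGmaps,
      GF := hGF, FG := hFG, per := hper, b0 := hbdry0, b1 := hbdry1, t0 := htwist0,
      t1 := htwist1 }
  have hann : ∀ p ∈ stripA, covProj p ∈ annA := fun p hp => ⟨trivial, hp.2⟩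
  have hz : ∃ z : ℝ × ℝ, 0 < z.2 ∧ z.2 < 1 ∧
      ∀ p ∈ stripA, F p = p → ∃ k : ℤ, p = z + ((k : ℝ), 0) := by
    by_cases hex : ∃ z ∈ stripA, F z = z
    · obtain ⟨z, hzs, hz⟩ := hex
      have hzm := PB.mem_strip.1 hzs
      refine ⟨z, lt_of_le_of_ne hzm.1 ?_, lt_of_le_of_ne hzm.2 ?_, ?_⟩
      · intro h0
        have e : z = (z.1, 0) := Prod.ext rfl h0.symm
        rw [e] at hz
        exact PB.bot_ne h _ hz
      · intro h0
        have e : z = (z.1, 1) := Prod.ext rfl h0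
        rw [e] at hz
        exact PB.top_ne h _ hz
      · intro p hp he
        apply PB.covProj_eq
        refine hcon _ _ (hann p hp) (hann z hzs) ?_ ?_
        · rw [← hlift p hp, he]
        · rw [← hlift z hzs, hz]
    · refine ⟨(0, 1 / 2), by norm_num, by norm_num, fun p hp he => ?_⟩
      exact absurd ⟨p, hp, he⟩ hex
  obtain ⟨z, hz0, hz1, hfix⟩ := hz
  obtain ⟨L, hL, hLe⟩ := PB.exists_L h z hz0 hz1 hfix
  obtain ⟨x, x', hA⟩ := PB.core h z hfix f hlift hinv L hL hLe
  have hneR : ∀ p, PB.R (F (PB.R p)) ≠ p → F (PB.R p) ≠ PB.R p := by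
    intro p hne he
    apply hne
    rw [he, PB.R_R]
  have hrhoA : ∀ U ⊆ annA, PB.rho '' U ⊆ annA := by
    rintro U hU _ ⟨u, hu, rfl⟩
    have := (hU hu).2
    exact ⟨trivial, by simp only [PB.rho]; linarith [this.2], by simp only [PB.rho]; linarith [this.1]⟩
  obtain ⟨y, y', hB⟩ := PB.core h.rot (PB.R z) (by
      intro p hp he
      have he' : F (PB.R p) = PB.R p := by rw [← PB.R_R (F (PB.R p)), he]
      obtain ⟨k, hk⟩ := hfix _ (PB.R_strip hp) he'
      refine ⟨-k, ?_⟩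
      rw [← PB.R_R p, hk]
      simp [PB.R]
      ring)
    (fun w => PB.rho (f (PB.rho w)))
    (fun p hp => by rw [PB.rho_cov, hlift _ (PB.R_strip hp), PB.rho_cov])
    (by
      intro U hU hUm
      have e : (fun w => PB.rho (f (PB.rho w))) '' U = PB.rho '' (f '' (PB.rho '' U)) := by
        simp only [image_image]
      have hm : MeasurableSet (PB.rho '' U) := by
        rw [PB.rho_inv.image_eq_preimage_symm]
        exact PB.rho_mp.measurable hUm
      rw [e, PB.rho_vol, hinv _ (hrhoA U hU) hm, PB.rho_vol])
    (fun p => L (PB.R p) + Real.pi * Complex.I)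
    (by
      apply ContinuousOn.add _ continuousOn_const
      exact hL.comp PB.R_cont.continuousOn fun p hp => ⟨PB.R_strip hp.1, hneR p hp.2⟩)
    (by
      intro p hp hne
      rw [Complex.exp_add, hLe _ (PB.R_strip hp) (hneR p hne), Complex.exp_pi_mul_I]
      apply Complex.ext <;> simp [PB.toC, PB.R] <;> ring)
  have hbc : ∀ a b : ℝ, (L (a, 0)).im = (L (b, 0)).im := by
    intro a b
    have := PB.bot_const h isPreconnected_univ (L := L)
      (hL.comp (by fun_prop) fun x _ => ⟨PB.s0 x, PB.bot_ne h x⟩)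
      (fun x _ => hLe _ (PB.s0 x) (PB.bot_ne h x)) (mem_univ a) (mem_univ b)
    have := congrArg Complex.im this
    rw [Complex.sub_im, Complex.ofReal_im] at this
    linarith
  have htc : ∀ a b : ℝ, (L (a, 1)).im = (L (b, 1)).im := by
    intro a b
    have := PB.top_const h isPreconnected_univ (L := L)
      (hL.comp (by fun_prop) fun x _ => ⟨PB.s1 x, PB.top_ne h x⟩)
      (fun x _ => hLe _ (PB.s1 x) (PB.top_ne h x)) (mem_univ a) (mem_univ b)
    have := congrArg Complex.im this
    rw [Complex.sub_im, Complex.ofReal_im] at this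
    linarith
  simp [PB.R] at hB
  rw [hbc _ x, htc _ x'] at hB
  have := Real.pi_pos
  linarith
end
end
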